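/- arXiv:2508.19435 — 3 statements merged into one kernel-verified Lean document; each statement's English description precedes it below -/
import Mathlib

section
/- For every integer s > 2, wsat(2s+1, K_{s,s}) = C(2s+1, 2) − (4s − 4). -/
open SimpleGraph

/-- `G` contains a copy of `F`. -/
def ContainsCopy {W V : Type*} (F : SimpleGraph W) (G : SimpleGraph V) : Prop :=
  ∃ f : W ↪ V, ∀ a b, F.Adj a b → G.Adj (f a) (f b)

/-- One step of the weak saturation process: add one missing edge `e` so that the new
graph contains a copy of `F` through `e`. -/
def AddStep {W V : Type*} (F : SimpleGraph W) (G G' : SimpleGraph V) : Prop :=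
  ∃ e, e ∉ G.edgeSet ∧ G'.edgeSet = insert e G.edgeSet ∧
    ∃ f : W ↪ V, (∀ a b, F.Adj a b → G'.Adj (f a) (f b)) ∧
      ∃ a b, F.Adj a b ∧ s(f a, f b) = e

/-- `G` is weakly `F`-saturated. -/
def IsWeaklySaturated {W V : Type*} (F : SimpleGraph W) (G : SimpleGraph V) : Prop :=
  ¬ ContainsCopy F G ∧
  ∃ (m : ℕ) (c : ℕ → SimpleGraph V), c 0 = G ∧ c m = ⊤ ∧
    ∀ i < m, AddStep F (c i) (c (i + 1))

/-- The weak saturation number `wsat(n, F)`. -/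
noncomputable def wsat {W : Type*} (n : ℕ) (F : SimpleGraph W) : ℕ :=
  sInf {m | ∃ G : SimpleGraph (Fin n), IsWeaklySaturated F G ∧ G.edgeSet.ncard = m}

open Finset in
/-- Dismantlable sets of edges (complements of weakly saturated graphs). -/
inductive Dis {α : Type*} [DecidableEq α] (V : Finset α) (s : ℕ) : Finset (Sym2 α) → Prop
  | empty : Dis V s ∅
  | step (E : Finset (Sym2 α)) (A B : Finset α) (x y : α) (hE : Dis V s E) (hA : A ⊆ V)
      (hB : B ⊆ V) (hAB : Disjoint A B) (cA : A.card = s) (cB : B.card = s) (hx : x ∈ A)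
      (hy : y ∈ B) (hno : ∀ a ∈ A, ∀ b ∈ B, s(a, b) ∉ E) : Dis V s (insert s(x, y) E)

section Lower
variable {α : Type*} [DecidableEq α]

/-- number of edges of `E` inside `S` -/
def ec (E : Finset (Sym2 α)) (S : Finset α) : ℕ := (E ∩ S.sym2).card

lemma ec_insert_le (E : Finset (Sym2 α)) (S : Finset α) (e : Sym2 α) :
    ec (insert e E) S ≤ ec E S + 1 := by
  unfold ec
  refine (Finset.card_le_card (t := insert e (E ∩ S.sym2)) ?_).trans (Finset.card_insert_le _ _)
  intro z hz
  simp only [Finset.mem_inter, Finset.mem_insert] at *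
  tauto

lemma ec_insert_of_not (E : Finset (Sym2 α)) (S : Finset α) (x y : α) (h : ¬ (x ∈ S ∧ y ∈ S)) :
    ec (insert s(x, y) E) S ≤ ec E S := by
  unfold ec
  refine Finset.card_le_card ?_
  intro z hz
  simp only [Finset.mem_inter, Finset.mem_insert] at *
  rcases hz with ⟨rfl | h1, h2⟩
  · exact absurd (Finset.mk_mem_sym2_iff.1 h2) h
  · exact ⟨h1, h2⟩

lemma ec_cut (E : Finset (Sym2 α)) (S A B : Finset α) (hAB : Disjoint A B)
    (hno : ∀ a ∈ A, ∀ b ∈ B, s(a, b) ∉ E) :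
    ec E S ≤ ec E (S \ B) + ec E (S \ A) := by
  unfold ec
  refine (Finset.card_le_card ?_).trans (Finset.card_union_le _ _)
  intro z
  induction z with
  | _ a b =>
    simp only [Finset.mem_inter, Finset.mem_union, Finset.mk_mem_sym2_iff, Finset.mem_sdiff]
    rintro ⟨h1, h2, h3⟩
    by_contra hcon
    have hd : ∀ z, z ∈ A → z ∉ B := fun _ h => Finset.disjoint_left.1 hAB h
    have n1 := hno a
    have n2 := hno b
    have h1' : s(b, a) ∈ E := by rwa [Sym2.eq_swap]
    by_cases a ∈ A <;> by_cases b ∈ A <;> by_cases a ∈ B <;> by_cases b ∈ B <;> simp_all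

lemma card_parts (S A B : Finset α) (hAB : Disjoint A B) :
    (S \ B).card = (S ∩ A).card + ((S \ A) \ B).card ∧
    (S \ A).card = (S ∩ B).card + ((S \ A) \ B).card ∧
    S.card = (S ∩ A).card + (S ∩ B).card + ((S \ A) \ B).card := by
  have hd : ∀ z, z ∈ A → z ∉ B := fun _ h => Finset.disjoint_left.1 hAB h
  have e1 : S \ B = (S ∩ A) ∪ ((S \ A) \ B) := by
    ext z; have := hd z; simp only [Finset.mem_sdiff, Finset.mem_union, Finset.mem_inter]; tauto
  have e2 : S \ A = (S ∩ B) ∪ ((S \ A) \ B) := by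
    ext z; have := hd z; simp only [Finset.mem_sdiff, Finset.mem_union, Finset.mem_inter]; tauto
  have d1 : Disjoint (S ∩ A) ((S \ A) \ B) := by
    rw [Finset.disjoint_left]; intro z; simp only [Finset.mem_sdiff, Finset.mem_inter]; tauto
  have d2 : Disjoint (S ∩ B) ((S \ A) \ B) := by
    rw [Finset.disjoint_left]; intro z; simp only [Finset.mem_sdiff, Finset.mem_inter]; tauto
  have c1 := Finset.card_union_of_disjoint d1
  have c2 := Finset.card_union_of_disjoint d2
  rw [← e1] at c1
  rw [← e2] at c2
  have c3 := Finset.card_sdiff_add_card_inter S A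
  exact ⟨c1, c2, by omega⟩

lemma out_le {V : Finset α} {s : ℕ} (hV : V.card = 2 * s + 1) {A B : Finset α} (hA : A ⊆ V)
    (hB : B ⊆ V) (hAB : Disjoint A B) (cA : A.card = s) (cB : B.card = s) :
    ((V \ A) \ B).card = 1 := by
  have := (card_parts V A B hAB).2.2
  rw [Finset.inter_eq_right.2 hA, Finset.inter_eq_right.2 hB] at this
  omega

lemma ec_le {V : Finset α} {s : ℕ} (hV : V.card = 2 * s + 1) {E : Finset (Sym2 α)}
    (h : Dis V s E) : ∀ S ⊆ V, ec E S ≤ 2 * S.card - 3 := by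
  induction h with
  | empty => intro S _; simp [ec]
  | step E A B x y hE hA hB hAB cA cB hx hy hno ih =>
    intro S hS
    by_cases hxy : x ∈ S ∧ y ∈ S
    · have h1 := ec_insert_le E S s(x, y)
      have h2 := ec_cut E S A B hAB hno
      have h3 := ih (S \ B) (Finset.sdiff_subset.trans hS)
      have h4 := ih (S \ A) (Finset.sdiff_subset.trans hS)
      have h5 := card_parts S A B hAB
      have h6 := out_le hV hA hB hAB cA cB
      have h7 : ((S \ A) \ B).card ≤ ((V \ A) \ B).card := Finset.card_le_card (by gcongr)
      have h8 : 0 < (S ∩ A).card := Finset.card_pos.2 ⟨x, by simp [hx, hxy.1]⟩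
      have h9 : 0 < (S ∩ B).card := Finset.card_pos.2 ⟨y, by simp [hy, hxy.2]⟩
      omega
    · exact (ec_insert_of_not E S x y hxy).trans (ih S hS)

/-- data for two disjoint sets versus a cut -/
lemma two_parts {V : Finset α} {s : ℕ} (hV : V.card = 2 * s + 1) {A B : Finset α} (hA : A ⊆ V)
    (hB : B ⊆ V) (hAB : Disjoint A B) (cA : A.card = s) (cB : B.card = s)
    {S T : Finset α} (hS : S ⊆ V) (hT : T ⊆ V) (hST : Disjoint S T) :
    (S ∩ A).card + (T ∩ A).card ≤ s ∧ (S ∩ B).card + (T ∩ B).card ≤ s ∧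
    ((S \ A) \ B).card + ((T \ A) \ B).card ≤ 1 := by
  refine ⟨?_, ?_, ?_⟩
  · rw [← Finset.card_union_of_disjoint, ← cA]
    · exact Finset.card_le_card (by intro z; simp; tauto)
    · exact hST.mono Finset.inter_subset_left Finset.inter_subset_left
  · rw [← Finset.card_union_of_disjoint, ← cB]
    · exact Finset.card_le_card (by intro z; simp; tauto)
    · exact hST.mono Finset.inter_subset_left Finset.inter_subset_left
  · rw [← Finset.card_union_of_disjoint, ← out_le hV hA hB hAB cA cB]
    · refine Finset.card_le_card (Finset.union_subset ?_ ?_) <;> gcongr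
    · exact hST.mono (Finset.sdiff_subset.trans Finset.sdiff_subset)
        (Finset.sdiff_subset.trans Finset.sdiff_subset)

lemma psi_le {V : Finset α} {s : ℕ} (hs : 2 < s) (hV : V.card = 2 * s + 1) {E : Finset (Sym2 α)}
    (h : Dis V s E) : ∀ S ⊆ V, ∀ T ⊆ V, Disjoint S T → S.card = s → T.card = s →
      ec E S + ec E T ≤ 4 * s - 7 := by
  induction h with
  | empty => intros; simp [ec]
  | step E A B x y hE hA hB hAB cA cB hx hy hno ih =>
    have key : ∀ S ⊆ V, ∀ T ⊆ V, Disjoint S T → S.card = s → T.card = s → x ∈ S → y ∈ S →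
        ec E S + ec E T + 1 ≤ 4 * s - 7 := by
      intro S hS T hT hST cS cT hxS hyS
      have h2 := ec_cut E S A B hAB hno
      have h3 := ec_le hV hE (S \ B) (Finset.sdiff_subset.trans hS)
      have h4 := ec_le hV hE (S \ A) (Finset.sdiff_subset.trans hS)
      have h5 := card_parts S A B hAB
      have h2' := ec_cut E T A B hAB hno
      have h3' := ec_le hV hE (T \ B) (Finset.sdiff_subset.trans hT)
      have h4' := ec_le hV hE (T \ A) (Finset.sdiff_subset.trans hT)
      have h5' := card_parts T A B hAB
      have h6 := two_parts hV hA hB hAB cA cB hS hT hST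
      have h8 : 0 < (S ∩ A).card := Finset.card_pos.2 ⟨x, by simp [hx, hxS]⟩
      have h9 : 0 < (S ∩ B).card := Finset.card_pos.2 ⟨y, by simp [hy, hyS]⟩
      omega
    intro S hS T hT hST cS cT
    by_cases h1 : x ∈ S ∧ y ∈ S
    · have := key S hS T hT hST cS cT h1.1 h1.2
      have a1 := ec_insert_le E S s(x, y)
      have a2 := ec_insert_of_not E T x y
        (fun h => Finset.disjoint_left.1 hST h1.1 h.1)
      omega
    · have a2 := ec_insert_of_not E S x y h1
      by_cases h2 : x ∈ T ∧ y ∈ T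
      · have := key T hT S hS hST.symm cT cS h2.1 h2.2
        have a1 := ec_insert_le E T s(x, y)
        omega
      · have a1 := ec_insert_of_not E T x y h2
        have := ih S hS T hT hST cS cT
        omega

lemma phi_le {V : Finset α} {s : ℕ} (hs : 2 < s) (hV : V.card = 2 * s + 1) {E : Finset (Sym2 α)}
    (h : Dis V s E) : ∀ S ⊆ V, ∀ T ⊆ V, Disjoint S T → S.card = s → T.card = s + 1 →
      ec E S + ec E T ≤ 4 * s - 6 := by
  induction h with
  | empty => intros; simp [ec]
  | step E A B x y hE hA hB hAB cA cB hx hy hno ih =>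
    intro S hS T hT hST cS cT
    have h2 := ec_cut E S A B hAB hno
    have h3 := ec_le hV hE (S \ B) (Finset.sdiff_subset.trans hS)
    have h4 := ec_le hV hE (S \ A) (Finset.sdiff_subset.trans hS)
    have h5 := card_parts S A B hAB
    have h2' := ec_cut E T A B hAB hno
    have h3' := ec_le hV hE (T \ B) (Finset.sdiff_subset.trans hT)
    have h4' := ec_le hV hE (T \ A) (Finset.sdiff_subset.trans hT)
    have h5' := card_parts T A B hAB
    have h6 := two_parts hV hA hB hAB cA cB hS hT hST
    by_cases h1 : x ∈ S ∧ y ∈ S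
    · have a1 := ec_insert_le E S s(x, y)
      have a2 := ec_insert_of_not E T x y
        (fun h => Finset.disjoint_left.1 hST h1.1 h.1)
      have h8 : 0 < (S ∩ A).card := Finset.card_pos.2 ⟨x, by simp [hx, h1.1]⟩
      have h9 : 0 < (S ∩ B).card := Finset.card_pos.2 ⟨y, by simp [hy, h1.2]⟩
      omega
    · have a2 := ec_insert_of_not E S x y h1
      by_cases h2 : x ∈ T ∧ y ∈ T
      · have a1 := ec_insert_le E T s(x, y)
        have h8 : 0 < (T ∩ A).card := Finset.card_pos.2 ⟨x, by simp [hx, h2.1]⟩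
        have h9 : 0 < (T ∩ B).card := Finset.card_pos.2 ⟨y, by simp [hy, h2.2]⟩
        by_cases b1 : (T \ A).card = s ∧ (T \ B).card ≤ 1
        · have := psi_le hs hV hE S hS (T \ A) (Finset.sdiff_subset.trans hT)
            (hST.mono_right Finset.sdiff_subset) cS b1.1
          omega
        · by_cases b2 : (T \ B).card = s ∧ (T \ A).card ≤ 1
          · have := psi_le hs hV hE S hS (T \ B) (Finset.sdiff_subset.trans hT)
              (hST.mono_right Finset.sdiff_subset) cS b2.1
            omega
          · omega
      · have a1 := ec_insert_of_not E T x y h2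
        have := ih S hS T hT hST cS cT
        omega

/-- the class of colour `i` -/
def cls {ι : Type} [DecidableEq ι] (V : Finset α) (v : α) (c : α → ι) (i : ι) : Finset α :=
  (V.erase v).filter (fun x => c x = i)

/-- contribution of one class -/
def Fc (E : Finset (Sym2 α)) (v : α) (C : Finset α) : ℕ :=
  if C = ∅ then 0 else ec E (insert v C) + 1

lemma sum_min_two {ι : Type} [DecidableEq ι] (I : Finset ι) (q : ι → ℕ) :
    min (∑ i ∈ I, q i) 2 ≤ ∑ i ∈ I, min (q i) 2 := by
  induction I using Finset.induction_on with
  | empty => simp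
  | insert a I ha ih => rw [Finset.sum_insert ha, Finset.sum_insert ha]; omega

lemma sum_h_ge {ι : Type} [Fintype ι] [DecidableEq ι] (s : ℕ) (hs : 2 < s) (q : ι → ℕ)
    (hq : ∑ i, q i = s) (hlt : ∀ i, q i < s) (i1 : ι) (h1 : q i1 + 1 < s) :
    3 ≤ ∑ i, (if i = i1 then min (q i) 1 else min (q i) 2) := by
  rw [← Finset.add_sum_erase _ _ (Finset.mem_univ i1)] at hq ⊢
  have e : ∑ x ∈ Finset.univ.erase i1, (if x = i1 then min (q x) 1 else min (q x) 2) =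
      ∑ x ∈ Finset.univ.erase i1, min (q x) 2 := by
    refine Finset.sum_congr rfl fun x hx => ?_
    rw [if_neg (Finset.ne_of_mem_erase hx)]
  rw [e, if_pos rfl]
  by_cases h0 : q i1 = 0
  · have : ∃ i2 ∈ Finset.univ.erase i1, q i2 ≠ 0 := by
      by_contra hcon
      push Not at hcon
      rw [Finset.sum_eq_zero hcon] at hq
      omega
    obtain ⟨i2, hi2, hne⟩ := this
    rw [← Finset.add_sum_erase _ _ hi2] at hq ⊢
    have := sum_min_two ((Finset.univ.erase i1).erase i2) q
    have := hlt i2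
    omega
  · have := sum_min_two (Finset.univ.erase i1) q
    omega

lemma sum_cls {ι : Type} [Fintype ι] [DecidableEq ι] (V : Finset α) (v : α) (c : α → ι)
    (B : Finset α) (hB : B ⊆ V.erase v) : ∑ i, (cls V v c i ∩ B).card = B.card := by
  rw [Finset.card_eq_sum_card_fiberwise (f := c) (t := Finset.univ) (by simp)]
  refine Finset.sum_congr rfl fun i _ => ?_
  congr 1
  ext z
  have := @hB z
  simp only [cls, Finset.mem_inter, Finset.mem_filter]
  tauto

/-- the case of a cut at another vertex, with `v ∈ A` -/
lemma two_other {V : Finset α} {s : ℕ} (hs : 2 < s) (hV : V.card = 2 * s + 1)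
    {E : Finset (Sym2 α)} (hE : Dis V s E) {A B : Finset α} (hA : A ⊆ V)
    (hB : B ⊆ V) (hAB : Disjoint A B) (cA : A.card = s) (cB : B.card = s)
    (hno : ∀ a ∈ A, ∀ b ∈ B, s(a, b) ∉ E) {ι : Type} [Fintype ι] [DecidableEq ι] (c : α → ι)
    (v : α) (hv : v ∈ A) (hc : ∀ i, (cls V v c i).card < s) :
    ∑ i, Fc E v (cls V v c i) ≤ 4 * s - 3 := by
  have hd : ∀ z, z ∈ A → z ∉ B := fun _ h => Finset.disjoint_left.1 hAB h
  obtain ⟨w, hw⟩ := Finset.card_eq_one.1 (out_le hV hA hB hAB cA cB)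
  have hwm : ∀ z, (z ∈ V ∧ z ∉ A) ∧ z ∉ B ↔ z = w := by
    intro z
    have := congrArg (z ∈ ·) hw
    simpa using this
  have hw1 := (hwm w).2 rfl
  have hvw : w ≠ v := by rintro rfl; exact hw1.1.2 hv
  have hBe : B ⊆ V.erase v := by
    intro z hz
    refine Finset.mem_erase.2 ⟨?_, hB hz⟩
    rintro rfl
    exact hd _ hv hz
  have sq := sum_cls V v c B hBe
  have sV := sum_cls V v c (V.erase v) (Finset.Subset.refl _)
  have hin : ∀ i, cls V v c i ∩ V.erase v = cls V v c i := fun i =>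
    Finset.inter_eq_left.2 (Finset.filter_subset _ _)
  simp only [hin] at sV
  rw [Finset.card_erase_of_mem (hA hv), hV] at sV
  rw [cB] at sq
  have hsub : ∀ i, cls V v c i ⊆ V := fun i =>
    (Finset.filter_subset _ _).trans (Finset.erase_subset _ _)
  have hlt : ∀ i, (cls V v c i ∩ B).card < s := fun i =>
    (Finset.card_le_card Finset.inter_subset_left).trans_lt (hc i)
  have hwc : w ∈ cls V v c (c w) := by simp [cls, hvw, hw1.1.1]
  have hout : ∀ i, i ≠ c w → ((cls V v c i \ A) \ B).card = 0 := by
    intro i hi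
    rw [Finset.card_eq_zero, Finset.eq_empty_iff_forall_notMem]
    intro z hz
    simp only [Finset.mem_sdiff] at hz
    have := (hwm z).1 ⟨⟨hsub i hz.1.1, hz.1.2⟩, hz.2⟩
    subst this
    have := hz.1.1
    simp only [cls, Finset.mem_filter] at this
    exact hi this.2.symm
  have hout1 : ((cls V v c (c w) \ A) \ B).card = 1 := by
    rw [Finset.card_eq_one]
    refine ⟨w, ?_⟩
    ext z
    simp only [Finset.mem_sdiff, Finset.mem_singleton]
    constructor
    · rintro ⟨⟨h1, h2⟩, h3⟩
      exact (hwm z).1 ⟨⟨hsub _ h1, h2⟩, h3⟩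
    · rintro rfl
      exact ⟨⟨hwc, hw1.1.2⟩, hw1.2⟩
  have h1 : (cls V v c (c w) ∩ B).card + 1 < s := by
    have := (card_parts (cls V v c (c w)) A B hAB).2.2
    have := hc (c w)
    omega
  have key := sum_h_ge s hs _ sq hlt (c w) h1
  have each : ∀ i ∈ Finset.univ, Fc E v (cls V v c i) +
      (if i = c w then min (cls V v c i ∩ B).card 1 else min (cls V v c i ∩ B).card 2) ≤
      2 * (cls V v c i).card := by
    intro i _
    have hcp := card_parts (cls V v c i) A B hAB
    unfold Fc
    by_cases h0 : cls V v c i = ∅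
    · simp [h0]
    have hvn : v ∉ cls V v c i := by simp [cls]
    have hpos := Finset.card_pos.2 (Finset.nonempty_iff_ne_empty.2 h0)
    rw [if_neg h0]
    have hSV : insert v (cls V v c i) ⊆ V := Finset.insert_subset (hA hv) (hsub i)
    have h2 := ec_cut E (insert v (cls V v c i)) A B hAB hno
    have h3 := ec_le hV hE (insert v (cls V v c i) \ B) (Finset.sdiff_subset.trans hSV)
    have h4 := ec_le hV hE (insert v (cls V v c i) \ A) (Finset.sdiff_subset.trans hSV)
    rw [Finset.insert_sdiff_of_notMem _ (hd v hv), Finset.card_insert_of_notMem (by simp [hvn])]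
      at h3
    rw [Finset.insert_sdiff_of_mem _ hv] at h4
    rw [Finset.insert_sdiff_of_notMem _ (hd v hv), Finset.insert_sdiff_of_mem _ hv] at h2
    split_ifs with hi
    · subst hi
      omega
    · have := hout i hi
      omega
  have tot := Finset.sum_le_sum each
  rw [Finset.sum_add_distrib, ← Finset.mul_sum, sV] at tot
  omega

lemma Fc_insert_sum {ι : Type} [Fintype ι] [DecidableEq ι] (E : Finset (Sym2 α)) (V : Finset α)
    (v : α) (c : α → ι) (x y : α) (hy : y ≠ v) :
    ∑ i, Fc (insert s(x, y) E) v (cls V v c i) ≤ ∑ i, Fc E v (cls V v c i) + 1 := by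
  have : ∑ i, (if i = c y then 1 else 0) = 1 := by simp
  rw [← this, ← Finset.sum_add_distrib]
  refine Finset.sum_le_sum fun i _ => ?_
  unfold Fc
  by_cases h0 : cls V v c i = ∅
  · simp [h0]
  rw [if_neg h0, if_neg h0]
  split_ifs with hi
  · have := ec_insert_le E (insert v (cls V v c i)) s(x, y)
    omega
  · have := ec_insert_of_not E (insert v (cls V v c i)) x y (by
      rintro ⟨-, h⟩
      simp only [Finset.mem_insert, hy, false_or, cls, Finset.mem_filter] at h
      exact hi h.2.symm)
    omega

lemma two_le {V : Finset α} {s : ℕ} (hs : 2 < s) (hV : V.card = 2 * s + 1) {E : Finset (Sym2 α)}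
    (h : Dis V s E) : ∀ (ι : Type) [Fintype ι] [DecidableEq ι] (c : α → ι), ∀ v ∈ V,
      (∀ i, (cls V v c i).card < s) → ∑ i, Fc E v (cls V v c i) ≤ 4 * s - 2 := by
  induction h with
  | empty =>
    intro ι _ _ c v hv hc
    have sV := sum_cls V v c (V.erase v) (Finset.Subset.refl _)
    have hin : ∀ i, cls V v c i ∩ V.erase v = cls V v c i := fun i =>
      Finset.inter_eq_left.2 (Finset.filter_subset _ _)
    simp only [hin] at sV
    rw [Finset.card_erase_of_mem hv, hV] at sV
    have : ∑ i, Fc ∅ v (cls V v c i) ≤ ∑ i, (cls V v c i).card := by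
      refine Finset.sum_le_sum fun i _ => ?_
      unfold Fc
      split_ifs with h0
      · simp
      · have := Finset.card_pos.2 (Finset.nonempty_iff_ne_empty.2 h0)
        simp [ec]; exact Finset.nonempty_iff_ne_empty.2 h0
    omega
  | step E A B x y hE hA hB hAB cA cB hx hy hno ih =>
    intro ι _ _ c v hv hc
    have hd : ∀ z, z ∈ A → z ∉ B := fun _ h => Finset.disjoint_left.1 hAB h
    by_cases hvA : v ∈ A
    · have := two_other hs hV hE hA hB hAB cA cB hno c v hvA hc
      have := Fc_insert_sum E V v c x y (by rintro rfl; exact hd _ hvA hy)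
      omega
    by_cases hvB : v ∈ B
    · have := two_other hs hV hE hB hA hAB.symm cB cA
        (fun a ha b hb => by rw [Sym2.eq_swap]; exact hno b hb a ha) c v hvB hc
      have := Fc_insert_sum E V v c y x (by rintro rfl; exact hd _ hx hvB)
      rw [Sym2.eq_swap] at this
      omega
    -- `v` is the cut vertex
    obtain ⟨w, hw⟩ := Finset.card_eq_one.1 (out_le hV hA hB hAB cA cB)
    have hwm : ∀ z, (z ∈ V ∧ z ∉ A) ∧ z ∉ B ↔ z = w := by
      intro z
      have := congrArg (z ∈ ·) hw
      simpa using this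
    have hvw := (hwm v).1 ⟨⟨hv, hvA⟩, hvB⟩
    subst hvw
    have hx' : x ≠ v := by rintro rfl; exact hvA hx
    have hy' : y ≠ v := by rintro rfl; exact hvB hy
    let c' : α → ι × Bool := fun z => (c z, decide (z ∈ A))
    have ct : ∀ i, cls V v c' (i, true) = cls V v c i \ B := by
      intro i
      ext z
      have := hwm z
      have := hd z
      simp only [cls, c', Finset.mem_filter, Finset.mem_sdiff, Prod.mk.injEq, decide_eq_true_eq,
        Finset.mem_erase]
      tauto
    have cf : ∀ i, cls V v c' (i, false) = cls V v c i \ A := by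
      intro i
      ext z
      simp only [cls, c', Finset.mem_filter, Finset.mem_sdiff, Prod.mk.injEq, decide_eq_false_iff_not,
        Finset.mem_erase]
      tauto
    have hc' : ∀ j, (cls V v c' j).card < s := by
      rintro ⟨i, b⟩
      refine lt_of_le_of_lt (Finset.card_le_card ?_) (hc i)
      cases b
      · rw [cf]; exact Finset.sdiff_subset
      · rw [ct]; exact Finset.sdiff_subset
    have := ih (ι × Bool) c' v hv hc'
    refine le_trans ?_ this
    rw [Fintype.sum_prod_type]
    refine Finset.sum_le_sum fun i _ => ?_
    rw [Fintype.sum_bool, ct, cf]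
    have hcut := ec_cut E (insert v (cls V v c i)) A B hAB hno
    rw [Finset.insert_sdiff_of_notMem _ hvA, Finset.insert_sdiff_of_notMem _ hvB] at hcut
    have hle := ec_insert_le E (insert v (cls V v c i)) s(x, y)
    unfold Fc
    by_cases h0 : cls V v c i = ∅
    · simp [h0]
    rw [if_neg h0]
    by_cases hb : x ∈ cls V v c i ∧ y ∈ cls V v c i
    · rw [if_neg, if_neg]
      · omega
      · exact Finset.ne_empty_of_mem (Finset.mem_sdiff.2 ⟨hb.2, fun h => hd _ h hy⟩)
      · exact Finset.ne_empty_of_mem (Finset.mem_sdiff.2 ⟨hb.1, hd _ hx⟩)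
    · have hle2 := ec_insert_of_not E (insert v (cls V v c i)) x y (by
        simpa [hx', hy'] using hb)
      have hvn : v ∉ cls V v c i := by simp [cls]
      have hp : ∀ z ∈ cls V v c i, z ∉ A → z ∈ B := by
        intro z hz h1
        by_contra h2
        have hzV : z ∈ V := by simp [cls] at hz; exact hz.1.2
        have := (hwm z).1 ⟨⟨hzV, h1⟩, h2⟩
        subst this
        exact hvn hz
      by_cases e1 : cls V v c i \ B = ∅
      · have : cls V v c i \ A = cls V v c i := by
          rw [Finset.sdiff_eq_self_iff_disjoint, Finset.disjoint_left]
          intro z hz hzA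
          have := Finset.eq_empty_iff_forall_notMem.1 e1 z
          exact this (Finset.mem_sdiff.2 ⟨hz, hd _ hzA⟩)
        rw [if_pos e1, this, if_neg h0]
        omega
      · by_cases e2 : cls V v c i \ A = ∅
        · have : cls V v c i \ B = cls V v c i := by
            rw [Finset.sdiff_eq_self_iff_disjoint, Finset.disjoint_left]
            intro z hz hzB
            have := Finset.eq_empty_iff_forall_notMem.1 e2 z
            exact this (Finset.mem_sdiff.2 ⟨hz, fun h => hd _ h hzB⟩)
          rw [if_pos e2, this, if_neg h0]
          omega
        · rw [if_neg e1, if_neg e2]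
          omega

lemma theta_core {V : Finset α} {s : ℕ} (hs : 2 < s) (hV : V.card = 2 * s + 1)
    {E : Finset (Sym2 α)} (hE : Dis V s E) {A B : Finset α} (hA : A ⊆ V)
    (hB : B ⊆ V) (hAB : Disjoint A B) (cA : A.card = s) (cB : B.card = s)
    (hno : ∀ a ∈ A, ∀ b ∈ B, s(a, b) ∉ E) {P Q : Finset α} (hP : P ⊆ V) (hQ : Q ⊆ V)
    (hPQ : Disjoint P Q) (cP : P.card = s) (cQ : Q.card = s) {v w : α} (hvP : v ∉ P)
    (hvQ : v ∉ Q) (hv : v ∈ A) (hw : w ∈ P) (hwA : w ∉ A) (hwB : w ∉ B) :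
    ec E (insert v P) + ec E (insert v Q) ≤ 4 * s - 6 := by
  have hvB : v ∉ B := fun h => Finset.disjoint_left.1 hAB hv h
  have hPV : insert v P ⊆ V := Finset.insert_subset (hA hv) hP
  have hQV : insert v Q ⊆ V := Finset.insert_subset (hA hv) hQ
  have hd1 : Disjoint P (insert v Q) := by simp [hvP, hPQ]
  have hd2 : Disjoint (insert v P) Q := by simp [hvQ, hPQ]
  have tp := two_parts hV hA hB hAB cA cB hP hQV hd1
  rw [Finset.insert_inter_of_mem hv, Finset.insert_inter_of_notMem hvB,
    Finset.insert_sdiff_of_mem _ hv, Finset.card_insert_of_notMem (by simp [hvQ])] at tp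
  have p5 := card_parts P A B hAB
  have q5 := card_parts Q A B hAB
  have hpos : 0 < ((P \ A) \ B).card := Finset.card_pos.2 ⟨w, by simp [hw, hwA, hwB]⟩
  have p2 := ec_cut E (insert v P) A B hAB hno
  have p3 := ec_le hV hE (insert v P \ B) (Finset.sdiff_subset.trans hPV)
  have p4 := ec_le hV hE (insert v P \ A) (Finset.sdiff_subset.trans hPV)
  have q2 := ec_cut E (insert v Q) A B hAB hno
  have q3 := ec_le hV hE (insert v Q \ B) (Finset.sdiff_subset.trans hQV)
  have q4 := ec_le hV hE (insert v Q \ A) (Finset.sdiff_subset.trans hQV)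
  have phi := phi_le hs hV hE (Q \ A) (Finset.sdiff_subset.trans hQ) (insert v P) hPV
    (hd2.symm.mono_left Finset.sdiff_subset)
  have psi := psi_le hs hV hE (P \ A) (Finset.sdiff_subset.trans hP) (insert v Q \ B)
    (Finset.sdiff_subset.trans hQV) (hd1.mono Finset.sdiff_subset Finset.sdiff_subset)
  rw [Finset.card_insert_of_notMem hvP] at phi
  have k1 : insert v P \ A = P \ A := Finset.insert_sdiff_of_mem _ hv
  have k2 : insert v Q \ A = Q \ A := Finset.insert_sdiff_of_mem _ hv
  have k3 : (insert v P \ B).card = (P \ B).card + 1 := by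
    rw [Finset.insert_sdiff_of_notMem _ hvB, Finset.card_insert_of_notMem (by simp [hvP])]
  have k4 : (insert v Q \ B).card = (Q \ B).card + 1 := by
    rw [Finset.insert_sdiff_of_notMem _ hvB, Finset.card_insert_of_notMem (by simp [hvQ])]
  rw [k1] at p2 p4
  rw [k2] at q2 q4
  by_cases c1 : (Q ∩ B).card = s
  · have := phi (by omega) (by omega)
    omega
  by_cases c2 : (Q ∩ B).card = 1
  · have := psi (by omega) (by omega)
    omega
  omega

/-- the case where the vertex is the cut vertex -/
lemma theta_same {V : Finset α} {s : ℕ} (hs : 2 < s) (hV : V.card = 2 * s + 1)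
    {E : Finset (Sym2 α)} (hE : Dis V s E) {A B : Finset α} (hA : A ⊆ V)
    (hB : B ⊆ V) (hAB : Disjoint A B) (cA : A.card = s) (cB : B.card = s)
    (hno : ∀ a ∈ A, ∀ b ∈ B, s(a, b) ∉ E) {P Q : Finset α} (hP : P ⊆ V) (hQ : Q ⊆ V)
    (hPQ : Disjoint P Q) (cP : P.card = s) (cQ : Q.card = s) {v x y : α} (hvV : v ∈ V)
    (hvP : v ∉ P) (hvQ : v ∉ Q) (hvA : v ∉ A) (hvB : v ∉ B) (hx : x ∈ A) (hy : y ∈ B)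
    (hxP : x ∈ P) (hyP : y ∈ P) :
    ec E (insert v P) + ec E (insert v Q) ≤ 4 * s - 6 := by
  have hd : ∀ z, z ∈ A → z ∉ B := fun _ h => Finset.disjoint_left.1 hAB h
  have hd' : ∀ z, z ∈ P → z ∉ Q := fun _ h => Finset.disjoint_left.1 hPQ h
  obtain ⟨w, hw⟩ := Finset.card_eq_one.1 (out_le hV hA hB hAB cA cB)
  have hwm : ∀ z, (z ∈ V ∧ z ∉ A) ∧ z ∉ B ↔ z = w := by
    intro z
    have := congrArg (z ∈ ·) hw
    simpa using this
  have hvw := (hwm v).1 ⟨⟨hvV, hvA⟩, hvB⟩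
  subst hvw
  obtain ⟨w, hw'⟩ := Finset.card_eq_one.1 (out_le hV hP hQ hPQ cP cQ)
  have hwm' : ∀ z, (z ∈ V ∧ z ∉ P) ∧ z ∉ Q ↔ z = w := by
    intro z
    have := congrArg (z ∈ ·) hw'
    simpa using this
  have hvw := (hwm' v).1 ⟨⟨hvV, hvP⟩, hvQ⟩
  subst hvw
  let c : α → Bool × Bool := fun z => (decide (z ∈ P), decide (z ∈ A))
  have c1 : cls V v c (true, true) = P \ B := by
    ext z
    have := hwm z; have := hwm' z; have := hd z; have := hd' z; have := @hP z
    simp only [cls, c, Finset.mem_filter, Finset.mem_sdiff, Prod.mk.injEq, decide_eq_true_eq,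
      Finset.mem_erase]
    grind
  have c2 : cls V v c (true, false) = P \ A := by
    ext z
    have := hwm z; have := hwm' z; have := hd z; have := hd' z; have := @hP z
    simp only [cls, c, Finset.mem_filter, Finset.mem_sdiff, Prod.mk.injEq, decide_eq_true_eq,
      Finset.mem_erase, decide_eq_false_iff_not]
    grind
  have c3 : cls V v c (false, true) = Q \ B := by
    ext z
    have := hwm z; have := hwm' z; have := hd z; have := hd' z; have := @hQ z
    simp only [cls, c, Finset.mem_filter, Finset.mem_sdiff, Prod.mk.injEq, decide_eq_true_eq,
      Finset.mem_erase, decide_eq_false_iff_not]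
    grind
  have c4 : cls V v c (false, false) = Q \ A := by
    ext z
    have := hwm z; have := hwm' z; have := hd z; have := hd' z; have := @hQ z
    simp only [cls, c, Finset.mem_filter, Finset.mem_sdiff, Prod.mk.injEq,
      Finset.mem_erase, decide_eq_false_iff_not]
    grind
  have tp := two_parts hV hA hB hAB cA cB hP hQ hPQ
  have p5 := card_parts P A B hAB
  have q5 := card_parts Q A B hAB
  have z1 : ((P \ A) \ B).card = 0 := by
    rw [Finset.card_eq_zero, Finset.eq_empty_iff_forall_notMem]
    intro z hz
    simp only [Finset.mem_sdiff] at hz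
    have := (hwm z).1 ⟨⟨hP hz.1.1, hz.1.2⟩, hz.2⟩
    subst this
    exact hvP hz.1.1
  have z2 : ((Q \ A) \ B).card = 0 := by
    rw [Finset.card_eq_zero, Finset.eq_empty_iff_forall_notMem]
    intro z hz
    simp only [Finset.mem_sdiff] at hz
    have := (hwm z).1 ⟨⟨hQ hz.1.1, hz.1.2⟩, hz.2⟩
    subst this
    exact hvQ hz.1.1
  have h8 : 0 < (P ∩ A).card := Finset.card_pos.2 ⟨x, by simp [hx, hxP]⟩
  have h9 : 0 < (P ∩ B).card := Finset.card_pos.2 ⟨y, by simp [hy, hyP]⟩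
  have main := two_le hs hV hE (Bool × Bool) c v hvV (by
    rintro ⟨_ | _, _ | _⟩
    · rw [c4]; omega
    · rw [c3]; omega
    · rw [c2]; omega
    · rw [c1]; omega)
  rw [Fintype.sum_prod_type, Fintype.sum_bool, Fintype.sum_bool, Fintype.sum_bool, c1, c2, c3,
    c4] at main
  unfold Fc at main
  have ne : ∀ C : Finset α, 0 < C.card → C ≠ ∅ := fun C h => Finset.card_pos.1 h |>.ne_empty
  rw [if_neg (ne _ (by omega)), if_neg (ne _ (by omega)), if_neg (ne _ (by omega)),
    if_neg (ne _ (by omega))] at main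
  have p2 := ec_cut E (insert v P) A B hAB hno
  have q2 := ec_cut E (insert v Q) A B hAB hno
  rw [Finset.insert_sdiff_of_notMem _ hvA, Finset.insert_sdiff_of_notMem _ hvB] at p2 q2
  omega

lemma theta_le {V : Finset α} {s : ℕ} (hs : 2 < s) (hV : V.card = 2 * s + 1)
    {E : Finset (Sym2 α)} (h : Dis V s E) : ∀ P ⊆ V, ∀ Q ⊆ V, Disjoint P Q → P.card = s →
      Q.card = s → ∀ v ∈ V, v ∉ P → v ∉ Q →
      ec E (insert v P) + ec E (insert v Q) ≤ 4 * s - 5 := by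
  induction h with
  | empty => intros; simp [ec]
  | step E A B x y hE hA hB hAB cA cB hx hy hno ih =>
    intro P hP Q hQ hPQ cP cQ v hvV hvP hvQ
    have hd : ∀ z, z ∈ A → z ∉ B := fun _ h => Finset.disjoint_left.1 hAB h
    have hd' : ∀ z, z ∈ P → z ∉ Q := fun _ h => Finset.disjoint_left.1 hPQ h
    have hno' : ∀ a ∈ B, ∀ b ∈ A, s(a, b) ∉ E :=
      fun a ha b hb => by rw [Sym2.eq_swap]; exact hno b hb a ha
    have hxy : x ≠ y := by rintro rfl; exact hd _ hx hy
    -- at most one of the two counts goes up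
    have up : ec (insert s(x, y) E) (insert v P) + ec (insert s(x, y) E) (insert v Q) ≤
        ec E (insert v P) + ec E (insert v Q) + 1 := by
      have a1 := ec_insert_le E (insert v P) s(x, y)
      have a2 := ec_insert_le E (insert v Q) s(x, y)
      by_cases h1 : x ∈ insert v P ∧ y ∈ insert v P
      · have := ec_insert_of_not E (insert v Q) x y (by
          have := hd' x; have := hd' y
          simp only [Finset.mem_insert] at *
          grind)
        omega
      · have := ec_insert_of_not E (insert v P) x y h1
        omega
    obtain ⟨w, hw⟩ := Finset.card_eq_one.1 (out_le hV hA hB hAB cA cB)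
    have hwm : ∀ z, (z ∈ V ∧ z ∉ A) ∧ z ∉ B ↔ z = w := by
      intro z
      have := congrArg (z ∈ ·) hw
      simpa using this
    have hw1 := (hwm w).2 rfl
    obtain ⟨u, hu⟩ := Finset.card_eq_one.1 (out_le hV hP hQ hPQ cP cQ)
    have hum : ∀ z, (z ∈ V ∧ z ∉ P) ∧ z ∉ Q ↔ z = u := by
      intro z
      have := congrArg (z ∈ ·) hu
      simpa using this
    have hvu := (hum v).1 ⟨⟨hvV, hvP⟩, hvQ⟩
    subst hvu
    by_cases hvw : w = v
    · subst hvw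
      have hx' : x ≠ w := by rintro rfl; exact hw1.1.2 hx
      have hy' : y ≠ w := by rintro rfl; exact hw1.2 hy
      by_cases h1 : x ∈ P ∧ y ∈ P
      · have := theta_same hs hV hE hA hB hAB cA cB hno hP hQ hPQ cP cQ hvV hvP hvQ hw1.1.2
          hw1.2 hx hy h1.1 h1.2
        omega
      · by_cases h2 : x ∈ Q ∧ y ∈ Q
        · have := theta_same hs hV hE hA hB hAB cA cB hno hQ hP hPQ.symm cQ cP hvV hvQ hvP hw1.1.2
            hw1.2 hx hy h2.1 h2.2
          omega
        · have a1 := ec_insert_of_not E (insert w P) x y (by simpa [hx', hy'] using h1)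
          have a2 := ec_insert_of_not E (insert w Q) x y (by simpa [hx', hy'] using h2)
          have := ih P hP Q hQ hPQ cP cQ w hvV hvP hvQ
          omega
    · have hwPQ : w ∈ P ∨ w ∈ Q := by
        by_contra hcon
        push Not at hcon
        exact hvw ((hum w).1 ⟨⟨hw1.1.1, hcon.1⟩, hcon.2⟩)
      have hvAB : v ∈ A ∨ v ∈ B := by
        by_contra hcon
        push Not at hcon
        exact hvw ((hwm v).1 ⟨⟨hvV, hcon.1⟩, hcon.2⟩).symm
      rcases hwPQ with hwP | hwP <;> rcases hvAB with hv | hv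
      · have := theta_core hs hV hE hA hB hAB cA cB hno hP hQ hPQ cP cQ hvP hvQ hv hwP hw1.1.2 hw1.2
        omega
      · have := theta_core hs hV hE hB hA hAB.symm cB cA hno' hP hQ hPQ cP cQ hvP hvQ hv hwP
          hw1.2 hw1.1.2
        omega
      · have := theta_core hs hV hE hA hB hAB cA cB hno hQ hP hPQ.symm cQ cP hvQ hvP hv hwP
          hw1.1.2 hw1.2
        omega
      · have := theta_core hs hV hE hB hA hAB.symm cB cA hno' hQ hP hPQ.symm cQ cP hvQ hvP hv hwP
          hw1.2 hw1.1.2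
        omega

lemma Dis.subset {V : Finset α} {s : ℕ} {E : Finset (Sym2 α)} (h : Dis V s E) : E ⊆ V.sym2 := by
  induction h with
  | empty => simp
  | step E A B x y hE hA hB hAB cA cB hx hy hno ih =>
    exact Finset.insert_subset (Finset.mk_mem_sym2_iff.2 ⟨hA hx, hB hy⟩) ih

lemma Dis.card_le {V : Finset α} {s : ℕ} (hs : 2 < s) (hV : V.card = 2 * s + 1)
    {E : Finset (Sym2 α)} (h : Dis V s E) : E.card ≤ 4 * s - 4 := by
  cases h with
  | empty => simp
  | step E A B x y hE hA hB hAB cA cB hx hy hno =>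
    have h1 := Finset.card_insert_le s(x, y) E
    have h2 : E.card = ec E V := by
      unfold ec
      rw [Finset.inter_eq_left.2 hE.subset]
    have h3 := ec_cut E V A B hAB hno
    obtain ⟨w, hw⟩ := Finset.card_eq_one.1 (out_le hV hA hB hAB cA cB)
    have hwm : ∀ z, (z ∈ V ∧ z ∉ A) ∧ z ∉ B ↔ z = w := by
      intro z
      have := congrArg (z ∈ ·) hw
      simpa using this
    have hw1 := (hwm w).2 rfl
    have hd : ∀ z, z ∈ A → z ∉ B := fun _ h => Finset.disjoint_left.1 hAB h
    have h4 := theta_le hs hV hE A hA B hB hAB cA cB w hw1.1.1 hw1.1.2 hw1.2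
    have e1 : V \ B = insert w A := by
      ext z
      have := hwm z; have := hd z; have := @hA z
      simp only [Finset.mem_sdiff, Finset.mem_insert]
      grind
    have e2 : V \ A = insert w B := by
      ext z
      have := hwm z; have := hd z; have := @hB z
      simp only [Finset.mem_sdiff, Finset.mem_insert]
      grind
    rw [e1, e2] at h3
    omega

end Lower

lemma phase {V : Finset ℕ} {s : ℕ} {E0 : Finset (Sym2 ℕ)} (h0 : Dis V s E0) (edge : ℕ → Sym2 ℕ)
    (N : ℕ) (hstep : ∀ i < N, ∃ (A B : Finset ℕ) (x y : ℕ), A ⊆ V ∧ B ⊆ V ∧ Disjoint A B ∧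
      A.card = s ∧ B.card = s ∧ x ∈ A ∧ y ∈ B ∧ edge i = s(x, y) ∧
      ∀ a ∈ A, ∀ b ∈ B, s(a, b) ∉ E0 ∧ ∀ j < i, s(a, b) ≠ edge j) :
    ∃ E, Dis V s E ∧ E.card = E0.card + N ∧ ∀ e, e ∈ E ↔ e ∈ E0 ∨ ∃ j < N, e = edge j := by
  induction N with
  | zero => exact ⟨E0, h0, rfl, by simp⟩
  | succ N ih =>
    obtain ⟨E, hE, hc, hm⟩ := ih (fun i hi => hstep i (by omega))
    obtain ⟨A, B, x, y, hA, hB, hAB, cA, cB, hx, hy, he, hno⟩ := hstep N (by omega)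
    have hno' : ∀ a ∈ A, ∀ b ∈ B, s(a, b) ∉ E := by
      intro a ha b hb hmem
      obtain ⟨h1, h2⟩ := hno a ha b hb
      rcases (hm _).1 hmem with h | ⟨j, hj, h⟩
      · exact h1 h
      · exact h2 j hj h
    refine ⟨insert s(x, y) E, Dis.step E A B x y hE hA hB hAB cA cB hx hy hno', ?_, ?_⟩
    · rw [Finset.card_insert_of_notMem (hno' x hx y hy), hc]; omega
    · intro e
      rw [Finset.mem_insert, hm, ← he]
      constructor
      · rintro (h | h | ⟨j, hj, h⟩)
        · exact Or.inr ⟨N, by omega, h⟩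
        · exact Or.inl h
        · exact Or.inr ⟨j, by omega, h⟩
      · rintro (h | ⟨j, hj, h⟩)
        · exact Or.inr (Or.inl h)
        · rcases Nat.lt_succ_iff_lt_or_eq.1 hj with h' | h'
          · exact Or.inr (Or.inr ⟨j, h', h⟩)
          · subst h'; exact Or.inl h

lemma exists_dis_nat (s : ℕ) (hs : 2 < s) :
    ∃ E, Dis (Finset.range (2 * s + 1)) s E ∧ E.card = 4 * s - 4 := by
  -- cards of the sets used in the first three phases
  have cB : ∀ x, s < x → x ≤ 2 * s → ∀ z, s ≤ z → z ≤ 2 * s → z ≠ x →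
      (((Finset.Icc (s - 1) (2 * s)).erase z).erase x).card = s := by
    intro x h1 h2 z h3 h4 h5
    rw [Finset.card_erase_of_mem, Finset.card_erase_of_mem, Nat.card_Icc]
    · omega
    · simp; omega
    · simp; omega
  have cA : ∀ x, s < x → (insert x (Finset.range (s - 1))).card = s := by
    intro x h1
    rw [Finset.card_insert_of_notMem, Finset.card_range]
    · omega
    · simp; omega
  obtain ⟨E1, d1, n1, m1⟩ := phase (V := Finset.range (2 * s + 1)) (s := s) Dis.empty
    (fun _ => s(s + 1, s + 2)) 1 (by
      intro i hi
      refine ⟨insert (s + 1) (Finset.range (s - 1)),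
        ((Finset.Icc (s - 1) (2 * s)).erase s).erase (s + 1), s + 1, s + 2, ?_, ?_, ?_,
        cA _ (by omega), cB _ (by omega) (by omega) _ (by omega) (by omega) (by omega), ?_, ?_,
        rfl, ?_⟩
      · intro z; simp <;> omega
      · intro z; simp <;> omega
      · rw [Finset.disjoint_left]; intro z; simp; omega
      · simp
      · simp; omega
      · intro a ha b hb
        simp; omega)
  obtain ⟨E2, d2, n2, m2⟩ := phase d1 (fun i => s(s + 3 + i, s + 2)) (s - 2) (by
      intro i hi
      refine ⟨insert (s + 3 + i) (Finset.range (s - 1)),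
        ((Finset.Icc (s - 1) (2 * s)).erase s).erase (s + 3 + i), s + 3 + i, s + 2, ?_, ?_, ?_,
        cA _ (by omega), cB _ (by omega) (by omega) _ (by omega) (by omega) (by omega), ?_, ?_,
        rfl, ?_⟩
      · intro z; simp <;> omega
      · intro z; simp <;> omega
      · rw [Finset.disjoint_left]; intro z; simp; omega
      · simp
      · simp; omega
      · intro a ha b hb
        simp only [Finset.mem_insert, Finset.mem_range, Finset.mem_erase, Finset.mem_Icc] at ha hb
        simp only [m1, Finset.notMem_empty, false_or, Sym2.eq_iff, ne_eq]
        constructor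
        · rintro ⟨j, hj, h⟩; omega
        · intro j hj; omega)
  obtain ⟨E3, d3, n3, m3⟩ := phase d2 (fun i => s(s + 4 + i, s + 3 + i)) (s - 3) (by
      intro i hi
      refine ⟨insert (s + 4 + i) (Finset.range (s - 1)),
        ((Finset.Icc (s - 1) (2 * s)).erase (s + 2)).erase (s + 4 + i), s + 4 + i, s + 3 + i,
        ?_, ?_, ?_,
        cA _ (by omega), cB _ (by omega) (by omega) _ (by omega) (by omega) (by omega), ?_, ?_,
        rfl, ?_⟩
      · intro z; simp <;> omega
      · intro z; simp <;> omega
      · rw [Finset.disjoint_left]; intro z; simp; omega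
      · simp
      · simp; omega
      · intro a ha b hb
        simp only [Finset.mem_insert, Finset.mem_range, Finset.mem_erase, Finset.mem_Icc] at ha hb
        simp only [m1, m2, Finset.notMem_empty, false_or, Sym2.eq_iff, ne_eq]
        constructor
        · rintro (⟨j, hj, h⟩ | ⟨j, hj, h⟩) <;> omega
        · intro j hj; omega)
  obtain ⟨E4, d4, n4, m4⟩ := phase d3 (fun i => s(s + 1, i)) s (by
      intro i hi
      refine ⟨insert (s + 1) ((Finset.range s).erase i),
        insert i (Finset.Icc (s + 3) (2 * s) ∪ {s}), s + 1, i,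
        ?_, ?_, ?_, ?_, ?_, ?_, ?_, rfl, ?_⟩
      · intro z; simp <;> omega
      · intro z; simp <;> omega
      · rw [Finset.disjoint_left]; intro z; simp; omega
      · rw [Finset.card_insert_of_notMem (by simp), Finset.card_erase_of_mem (by simpa using hi),
          Finset.card_range]
        omega
      · rw [Finset.card_insert_of_notMem (by simp; omega), Finset.card_union_of_disjoint (by simp),
          Nat.card_Icc, Finset.card_singleton]
        omega
      · simp
      · simp
      · intro a ha b hb
        simp only [Finset.mem_insert, Finset.mem_range, Finset.mem_erase, Finset.mem_Icc,
          Finset.mem_union, Finset.mem_singleton] at ha hb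
        simp only [m1, m2, m3, Finset.notMem_empty, false_or, Sym2.eq_iff, ne_eq]
        constructor
        · rintro ((⟨j, hj, h⟩ | ⟨j, hj, h⟩) | ⟨j, hj, h⟩) <;> omega
        · intro j hj; omega)
  obtain ⟨E5, d5, n5, m5⟩ := phase d4 (fun i => s(i + 1, i)) s (by
      intro i hi
      refine ⟨insert (i + 1) (Finset.Icc (s + 2) (2 * s)),
        (Finset.range (s + 1)).erase (i + 1), i + 1, i,
        ?_, ?_, ?_, ?_, ?_, ?_, ?_, rfl, ?_⟩
      · intro z; simp <;> omega
      · intro z; simp <;> omega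
      · rw [Finset.disjoint_left]; intro z; simp; omega
      · rw [Finset.card_insert_of_notMem (by simp; omega), Nat.card_Icc]
        omega
      · rw [Finset.card_erase_of_mem (by simpa using hi), Finset.card_range]
        omega
      · simp
      · simp; omega
      · intro a ha b hb
        simp only [Finset.mem_insert, Finset.mem_range, Finset.mem_erase, Finset.mem_Icc] at ha hb
        simp only [m1, m2, m3, m4, Finset.notMem_empty, false_or, Sym2.eq_iff, ne_eq]
        constructor
        · rintro (((⟨j, hj, h⟩ | ⟨j, hj, h⟩) | ⟨j, hj, h⟩) | ⟨j, hj, h⟩) <;> omega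
        · intro j hj; omega)
  refine ⟨E5, d5, ?_⟩
  rw [n5, n4, n3, n2, n1, Finset.card_empty]
  omega

lemma dis_fin {n s : ℕ} {E : Finset (Sym2 ℕ)} (h : Dis (Finset.range n) s E) :
    ∃ E' : Finset (Sym2 (Fin n)), Dis Finset.univ s E' ∧ E'.card = E.card ∧
      ∀ a b : Fin n, s(a, b) ∈ E' ↔ s((a : ℕ), (b : ℕ)) ∈ E := by
  induction h with
  | empty => exact ⟨∅, Dis.empty, rfl, by simp⟩
  | step E A B x y hE hA hB hAB cA cB hx hy hno ih =>
    obtain ⟨E', d, c, m⟩ := ih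
    have key : ∀ S ⊆ Finset.range n,
        (Finset.univ.filter (fun z : Fin n => (z : ℕ) ∈ S)).card = S.card := by
      intro S hS
      rw [← Finset.card_map Fin.valEmbedding]
      congr 1
      ext z
      simp only [Finset.mem_map, Finset.mem_filter, Finset.mem_univ, true_and,
        Fin.valEmbedding_apply]
      constructor
      · rintro ⟨a, ha, rfl⟩; exact ha
      · intro hz; exact ⟨⟨z, Finset.mem_range.1 (hS hz)⟩, hz, rfl⟩
    have hno' : ∀ a ∈ Finset.univ.filter (fun z : Fin n => (z : ℕ) ∈ A),
        ∀ b ∈ Finset.univ.filter (fun z : Fin n => (z : ℕ) ∈ B), s(a, b) ∉ E' := by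
      intro a ha b hb
      rw [m]
      exact hno _ (by simpa using ha) _ (by simpa using hb)
    have hx' : (⟨x, Finset.mem_range.1 (hA hx)⟩ : Fin n) ∈
      Finset.univ.filter (fun z : Fin n => (z : ℕ) ∈ A) := by simpa using hx
    have hy' : (⟨y, Finset.mem_range.1 (hB hy)⟩ : Fin n) ∈
      Finset.univ.filter (fun z : Fin n => (z : ℕ) ∈ B) := by simpa using hy
    refine ⟨_, Dis.step E' _ _ _ _ d (Finset.subset_univ _) (Finset.subset_univ _) ?_
      (by rw [key A hA, cA]) (by rw [key B hB, cB]) hx' hy' hno', ?_, ?_⟩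
    · rw [Finset.disjoint_left]
      intro z hz hz'
      exact Finset.disjoint_left.1 hAB (by simpa using hz) (by simpa using hz')
    · rw [Finset.card_insert_of_notMem (hno' _ hx' _ hy'),
        Finset.card_insert_of_notMem (hno _ hx _ hy), c]
    · intro a b
      simp only [Finset.mem_insert, m, Sym2.eq_iff, Fin.ext_iff]

/-- a copy of `K_{s,s}` gives two disjoint sets -/
lemma sets_of_embedding {V : Type*} [DecidableEq V] {s : ℕ} (f : Fin s ⊕ Fin s ↪ V) :
    Disjoint (Finset.univ.image (fun i => f (Sum.inl i)))
      (Finset.univ.image (fun i => f (Sum.inr i))) ∧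
    (Finset.univ.image (fun i => f (Sum.inl i))).card = s ∧
    (Finset.univ.image (fun i => f (Sum.inr i))).card = s := by
  refine ⟨?_, ?_, ?_⟩
  · rw [Finset.disjoint_left]
    intro z hz hz'
    simp only [Finset.mem_image, Finset.mem_univ, true_and] at hz hz'
    obtain ⟨a, rfl⟩ := hz
    obtain ⟨b, hb⟩ := hz'
    simpa using f.injective hb
  · rw [Finset.card_image_of_injective _ (fun a b h => by simpa using f.injective h)]
    simp
  · rw [Finset.card_image_of_injective _ (fun a b h => by simpa using f.injective h)]
    simp

open Classical in
lemma dis_of_chain {n s : ℕ} (m : ℕ) : ∀ (c : ℕ → SimpleGraph (Fin n)), c m = ⊤ →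
    (∀ i < m, AddStep (completeBipartiteGraph (Fin s) (Fin s)) (c i) (c (i + 1))) →
    Dis Finset.univ s (c 0)ᶜ.edgeFinset := by
  induction m with
  | zero =>
    intro c h0 _
    have : (c 0)ᶜ.edgeFinset = ∅ := by
      rw [Finset.eq_empty_iff_forall_notMem]
      intro e
      rw [h0]
      simp
    rw [this]
    exact Dis.empty
  | succ m ih =>
    intro c hm hstep
    have hD := ih (fun i => c (i + 1)) hm (fun i hi => hstep (i + 1) (by omega))
    obtain ⟨e, he, hins, f, hf, a, b, hab, hfe⟩ := hstep 0 (by omega)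
    obtain ⟨d, cA, cB⟩ := sets_of_embedding f
    have hne : ¬ e.IsDiag := by
      have : e ∈ (c (0 + 1)).edgeSet := by rw [hins]; exact Set.mem_insert _ _
      exact SimpleGraph.not_isDiag_of_mem_edgeSet _ this
    have hEq : (c 0)ᶜ.edgeFinset = insert e (c 1)ᶜ.edgeFinset := by
      ext z
      have hz := congrArg (z ∈ ·) hins
      induction z with
      | _ x y =>
        simp only [zero_add, Set.mem_insert_iff, SimpleGraph.mem_edgeSet, eq_iff_iff] at hz
        simp only [SimpleGraph.mem_edgeFinset, SimpleGraph.mem_edgeSet, SimpleGraph.compl_adj,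
          Finset.mem_insert, hz]
        by_cases hxe : s(x, y) = e
        · subst hxe
          simp only [SimpleGraph.mem_edgeSet] at he
          simpa [he] using hne
        · simp [hxe]
    have hno : ∀ x ∈ Finset.univ.image (fun i => f (Sum.inl i)),
        ∀ y ∈ Finset.univ.image (fun i => f (Sum.inr i)), s(x, y) ∉ (c 1)ᶜ.edgeFinset := by
      intro x hx y hy
      simp only [Finset.mem_image, Finset.mem_univ, true_and] at hx hy
      obtain ⟨i, rfl⟩ := hx
      obtain ⟨j, rfl⟩ := hy
      have := hf (Sum.inl i) (Sum.inr j) (by simp)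
      simp only [zero_add] at this
      simp [this]
    rw [hEq, ← hfe]
    rcases a with a | a <;> rcases b with b | b
    · simp at hab
    · exact Dis.step _ _ _ _ _ hD (Finset.subset_univ _) (Finset.subset_univ _) d cA cB
        (by simp) (by simp) hno
    · rw [Sym2.eq_swap]
      exact Dis.step _ _ _ _ _ hD (Finset.subset_univ _) (Finset.subset_univ _) d cA cB
        (by simp) (by simp) hno
    · simp at hab

lemma embedding_of_sets {V : Type*} [DecidableEq V] {s : ℕ} {A B : Finset V} (hAB : Disjoint A B)
    (cA : A.card = s) (cB : B.card = s) : ∃ f : Fin s ⊕ Fin s ↪ V,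
      (∀ i, f (Sum.inl i) ∈ A) ∧ (∀ i, f (Sum.inr i) ∈ B) ∧
      (∀ a ∈ A, ∃ i, f (Sum.inl i) = a) ∧ (∀ b ∈ B, ∃ i, f (Sum.inr i) = b) := by
  let ea := (A.equivFinOfCardEq cA).symm
  let eb := (B.equivFinOfCardEq cB).symm
  refine ⟨⟨Sum.elim (fun i => (ea i : V)) (fun i => (eb i : V)), ?_⟩, ?_, ?_, ?_, ?_⟩
  · rintro (i | i) (j | j) h
    · rw [ea.injective (Subtype.ext h)]
    · simp only [Sum.elim_inl, Sum.elim_inr] at h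
      exact absurd (h ▸ (eb j).2) (Finset.disjoint_left.1 hAB (ea i).2)
    · simp only [Sum.elim_inl, Sum.elim_inr] at h
      exact absurd (h ▸ (eb i).2) (Finset.disjoint_left.1 hAB (ea j).2)
    · rw [eb.injective (Subtype.ext h)]
  · intro i; exact (ea i).2
  · intro i; exact (eb i).2
  · intro a ha; exact ⟨ea.symm ⟨a, ha⟩, congrArg Subtype.val (ea.apply_symm_apply ⟨a, ha⟩)⟩
  · intro b hb; exact ⟨eb.symm ⟨b, hb⟩, congrArg Subtype.val (eb.apply_symm_apply ⟨b, hb⟩)⟩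

/-- complement graph of a set of edges -/
def cg {V : Type*} [DecidableEq V] (E : Finset (Sym2 V)) : SimpleGraph V :=
  SimpleGraph.fromEdgeSet ((E : Set (Sym2 V))ᶜ)

lemma cg_adj {V : Type*} [DecidableEq V] (E : Finset (Sym2 V)) (x y : V) :
    (cg E).Adj x y ↔ s(x, y) ∉ E ∧ x ≠ y := by
  simp [cg]

lemma chain_of_dis {n s : ℕ} {E : Finset (Sym2 (Fin n))} (h : Dis Finset.univ s E) :
    ∃ (m : ℕ) (c : ℕ → SimpleGraph (Fin n)), c 0 = cg E ∧ c m = ⊤ ∧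
      ∀ i < m, AddStep (completeBipartiteGraph (Fin s) (Fin s)) (c i) (c (i + 1)) := by
  induction h with
  | empty => exact ⟨0, fun _ => ⊤, by ext; simp [cg_adj], rfl, by simp⟩
  | step E A B x y hE hA hB hAB cA cB hx hy hno ih =>
    obtain ⟨m, c, h0, hm, hs⟩ := ih
    obtain ⟨f, f1, f2, f3, f4⟩ := embedding_of_sets hAB cA cB
    have hd : ∀ z, z ∈ A → z ∉ B := fun _ h => Finset.disjoint_left.1 hAB h
    have hxy : x ≠ y := by rintro rfl; exact hd _ hx hy
    refine ⟨m + 1, fun i => if i = 0 then cg (insert s(x, y) E) else c (i - 1), by simp,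
      by simpa using hm, ?_⟩
    rintro (_ | i) hi
    · simp only [if_true, zero_add, one_ne_zero, if_false, Nat.sub_self, h0]
      refine ⟨s(x, y), ?_, ?_, f, ?_, ?_⟩
      · simp [cg_adj]
      · ext z
        induction z with
        | _ a b =>
          simp only [SimpleGraph.mem_edgeSet, cg_adj, Set.mem_insert_iff, Finset.mem_insert]
          by_cases hab : s(a, b) = s(x, y)
          · have : a ≠ b := by
              rintro rfl
              simp only [Sym2.eq_iff] at hab
              grind
            simp [hab, hno x hx y hy, this]
          · simp [hab]
      · intro a b hab
        rw [cg_adj]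
        refine ⟨?_, fun h => hab.ne (f.injective h)⟩
        rcases a with a | a <;> rcases b with b | b
        · simp at hab
        · exact hno _ (f1 a) _ (f2 b)
        · rw [Sym2.eq_swap]; exact hno _ (f1 b) _ (f2 a)
        · simp at hab
      · obtain ⟨i, hi⟩ := f3 x hx
        obtain ⟨j, hj⟩ := f4 y hy
        exact ⟨Sum.inl i, Sum.inr j, by simp, by rw [hi, hj]⟩
    · have := hs i (by omega)
      simpa using this

open Classical in
lemma card_compl {n : ℕ} (G : SimpleGraph (Fin n)) :
    G.edgeSet.ncard + Gᶜ.edgeFinset.card = n.choose 2 := by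
  have h1 : G.edgeSet.ncard = G.edgeFinset.card := by
    rw [Set.ncard_eq_toFinset_card']; simp [SimpleGraph.edgeFinset]
  rw [h1, ← Finset.card_union_of_disjoint, ← SimpleGraph.edgeFinset_sup]
  · have := SimpleGraph.card_edgeFinset_top_eq_card_choose_two (V := Fin n)
    rw [Fintype.card_fin] at this
    rw [← this]
    congr 1
    ext e
    simp only [SimpleGraph.mem_edgeFinset]
    rw [sup_compl_eq_top]
  · rw [SimpleGraph.disjoint_edgeFinset]
    exact disjoint_compl_right

theorem wsat_Kss (s : ℕ) (hs : 2 < s) :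
    (wsat (2 * s + 1) (completeBipartiteGraph (Fin s) (Fin s)) : ℤ) =
      ((2 * s + 1).choose 2 : ℤ) - (4 * s - 4) := by
  classical
  have hV : (Finset.univ : Finset (Fin (2 * s + 1))).card = 2 * s + 1 := by simp
  have low : ∀ m ∈ {m | ∃ G : SimpleGraph (Fin (2 * s + 1)),
      IsWeaklySaturated (completeBipartiteGraph (Fin s) (Fin s)) G ∧ G.edgeSet.ncard = m},
      (2 * s + 1).choose 2 ≤ m + (4 * s - 4) := by
    rintro m ⟨G, ⟨-, k, c, h0, hk, hst⟩, rfl⟩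
    have hD := dis_of_chain k c hk hst
    rw [h0] at hD
    have := hD.card_le hs hV
    have := card_compl G
    omega
  obtain ⟨E0, hE0, hc0⟩ := exists_dis_nat s hs
  obtain ⟨E, hE, hc, -⟩ := dis_fin hE0
  have hdiag : ∀ e ∈ E, ¬ e.IsDiag := by
    clear hc
    induction hE with
    | empty => simp
    | step E A B x y hE hA hB hAB cA cB hx hy hno ih =>
      intro e he
      rcases Finset.mem_insert.1 he with rfl | he
      · rw [Sym2.mk_isDiag_iff]
        rintro rfl
        exact Finset.disjoint_left.1 hAB hx hy
      · exact ih e he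
  have hcompl : (cg E)ᶜ.edgeFinset = E := by
    ext z
    have := hdiag z
    induction z with
    | _ a b =>
      simp only [SimpleGraph.mem_edgeFinset, SimpleGraph.mem_edgeSet, SimpleGraph.compl_adj, cg_adj]
      rw [Sym2.mk_isDiag_iff] at this
      tauto
  have hcard := card_compl (cg E)
  rw [hcompl] at hcard
  have mem : (cg E).edgeSet.ncard ∈ {m | ∃ G : SimpleGraph (Fin (2 * s + 1)),
      IsWeaklySaturated (completeBipartiteGraph (Fin s) (Fin s)) G ∧ G.edgeSet.ncard = m} := by
    refine ⟨cg E, ⟨?_, chain_of_dis hE⟩, rfl⟩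
    rintro ⟨f, hf⟩
    obtain ⟨d, cA, cB⟩ := sets_of_embedding f
    have hno : ∀ x ∈ Finset.univ.image (fun i => f (Sum.inl i)),
        ∀ y ∈ Finset.univ.image (fun i => f (Sum.inr i)), s(x, y) ∉ E := by
      intro x hx y hy
      simp only [Finset.mem_image, Finset.mem_univ, true_and] at hx hy
      obtain ⟨i, rfl⟩ := hx
      obtain ⟨j, rfl⟩ := hy
      exact ((cg_adj _ _ _).1 (hf (Sum.inl i) (Sum.inr j) (by simp))).1
    have i0 : Fin s := ⟨0, by omega⟩
    have m1 : f (Sum.inl i0) ∈ Finset.univ.image (fun i => f (Sum.inl i)) := by simp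
    have m2 : f (Sum.inr i0) ∈ Finset.univ.image (fun i => f (Sum.inr i)) := by simp
    have := (Dis.step E _ _ _ _ hE (Finset.subset_univ _) (Finset.subset_univ _) d cA cB
      m1 m2 hno).card_le hs hV
    rw [Finset.card_insert_of_notMem (hno _ m1 _ m2)] at this
    omega
  have l1 := low _ (Nat.sInf_mem ⟨_, mem⟩)
  have l2 := Nat.sInf_le mem
  unfold wsat
  omega
end

section
/- For every integer s > 2, the maximum number of edges of an erasable graph on 2s+1 vertices (with parameters s,t = s) equals 4s−4; in particular every erasable graph on 2s+1 vertices has at most 4s−4 edges. -/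
open SimpleGraph
/-- One step of the erase process with parameters `s`, `t`: delete an edge `e` that is
the unique edge between a set `V₁` of size `s` and a set `V₂` of size `t`, where
`V₁`, `V₂` and one extra vertex `v` partition the vertex set. -/
def EraseStep (s t : ℕ) {V : Type*} (G G' : SimpleGraph V) : Prop :=
  ∃ e ∈ G.edgeSet, G'.edgeSet = G.edgeSet \ {e} ∧
    ∃ (V1 V2 : Set V) (v : V),
      Disjoint V1 V2 ∧ v ∉ V1 ∧ v ∉ V2 ∧ V1 ∪ V2 ∪ {v} = Set.univ ∧
      V1.ncard = s ∧ V2.ncard = t ∧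
      (∃ x ∈ V1, ∃ y ∈ V2, e = s(x, y)) ∧
      ∀ x ∈ V1, ∀ y ∈ V2, G.Adj x y → s(x, y) = e

/-- `G` is erasable (with parameters `s`, `t`): its edges can be deleted one at a time
by erase steps until no edge remains. -/
def Erasable (s t : ℕ) {V : Type*} (G : SimpleGraph V) : Prop :=
  ∃ (m : ℕ) (c : ℕ → SimpleGraph V), c 0 = G ∧ c m = ⊥ ∧
    ∀ i < m, EraseStep s t (c i) (c (i + 1))


open Finset in
/-- balanced partition of the vertex set with a pivot -/
structure BPart (s : ℕ) {V : Type} [Fintype V] [DecidableEq V] (A B : Finset V) (u : V) : Prop where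
  disj : ∀ x, x ∈ A → x ∈ B → False
  uA : u ∉ A
  uB : u ∉ B
  cover : ∀ x, x ∈ A ∨ x ∈ B ∨ x = u
  cA : A.card = s
  cB : B.card = s

/-- edge sets which can be built up (reverse of the erase process) -/
inductive Er (s : ℕ) {V : Type} [Fintype V] [DecidableEq V] : Finset (Sym2 V) → Prop
  | nil : Er s ∅
  | step (E : Finset (Sym2 V)) (A B : Finset V) (u x y : V) : Er s E → BPart s A B u →
      x ∈ A → y ∈ B → (∀ a ∈ A, ∀ b ∈ B, s(a, b) ∉ E) → Er s (insert s(x, y) E)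

section EraHelp

variable {V : Type} [Fintype V] [DecidableEq V] {s : ℕ}

def cnt (E : Finset (Sym2 V)) (X : Finset V) : ℕ := (E.filter (fun e => ∀ x ∈ e, x ∈ X)).card

theorem BPart.symm {A B : Finset V} {u : V} (h : BPart s A B u) : BPart s B A u :=
  ⟨fun x a b => h.disj x b a, h.uB, h.uA, fun x => by have := h.cover x; tauto, h.cB, h.cA⟩

theorem cnt_split (E : Finset (Sym2 V)) (X X1 X2 : Finset V)
    (h : ∀ a b, s(a, b) ∈ E → a ∈ X → b ∈ X → (a ∈ X1 ∧ b ∈ X1) ∨ (a ∈ X2 ∧ b ∈ X2)) :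
    cnt E X ≤ cnt E X1 + cnt E X2 := by
  unfold cnt
  refine le_trans (Finset.card_le_card ?_) (Finset.card_union_le _ _)
  intro e he
  induction e with | _ a b
  simp only [Finset.mem_filter, Finset.mem_union, Sym2.mem_iff] at he ⊢
  have := h a b he.1 (he.2 a (Or.inl rfl)) (he.2 b (Or.inr rfl))
  rcases this with h | h
  · left; refine ⟨he.1, ?_⟩; rintro x (rfl | rfl); exacts [h.1, h.2]
  · right; refine ⟨he.1, ?_⟩; rintro x (rfl | rfl); exacts [h.1, h.2]

theorem cnt_mono (E : Finset (Sym2 V)) {X Y : Finset V} (h : X ⊆ Y) : cnt E X ≤ cnt E Y := by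
  unfold cnt
  refine Finset.card_le_card ?_
  intro e he
  simp only [Finset.mem_filter] at he ⊢
  exact ⟨he.1, fun x hx => h (he.2 x hx)⟩

theorem cnt_univ (E : Finset (Sym2 V)) : cnt E Finset.univ = E.card := by
  unfold cnt; simp

theorem cnt_insert_le (E : Finset (Sym2 V)) (e) (X : Finset V) :
    cnt (insert e E) X ≤ cnt E X + 1 := by
  unfold cnt
  rw [Finset.filter_insert]
  split_ifs
  · exact Finset.card_insert_le _ _
  · omega

theorem cnt_insert_not (E : Finset (Sym2 V)) (x y : V) (X : Finset V) (h : ¬ (x ∈ X ∧ y ∈ X)) :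
    cnt (insert s(x, y) E) X = cnt E X := by
  unfold cnt
  rw [Finset.filter_insert, if_neg]
  intro h2
  exact h ⟨h2 x (by simp), h2 y (by simp)⟩

theorem cnt_part {E : Finset (Sym2 V)} {A B : Finset V} {u : V} (hP : BPart s A B u)
    (hE : ∀ a ∈ A, ∀ b ∈ B, s(a, b) ∉ E) (X : Finset V) :
    cnt E X ≤ cnt E (X \ B) + cnt E (X \ A) := by
  apply cnt_split
  intro a b hab ha hb
  have h1 := hP.cover a
  have h2 := hP.cover b
  have h3 := fun h h' => hE a h b h' hab
  have h4 := fun h h' => hE b h a h' (by rwa [Sym2.eq_swap])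
  have h5 := hP.disj a
  have h6 := hP.disj b
  simp only [Finset.mem_sdiff]
  tauto

/-- numeric description of how a partition cuts a set -/
theorem part_num {A B : Finset V} {u : V} (hP : BPart s A B u) (X : Finset V) :
    ∃ a b d : ℕ, (X ∩ A).card = a ∧ (X ∩ B).card = b ∧ (X \ B).card = a + d ∧
      (X \ A).card = b + d ∧
      X.card = a + b + d ∧ d ≤ 1 ∧ (u ∈ X → d = 1) ∧ (u ∉ X → d = 0) := by
  refine ⟨_, _, (X ∩ {u}).card, rfl, rfl, ?_, ?_, ?_, ?_, ?_, ?_⟩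
  · rw [← Finset.card_union_of_disjoint]
    · congr 1; ext x
      have := hP.cover x; have := hP.disj x; have := hP.uB
      simp only [Finset.mem_sdiff, Finset.mem_union, Finset.mem_inter, Finset.mem_singleton]
      by_cases hx : x = u
      · subst hx; tauto
      · tauto
    · rw [Finset.disjoint_left]; intro x; have := hP.uA
      simp only [Finset.mem_inter, Finset.mem_singleton]
      rintro ⟨_, h⟩ ⟨_, rfl⟩; exact this h
  · rw [← Finset.card_union_of_disjoint]
    · congr 1; ext x
      have := hP.cover x; have := hP.disj x; have := hP.uA
      simp only [Finset.mem_sdiff, Finset.mem_union, Finset.mem_inter, Finset.mem_singleton]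
      by_cases hx : x = u
      · subst hx; tauto
      · tauto
    · rw [Finset.disjoint_left]; intro x; have := hP.uB
      simp only [Finset.mem_inter, Finset.mem_singleton]
      rintro ⟨_, h⟩ ⟨_, rfl⟩; exact this h
  · rw [← Finset.card_union_of_disjoint, ← Finset.card_union_of_disjoint]
    · congr 1; ext x
      have := hP.cover x
      simp only [Finset.mem_union, Finset.mem_inter, Finset.mem_singleton]
      tauto
    · rw [Finset.disjoint_left]; intro x; have := hP.uA; have := hP.uB
      simp only [Finset.mem_inter, Finset.mem_singleton, Finset.mem_union]
      rintro (⟨_, h⟩ | ⟨_, h⟩) ⟨_, rfl⟩ <;> tauto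
    · rw [Finset.disjoint_left]; intro x; have := hP.disj x
      simp only [Finset.mem_inter]
      tauto
  · exact (Finset.card_le_card Finset.inter_subset_right).trans (by simp)
  · intro h
    rw [Finset.inter_singleton_of_mem h]; simp
  · intro h
    rw [Finset.inter_singleton_of_notMem h]; simp

theorem part_card {A B : Finset V} {u : V} (hP : BPart s A B u) : Fintype.card V = 2 * s + 1 := by
  obtain ⟨a, b, d, h1, h2, h3, h4, h5, h6, h7, h8⟩ := part_num hP Finset.univ
  have := h7 (Finset.mem_univ _)
  rw [Finset.univ_inter] at h1 h2
  rw [Finset.card_univ] at h5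
  have := hP.cA; have := hP.cB
  omega

theorem two_disj {X Y A : Finset V} (h : Disjoint X Y) : (X ∩ A).card + (Y ∩ A).card ≤ A.card := by
  rw [← Finset.card_union_of_disjoint]
  · apply Finset.card_le_card; intro x; simp; tauto
  · exact Disjoint.mono Finset.inter_subset_left Finset.inter_subset_left h

theorem pos_of_mem {X A : Finset V} {x : V} (h : x ∈ X) (h' : x ∈ A) : 1 ≤ (X ∩ A).card :=
  Finset.card_pos.mpr ⟨x, Finset.mem_inter.mpr ⟨h, h'⟩⟩

theorem er_sparse {E : Finset (Sym2 V)} (hE : Er s E) : ∀ X, cnt E X ≤ 2 * X.card - 3 := by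
  induction hE with
  | nil => intro X; simp [cnt]
  | step E A B u x y hE hP hx hy hc ih =>
    intro X
    by_cases h : x ∈ X ∧ y ∈ X
    · have h0 := cnt_insert_le E s(x, y) X
      have h1 := cnt_part hP hc X
      have h2 := ih (X \ B)
      have h3 := ih (X \ A)
      obtain ⟨a, b, d, e1, e2, e3, e4, e5, e6, -, -⟩ := part_num hP X
      have := pos_of_mem h.1 hx
      have := pos_of_mem h.2 hy
      omega
    · rw [cnt_insert_not E x y X h]; exact ih X

theorem er_T (hs : 2 < s) {E : Finset (Sym2 V)} (hE : Er s E) : ∀ S W : Finset V, Disjoint S W →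
    S.card = s → W.card = s → cnt E S + cnt E W + 7 ≤ 4 * s := by
  induction hE with
  | nil => intro X; simp [cnt]; omega
  | step E A B u x y hE hP hx hy hc ih =>
    have key : ∀ S W : Finset V, Disjoint S W → S.card = s → W.card = s → x ∈ S → y ∈ S →
        cnt E S + cnt E W + 8 ≤ 4 * s := by
      intro S W hd hS hW hxS hyS
      have sp := er_sparse hE
      have h1 := cnt_part hP hc S
      have h2 := sp (S \ B)
      have h3 := sp (S \ A)
      have h1' := cnt_part hP hc W
      have h2' := sp (W \ B)
      have h3' := sp (W \ A)
      have h4 := sp S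
      have h5 := sp W
      obtain ⟨a, b, d, e1, e2, e3, e4, e5, e6, e7, e8⟩ := part_num hP S
      obtain ⟨a', b', d', e1', e2', e3', e4', e5', e6', e7', e8'⟩ := part_num hP W
      have := pos_of_mem hxS hx
      have := pos_of_mem hyS hy
      have q1 := two_disj (A := A) hd
      have q2 := two_disj (A := B) hd
      rw [hP.cA] at q1
      rw [hP.cB] at q2
      have q3 : d + d' ≤ 1 := by
        by_cases hu : u ∈ S
        · have := e8' (Finset.disjoint_left.mp hd hu); omega
        · have := e8 hu; omega
      omega
    intro S W hd hS hW
    by_cases h1 : x ∈ S ∧ y ∈ S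
    · have h2 : ¬ (x ∈ W ∧ y ∈ W) := fun h => Finset.disjoint_left.mp hd h1.1 h.1
      have := key S W hd hS hW h1.1 h1.2
      have := cnt_insert_le E s(x, y) S
      rw [cnt_insert_not E x y W h2]
      omega
    · rw [cnt_insert_not E x y S h1]
      by_cases h2 : x ∈ W ∧ y ∈ W
      · have := key W S hd.symm hW hS h2.1 h2.2
        have := cnt_insert_le E s(x, y) W
        omega
      · rw [cnt_insert_not E x y W h2]
        exact ih S W hd hS hW

theorem er_E (hs : 2 < s) {E : Finset (Sym2 V)} (hE : Er s E) : ∀ S W : Finset V, Disjoint S W →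
    S.card = s → W.card = s + 1 → cnt E S + cnt E W + 6 ≤ 4 * s := by
  induction hE with
  | nil => intro X; simp [cnt]; omega
  | step E A B u x y hE hP hx hy hc ih =>
    intro S W hd hS hW
    have sp := er_sparse hE
    have h1 := cnt_part hP hc S
    have h2 := sp (S \ B)
    have h3 := sp (S \ A)
    have h1' := cnt_part hP hc W
    have h2' := sp (W \ B)
    have h3' := sp (W \ A)
    have h4 := sp S
    have h5 := sp W
    obtain ⟨a, b, d, e1, e2, e3, e4, e5, e6, e7, e8⟩ := part_num hP S
    obtain ⟨a', b', d', e1', e2', e3', e4', e5', e6', e7', e8'⟩ := part_num hP W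
    have q1 := two_disj (A := A) hd
    have q2 := two_disj (A := B) hd
    rw [hP.cA] at q1
    rw [hP.cB] at q2
    have q3 : d + d' ≤ 1 := by
      by_cases hu : u ∈ S
      · have := e8' (Finset.disjoint_left.mp hd hu); omega
      · have := e8 hu; omega
    by_cases c1 : x ∈ S ∧ y ∈ S
    · have c2 : ¬ (x ∈ W ∧ y ∈ W) := fun h => Finset.disjoint_left.mp hd c1.1 h.1
      have := pos_of_mem c1.1 hx
      have := pos_of_mem c1.2 hy
      have := cnt_insert_le E s(x, y) S
      rw [cnt_insert_not E x y W c2]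
      omega
    · rw [cnt_insert_not E x y S c1]
      by_cases c2 : x ∈ W ∧ y ∈ W
      · have := pos_of_mem c2.1 hx
        have := pos_of_mem c2.2 hy
        have := cnt_insert_le E s(x, y) W
        have t1 : (W \ B).card = s → cnt E S + cnt E (W \ B) + 7 ≤ 4 * s := fun h =>
          er_T hs hE S (W \ B) (hd.mono_right Finset.sdiff_subset) hS h
        have t2 : (W \ A).card = s → cnt E S + cnt E (W \ A) + 7 ≤ 4 * s := fun h =>
          er_T hs hE S (W \ A) (hd.mono_right Finset.sdiff_subset) hS h
        by_cases w1 : (W \ B).card = s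
        · have := t1 w1
          omega
        · by_cases w2 : (W \ A).card = s
          · have := t2 w2
            omega
          · omega
      · rw [cnt_insert_not E x y W c2]
        exact ih S W hd hS hW

set_option maxHeartbeats 2000000 in
/-- two different pivots -/
theorem er_main_aux (hs : 2 < s) {E : Finset (Sym2 V)} (hE : Er s E) {A B A' B' : Finset V} {u v : V}
    (hP : BPart s A B v) (hP' : BPart s A' B' u)
    (hc : ∀ a ∈ A, ∀ b ∈ B, s(a, b) ∉ E) (hc' : ∀ a ∈ A', ∀ b ∈ B', s(a, b) ∉ E)
    (hu : u ∈ A) (hv : v ∈ A') : E.card + 6 ≤ 4 * s := by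
  have sp := er_sparse hE
  have k0 := cnt_part hP' hc' Finset.univ
  rw [cnt_univ] at k0
  have k1 := cnt_part hP hc (Finset.univ \ B')
  have k2 := cnt_part hP hc (Finset.univ \ A')
  have huB : u ∉ B := fun h => hP.disj u hu h
  have hvB' : v ∉ B' := fun h => hP'.disj v hv h
  obtain ⟨a, b, d, e1, e2, e3, e4, e5, e6, e7, e8⟩ := part_num hP (Finset.univ \ B')
  obtain ⟨a', b', d', e1', e2', e3', e4', e5', e6', e7', e8'⟩ := part_num hP (Finset.univ \ A')
  have hd : d = 1 := e7 (by simp [hvB'])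
  have hd' : d' = 0 := e8' (by simp [hv])
  have n := part_card hP
  have c1 : (Finset.univ \ B').card = s + 1 := by
    rw [Finset.card_univ_sdiff, hP'.cB]; omega
  have c2 : (Finset.univ \ A').card = s + 1 := by
    rw [Finset.card_univ_sdiff, hP'.cA]; omega
  have hB : b + b' = s := by
    obtain ⟨x, y, z, i1, i2, i3, i4, i5, i6, i7, i8⟩ := part_num hP' B
    have j0 := hP.cB
    have j1 := i8 huB
    have : (Finset.univ \ B') ∩ B = B \ B' := by ext x; simp [and_comm]
    rw [this] at e2
    have : (Finset.univ \ A') ∩ B = B \ A' := by ext x; simp [and_comm]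
    rw [this] at e2'
    omega
  have p1 := sp ((Finset.univ \ B') \ B)
  have p2 := sp ((Finset.univ \ B') \ A)
  have p3 := sp ((Finset.univ \ A') \ B)
  have p4 := sp ((Finset.univ \ A') \ A)
  have ha1 : 1 ≤ a := by
    rw [← e1]; exact pos_of_mem (by simp [hP'.uB]) hu
  have ha1' : 1 ≤ a' := by
    rw [← e1']; exact pos_of_mem (by simp [hP'.uA]) hu
  by_cases hb : b = 0
  ·
    have hBB : B = B' := by
      apply Finset.eq_of_subset_of_card_le
      · intro x hx
        by_contra h
        have : x ∈ (Finset.univ \ B') ∩ B := by simp [h, hx]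
        have := Finset.card_pos.mpr ⟨x, this⟩
        omega
      · rw [hP.cB, hP'.cB]
    have hd2 : Disjoint B (Finset.univ \ B') := by rw [hBB]; exact Finset.disjoint_sdiff
    have := er_E hs hE B (Finset.univ \ B') hd2 hP.cB c1
    have h5 : cnt E (Finset.univ \ A') ≤ cnt E B + cnt E {u} := by
      apply cnt_split
      intro x y hxy hx hy
      simp only [Finset.mem_sdiff, Finset.mem_univ, true_and] at hx hy
      have q1 := hP'.cover x
      have q2 := hP'.cover y
      rw [← hBB] at q1 q2
      simp only [Finset.mem_singleton]
      rcases q1 with q1 | q1 | q1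
      · exact absurd q1 hx
      · rcases q2 with q2 | q2 | q2
        · exact absurd q2 hy
        · exact Or.inl ⟨q1, q2⟩
        · rw [q2, Sym2.eq_swap] at hxy
          exact absurd hxy (hc u hu x q1)
      · rcases q2 with q2 | q2 | q2
        · exact absurd q2 hy
        · rw [q1] at hxy
          exact absurd hxy (hc u hu y q2)
        · exact Or.inr ⟨q1, q2⟩
    have h6 := sp {u}
    simp at h6
    omega
  · by_cases hb1 : b' = 1
    ·
      have q1 : a' = s := by omega
      have hd3 : Disjoint ((Finset.univ \ A') \ B) ((Finset.univ \ B') \ A) := by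
        rw [Finset.disjoint_left]
        intro x
        have := hP.cover x
        simp only [Finset.mem_sdiff, Finset.mem_univ, true_and]
        have hva : v ∈ A' := hv
        rintro ⟨h1, h2⟩ ⟨h3, h4⟩
        rcases this with h | h | h
        · exact h4 h
        · exact h2 h
        · subst h; exact h1 hv
      have := er_T hs hE _ _ hd3 (by omega) (by omega)
      omega
    · omega

theorem er_main_ne (hs : 2 < s) {E : Finset (Sym2 V)} (hE : Er s E) {A B A' B' : Finset V} {u v : V}
    (hP : BPart s A B v) (hP' : BPart s A' B' u)
    (hc : ∀ a ∈ A, ∀ b ∈ B, s(a, b) ∉ E) (hc' : ∀ a ∈ A', ∀ b ∈ B', s(a, b) ∉ E)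
    (huv : u ≠ v) : E.card + 6 ≤ 4 * s := by
  have hcs : ∀ a ∈ B, ∀ b ∈ A, s(a, b) ∉ E := fun a ha b hb => by
    rw [Sym2.eq_swap]; exact hc b hb a ha
  have hcs' : ∀ a ∈ B', ∀ b ∈ A', s(a, b) ∉ E := fun a ha b hb => by
    rw [Sym2.eq_swap]; exact hc' b hb a ha
  rcases hP.cover u with h | h | h
  · rcases hP'.cover v with g | g | g
    · exact er_main_aux hs hE hP hP' hc hc' h g
    · exact er_main_aux hs hE hP hP'.symm hc hcs' h g
    · exact absurd g.symm huv
  · rcases hP'.cover v with g | g | g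
    · exact er_main_aux hs hE hP.symm hP' hcs hc' h g
    · exact er_main_aux hs hE hP.symm hP'.symm hcs hcs' h g
    · exact absurd g.symm huv
  · exact absurd h huv

theorem cnt_color {E : Finset (Sym2 V)} (f : V → ℕ) (X : Finset V) (v : V) (hv : v ∉ X) (D : Finset V)
    (hD : D ⊆ {v}) (hloop : ∀ e ∈ E, ¬ e.IsDiag)
    (h : ∀ a b, a ≠ v → b ≠ v → s(a, b) ∈ E → a ∈ X → b ∈ X → f a = f b) :
    cnt E (X ∪ D) ≤ ∑ c ∈ X.image f, cnt E (X.filter (fun x => f x = c) ∪ D) := by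
  unfold cnt
  refine le_trans (Finset.card_le_card ?_) Finset.card_biUnion_le
  intro e he
  induction e with | _ a b
  simp only [Finset.mem_filter, Finset.mem_union, Sym2.mem_iff] at he
  have hab : a ≠ b := by
    have := hloop _ he.1; simpa using this
  have ha := he.2 a (Or.inl rfl)
  have hb := he.2 b (Or.inr rfl)
  simp only [Finset.mem_biUnion, Finset.mem_filter, Finset.mem_union, Sym2.mem_iff, Finset.mem_image]
  have hDv : ∀ x ∈ D, x = v := fun x hx => by simpa using hD hx
  rcases ha with ha | ha
  · refine ⟨f a, ⟨a, ha, rfl⟩, he.1, ?_⟩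
    rintro x (rfl | rfl)
    · exact Or.inl ⟨ha, rfl⟩
    · rcases hb with hb | hb
      · left; refine ⟨hb, (h a x ?_ ?_ he.1 ha hb).symm⟩
        · rintro rfl; exact hv ha
        · rintro rfl; exact hv hb
      · right; exact hb
  · have hbX : b ∈ X := by
      rcases hb with hb | hb
      · exact hb
      · exact absurd ((hDv _ ha).trans (hDv _ hb).symm) hab
    refine ⟨f b, ⟨b, hbX, rfl⟩, he.1, ?_⟩
    rintro x (rfl | rfl)
    · exact Or.inr ha
    · exact Or.inl ⟨hbX, rfl⟩

theorem er_loop {E : Finset (Sym2 V)} (hE : Er s E) : ∀ e ∈ E, ¬ e.IsDiag := by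
  induction hE with
  | nil => simp
  | step E A B u x y hE hP hx hy hc ih =>
    intro e he
    rcases Finset.mem_insert.mp he with rfl | h
    · simp only [Sym2.mk_isDiag_iff]
      rintro rfl; exact hP.disj _ hx hy
    · exact ih e h

theorem sum_min_two_s4 (I : Finset ℕ) (k : ℕ → ℕ) : min (∑ c ∈ I, k c) 2 ≤ ∑ c ∈ I, min (k c) 2 := by
  induction I using Finset.induction_on with
  | empty => simp
  | insert a I ha ih => rw [Finset.sum_insert ha, Finset.sum_insert ha]; omega

theorem sum_four (hs : 2 < s) (I : Finset ℕ) (k : ℕ → ℕ) (h1 : ∑ c ∈ I, k c = s + 1)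
    (h2 : ∀ c ∈ I, k c ≤ s - 1) : 4 ≤ ∑ c ∈ I, min (k c) 2 := by
  by_cases h : ∀ c ∈ I, k c ≤ 2
  · have : ∑ c ∈ I, min (k c) 2 = ∑ c ∈ I, k c :=
      Finset.sum_congr rfl (fun c hc => by have := h c hc; omega)
    omega
  · push Not at h
    obtain ⟨c, hc, hk⟩ := h
    rw [← Finset.add_sum_erase I _ hc] at h1 ⊢
    have := sum_min_two_s4 (I.erase c) k
    have := h2 c hc
    omega

theorem er_D_aux (hs : 2 < s) {E : Finset (Sym2 V)} (hE : Er s E) {A B : Finset V} {u v : V}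
    (hP : BPart s A B u) (hc : ∀ a ∈ A, ∀ b ∈ B, s(a, b) ∉ E) (f : V → ℕ)
    (hf : ∀ x y, x ≠ v → y ≠ v → s(x, y) ∈ E → f x = f y)
    (hsz : ∀ c, ((Finset.univ.erase v).filter (fun x => f x = c)).card ≤ s - 1)
    (hv : v ∈ A) : E.card + ((Finset.univ.erase v).image f).card + 3 ≤ 4 * s := by
  have sp := er_sparse hE
  have hl := er_loop hE
  have huv : u ≠ v := by rintro rfl; exact hP.uA hv
  have hvB : v ∉ B := fun h => hP.disj v hv h
  have n := part_card hP
  have k0 := cnt_part hP hc Finset.univ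
  rw [cnt_univ] at k0
  set X := (Finset.univ \ B).erase v with hX
  set Y := Finset.univ \ A with hY
  have cX : X.card + 1 = s + 1 := by
    rw [hX, Finset.card_erase_of_mem (by simp [hvB]), Finset.card_univ_sdiff, hP.cB]; omega
  have cY : Y.card = s + 1 := by
    rw [hY, Finset.card_univ_sdiff, hP.cA]; omega
  have hXv : X ∪ {v} = Finset.univ \ B := by
    rw [hX]; ext x
    simp only [Finset.mem_union, Finset.mem_erase, Finset.mem_singleton, Finset.mem_sdiff]
    by_cases h : x = v
    · subst h; simp [hvB]
    · simp [h]
  have b1 : cnt E (Finset.univ \ B) + (X.image f).card ≤ 2 * s := by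
    have := cnt_color f X v (by simp [hX]) {v} (by simp) hl
      (fun a b h1 h2 h3 _ _ => hf a b h1 h2 h3)
    rw [hXv] at this
    have h2 : ∑ c ∈ X.image f, (cnt E (X.filter (fun x => f x = c) ∪ {v}) + 1) ≤
        ∑ c ∈ X.image f, 2 * (X.filter (fun x => f x = c)).card := by
      apply Finset.sum_le_sum
      intro c hc
      have h3 := sp (X.filter (fun x => f x = c) ∪ {v})
      have h4 := Finset.card_union_le (X.filter (fun x => f x = c)) {v}
      rw [Finset.card_singleton] at h4
      have h5 : 1 ≤ (X.filter (fun x => f x = c)).card := by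
        obtain ⟨x, hx, hxc⟩ := Finset.mem_image.mp hc
        exact Finset.card_pos.mpr ⟨x, by simp [hx, hxc]⟩
      omega
    rw [Finset.sum_add_distrib, ← Finset.mul_sum,
      ← Finset.card_eq_sum_card_image] at h2
    simp only [Finset.sum_const, smul_eq_mul, mul_one] at h2
    omega
  have b2 : cnt E Y + (Y.image f).card + 4 ≤ 2 * (s + 1) := by
    have := cnt_color f Y v (by simp [hY, hv]) ∅ (by simp) hl
      (fun a b h1 h2 h3 _ _ => hf a b h1 h2 h3)
    simp only [Finset.union_empty] at this
    have hsum : ∑ c ∈ Y.image f, (Y.filter (fun x => f x = c)).card = s + 1 := by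
      rw [← Finset.card_eq_sum_card_image, cY]
    have h4 := sum_four hs (Y.image f) (fun c => (Y.filter (fun x => f x = c)).card) hsum (by
      intro c _
      refine le_trans (Finset.card_le_card ?_) (hsz c)
      apply Finset.filter_subset_filter
      intro x hx
      simp only [hY, Finset.mem_sdiff, Finset.mem_univ, true_and] at hx
      simp only [Finset.mem_erase, Finset.mem_univ, and_true]
      rintro rfl; exact hx hv)
    have h2 : ∑ c ∈ Y.image f, (cnt E (Y.filter (fun x => f x = c)) + 1 +
          min (Y.filter (fun x => f x = c)).card 2) ≤
        ∑ c ∈ Y.image f, 2 * (Y.filter (fun x => f x = c)).card := by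
      apply Finset.sum_le_sum
      intro c hc
      have h3 := sp (Y.filter (fun x => f x = c))
      have h5 : 1 ≤ (Y.filter (fun x => f x = c)).card := by
        obtain ⟨x, hx, hxc⟩ := Finset.mem_image.mp hc
        exact Finset.card_pos.mpr ⟨x, by simp [hx, hxc]⟩
      omega
    rw [Finset.sum_add_distrib, Finset.sum_add_distrib, ← Finset.mul_sum, hsum] at h2
    simp only [Finset.sum_const, smul_eq_mul, mul_one] at h2
    omega
  have b3 : ((Finset.univ.erase v).image f).card + 1 ≤ (X.image f).card + (Y.image f).card := by
    rw [← Finset.card_union_add_card_inter]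
    have i1 : (Finset.univ.erase v).image f ⊆ X.image f ∪ Y.image f := by
      rw [← Finset.image_union]
      apply Finset.image_subset_image
      intro x hx
      have := hP.disj x
      simp only [hX, hY, Finset.mem_erase, Finset.mem_union, Finset.mem_sdiff, Finset.mem_univ,
        true_and, and_true] at hx ⊢
      tauto
    have i2 : 1 ≤ (X.image f ∩ Y.image f).card := by
      apply Finset.card_pos.mpr
      refine ⟨f u, Finset.mem_inter.mpr ⟨Finset.mem_image_of_mem _ ?_, Finset.mem_image_of_mem _ ?_⟩⟩
      · simp [hX, huv, hP.uB]
      · simp [hY, hP.uA]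
    have := Finset.card_le_card i1
    omega
  omega

theorem er_D (hs : 2 < s) (hn : Fintype.card V = 2 * s + 1) {E : Finset (Sym2 V)} (hE : Er s E) :
    ∀ (f : V → ℕ) (v : V),
    (∀ x y, x ≠ v → y ≠ v → s(x, y) ∈ E → f x = f y) →
    (∀ c, ((Finset.univ.erase v).filter (fun x => f x = c)).card ≤ s - 1) →
    E.card + ((Finset.univ.erase v).image f).card + 2 ≤ 4 * s := by
  induction hE with
  | nil =>
    intro f v _ _
    have := Finset.card_image_le (s := Finset.univ.erase v) (f := f)
    rw [Finset.card_erase_of_mem (Finset.mem_univ _), Finset.card_univ, hn] at this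
    simp
    omega
  | step E A B u x y hE hP hx hy hc ih =>
    intro f v hf hsz
    have hf' : ∀ x y, x ≠ v → y ≠ v → s(x, y) ∈ E → f x = f y := fun a b h1 h2 h3 =>
      hf a b h1 h2 (Finset.mem_insert_of_mem h3)
    have hci := Finset.card_insert_le s(x, y) E
    have hcs : ∀ a ∈ B, ∀ b ∈ A, s(a, b) ∉ E := fun a ha b hb => by
      rw [Sym2.eq_swap]; exact hc b hb a ha
    rcases hP.cover v with h | h | h
    · have := er_D_aux hs hE hP hc f hf' hsz h
      omega
    · have := er_D_aux hs hE hP.symm hcs f hf' hsz h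
      omega
    · subst h
      have hxv : x ≠ v := by rintro rfl; exact hP.uA hx
      have hyv : y ≠ v := by rintro rfl; exact hP.uB hy
      set f' : V → ℕ := fun x => 2 * f x + if x ∈ A then 1 else 0 with hf'd
      have hdiv : ∀ z, f' z / 2 = f z := by
        intro z; simp only [hf'd]; split_ifs <;> omega
      have h1 := ih f' v (by
        intro a b ha hb hab
        have e1 := hf' a b ha hb hab
        have q1 := hP.cover a
        have q2 := hP.cover b
        have q3 := fun h => hc a h b
        have q4 := fun h => hcs a h b
        have : a ∈ A ↔ b ∈ A := by
          have := hP.disj a; have := hP.disj b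
          tauto
        simp only [hf'd, e1, this]) (by
        intro c
        refine le_trans (Finset.card_le_card ?_) (hsz (c / 2))
        intro z hz
        simp only [Finset.mem_filter] at hz ⊢
        exact ⟨hz.1, by rw [← hdiv, hz.2]⟩)
      have h2 : (Finset.univ.erase v).image f = ((Finset.univ.erase v).image f').image (· / 2) := by
        rw [Finset.image_image]
        apply Finset.image_congr
        intro z _
        simp [hdiv]
      have h3 : ((Finset.univ.erase v).image f).card < ((Finset.univ.erase v).image f').card := by
        rw [h2]
        refine lt_of_le_of_ne Finset.card_image_le ?_
        intro heq
        have inj := Finset.card_image_iff.mp heq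
        have := @inj (f' x) (by
          simpa using ⟨x, hxv, rfl⟩) (f' y) (by
          simpa using ⟨y, hyv, rfl⟩) (by
          simp only [hdiv]
          exact hf x y hxv hyv (Finset.mem_insert_self _ _))
        have hyA : y ∉ A := fun h => hP.disj y h hy
        simp only [hf'd, hx, hyA, if_true, if_false] at this
        omega
      omega

theorem side_iff {A B : Finset V} {v p q : V} (hP : BPart s A B v) (hp : p ≠ v) (hq : q ≠ v)
    (h1 : p ∈ A → q ∈ B → False) (h2 : q ∈ A → p ∈ B → False) : p ∈ A ↔ q ∈ A := by
  have := hP.cover p; have := hP.cover q; have := hP.disj p; have := hP.disj q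
  tauto

set_option maxHeartbeats 2000000 in
theorem er_same (hs : 2 < s) {E : Finset (Sym2 V)} (hE : Er s E) {A B A' B' : Finset V} {v x y : V}
    (hP : BPart s A B v) (hP' : BPart s A' B' v)
    (hc : ∀ a ∈ A, ∀ b ∈ B, s(a, b) ∉ insert s(x, y) E) (hc' : ∀ a ∈ A', ∀ b ∈ B', s(a, b) ∉ E)
    (hx : x ∈ A') (hy : y ∈ B') : E.card + 6 ≤ 4 * s := by
  have hcE : ∀ a b, s(a, b) ∈ E → a ∈ A → b ∈ B → False := fun a b h ha hb =>
    hc a ha b hb (Finset.mem_insert_of_mem h)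
  have hcE2 : ∀ a b, s(a, b) ∈ E → b ∈ A → a ∈ B → False := fun a b h ha hb =>
    hcE b a (by rwa [Sym2.eq_swap]) ha hb
  have hcE' : ∀ a b, s(a, b) ∈ E → a ∈ A' → b ∈ B' → False := fun a b h ha hb => hc' a ha b hb h
  have hcE2' : ∀ a b, s(a, b) ∈ E → b ∈ A' → a ∈ B' → False := fun a b h ha hb =>
    hcE' b a (by rwa [Sym2.eq_swap]) ha hb
  have hxy1 : ¬ (x ∈ A ∧ y ∈ B) := fun h => hc x h.1 y h.2 (Finset.mem_insert_self _ _)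
  have hxy2 : ¬ (y ∈ A ∧ x ∈ B) := fun h => hc y h.1 x h.2 (by rw [Sym2.eq_swap]; exact Finset.mem_insert_self _ _)
  have hxv : x ≠ v := by rintro rfl; exact hP'.uA hx
  have hyv : y ≠ v := by rintro rfl; exact hP'.uB hy
  obtain ⟨a, b, d, e1, e2, e3, e4, e5, e6, e7, e8⟩ := part_num hP A'
  obtain ⟨a', b', d', e1', e2', e3', e4', e5', e6', e7', e8'⟩ := part_num hP B'
  obtain ⟨a2, b2, d2, i1, i2, i3, i4, i5, i6, i7, i8⟩ := part_num hP' A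
  have j1 := e8 hP'.uA
  have j2 := e8' hP'.uB
  have j3 := i8 hP.uA
  have j4 := hP.cA
  have j5 := hP'.cA
  have j6 := hP'.cB
  rw [Finset.inter_comm] at i1 i2
  have n1 : 1 ≤ a + b' := by
    by_contra hcon
    have z1 : (A' ∩ A) = ∅ := Finset.card_eq_zero.mp (by omega)
    have z2 : (B' ∩ B) = ∅ := Finset.card_eq_zero.mp (by omega)
    have z3 : x ∉ A := fun h => by
      have : x ∈ A' ∩ A := Finset.mem_inter.mpr ⟨hx, h⟩
      simp [z1] at this
    have z4 : y ∉ B := fun h => by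
      have : y ∈ B' ∩ B := Finset.mem_inter.mpr ⟨hy, h⟩
      simp [z2] at this
    have := hP.cover x; have := hP.cover y
    grind
  have n2 : 1 ≤ b + a' := by
    by_contra hcon
    have z1 : (A' ∩ B) = ∅ := Finset.card_eq_zero.mp (by omega)
    have z2 : (B' ∩ A) = ∅ := Finset.card_eq_zero.mp (by omega)
    have z3 : x ∉ B := fun h => by
      have : x ∈ A' ∩ B := Finset.mem_inter.mpr ⟨hx, h⟩
      simp [z1] at this
    have z4 : y ∉ A := fun h => by
      have : y ∈ B' ∩ A := Finset.mem_inter.mpr ⟨hy, h⟩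
      simp [z2] at this
    have := hP.cover x; have := hP.cover y
    grind
  have m1 : 1 ≤ a ∧ 1 ≤ b ∧ 1 ≤ a' ∧ 1 ≤ b' := by omega
  obtain ⟨m1, m2, m3, m4⟩ := m1
  set f : V → ℕ := fun z => (if z ∈ A then 1 else 0) + (if z ∈ A' then 2 else 0) with hfd
  have disj := hP.disj
  have disj' := hP'.disj
  have cov := hP.cover
  have cov' := hP'.cover
  have h1 := er_D hs (part_card hP) hE f v (by
    intro p q hp hq hpq
    have t1 : p ∈ A ↔ q ∈ A := side_iff hP hp hq (hcE p q hpq) (hcE2 p q hpq)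
    have t2 : p ∈ A' ↔ q ∈ A' := side_iff hP' hp hq (hcE' p q hpq) (hcE2' p q hpq)
    simp only [hfd, t1, t2]) (by
    intro c
    have hle : ∀ Z : Finset V, Z.card ≤ s - 1 →
      (∀ z, z ≠ v → f z = c → z ∈ Z) →
      ((Finset.univ.erase v).filter (fun x => f x = c)).card ≤ s - 1 := by
      intro Z hZ h
      refine le_trans (Finset.card_le_card ?_) hZ
      intro z hz
      simp at hz
      exact h z hz.1 hz.2
    by_cases c1 : c = 3
    · apply hle (A' ∩ A) (by omega)
      intro z hz hzc
      simp only [hfd] at hzc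
      rw [Finset.mem_inter]
      split_ifs at hzc <;> first | omega | grind
    by_cases c2 : c = 2
    · apply hle (A' ∩ B) (by omega)
      intro z hz hzc
      simp only [hfd] at hzc
      have := cov z
      rw [Finset.mem_inter]
      split_ifs at hzc <;> first | omega | grind
    by_cases c3 : c = 1
    · apply hle (B' ∩ A) (by omega)
      intro z hz hzc
      simp only [hfd] at hzc
      have := cov' z
      rw [Finset.mem_inter]
      split_ifs at hzc <;> first | omega | grind
    · apply hle (B' ∩ B) (by omega)
      intro z hz hzc
      simp only [hfd] at hzc
      have := cov z
      have := cov' z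
      rw [Finset.mem_inter]
      split_ifs at hzc <;> first | omega | grind)
  have h4 : 4 ≤ ((Finset.univ.erase v).image f).card := by
    have : ({0, 1, 2, 3} : Finset ℕ) ⊆ (Finset.univ.erase v).image f := by
      have hne : ∀ Z : Finset V, 1 ≤ Z.card → ∃ z, z ∈ Z := fun Z h => Finset.card_pos.mp h
      obtain ⟨z0, hz0⟩ := hne (B' ∩ B) (by omega)
      obtain ⟨z1, hz1⟩ := hne (B' ∩ A) (by omega)
      obtain ⟨z2, hz2⟩ := hne (A' ∩ B) (by omega)
      obtain ⟨z3, hz3⟩ := hne (A' ∩ A) (by omega)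
      rw [Finset.mem_inter] at hz0 hz1 hz2 hz3
      have uA := hP.uA
      have uB := hP.uB
      intro c hc
      simp only [Finset.mem_insert, Finset.mem_singleton] at hc
      rw [Finset.mem_image]
      rcases hc with rfl | rfl | rfl | rfl
      · refine ⟨z0, ?_, ?_⟩
        · simp only [Finset.mem_erase, Finset.mem_univ, and_true]; rintro rfl; grind
        · have := disj z0; have := disj' z0
          simp only [hfd]; rw [if_neg (by grind), if_neg (by grind)]
      · refine ⟨z1, ?_, ?_⟩
        · simp only [Finset.mem_erase, Finset.mem_univ, and_true]; rintro rfl; grind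
        · have := disj z1; have := disj' z1
          simp only [hfd]; rw [if_pos (by grind), if_neg (by grind)]
      · refine ⟨z2, ?_, ?_⟩
        · simp only [Finset.mem_erase, Finset.mem_univ, and_true]; rintro rfl; grind
        · have := disj z2; have := disj' z2
          simp only [hfd]; rw [if_neg (by grind), if_pos (by grind)]
      · refine ⟨z3, ?_, ?_⟩
        · simp only [Finset.mem_erase, Finset.mem_univ, and_true]; rintro rfl; grind
        · simp only [hfd]; rw [if_pos (by grind), if_pos (by grind)]
    have := Finset.card_le_card this
    simpa using this
  omega

theorem er_upper (hs : 2 < s) {E : Finset (Sym2 V)} (hE : Er s E) : E.card ≤ 4 * s - 4 := by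
  cases hE with
  | nil => simp
  | step H A B v x y hH hP hx hy hc =>
    have h0 := Finset.card_insert_le s(x, y) H
    suffices H.card + 5 ≤ 4 * s by omega
    cases hH with
    | nil => simp; omega
    | step H' A' B' u x' y' hH' hP' hx' hy' hc' =>
      have h1 := Finset.card_insert_le s(x', y') H'
      suffices H'.card + 6 ≤ 4 * s by omega
      by_cases huv : u = v
      · subst huv
        exact er_same hs hH' hP hP' hc hc' hx' hy'
      · exact er_main_ne hs hH' hP hP' (fun a ha b hb h => hc a ha b hb (Finset.mem_insert_of_mem h)) hc' huv


theorem er_grow {E : Finset (Sym2 V)} (hn : Fintype.card V = 2 * s + 1) (hE : Er s E) (X Y : Finset V)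
    (hXY : Disjoint X Y)
    (hEX : ∀ a b, s(a, b) ∈ E → (a ∈ X ∧ b ∈ X) ∨ (a ∈ Y ∧ b ∈ Y))
    (hX : X.card ≤ s) (hY : Y.card + 1 ≤ s) (x p : V) (hx : x ∉ X) (hxY : x ∉ Y) (hp : p ∈ X) :
    Er s (insert s(x, p) E) ∧ s(x, p) ∉ E ∧ ∀ q ∈ X, q ≠ p →
      Er s (insert s(x, q) (insert s(x, p) E)) ∧ s(x, q) ∉ insert s(x, p) E := by
  have hxp : s(x, p) ∉ E := by
    intro h
    rcases hEX _ _ h with h | h <;> tauto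
  have h1 : insert x Y ⊆ Finset.univ \ X := by
    intro z hz
    simp only [Finset.mem_insert] at hz
    simp only [Finset.mem_sdiff, Finset.mem_univ, true_and]
    rcases hz with rfl | hz
    · exact hx
    · exact Finset.disjoint_right.mp hXY hz
  obtain ⟨A, hA1, hA2, hA3⟩ := Finset.exists_subsuperset_card_eq h1
    (n := s) ((Finset.card_insert_le _ _).trans hY) (by rw [Finset.card_univ_sdiff]; omega)
  have hxA : x ∈ A := hA1 (Finset.mem_insert_self _ _)
  have hYA : ∀ z ∈ Y, z ∈ A := fun z hz => hA1 (Finset.mem_insert_of_mem hz)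
  have hXA : ∀ z ∈ X, z ∉ A := fun z hz h => by have := hA2 h; simp at this; exact this hz
  have hAc : (Finset.univ \ A).card = s + 1 := by rw [Finset.card_univ_sdiff]; omega
  have mk : ∀ u, u ∉ A → BPart s A ((Finset.univ \ A).erase u) u := by
    intro u hu
    refine ⟨?_, hu, by simp, ?_, hA3, ?_⟩
    · intro z h1 h2; simp at h2; exact h2.2 h1
    · intro z; simp; tauto
    · rw [Finset.card_erase_of_mem (by simpa using hu), hAc]; omega
  have nocross : ∀ a ∈ A, ∀ b, b ∉ A → s(a, b) ∉ E := by
    intro a ha b hb h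
    rcases hEX _ _ h with h | h
    · exact hXA a h.1 ha
    · exact hb (hYA b h.2)
  obtain ⟨u, hu, huX⟩ : ∃ u ∈ Finset.univ \ A, u ∉ X := by
    by_contra hcon
    push Not at hcon
    have := Finset.card_le_card (s := Finset.univ \ A) (t := X) hcon
    omega
  have hu' : u ∉ A := by simpa using hu
  have s1 : Er s (insert s(x, p) E) := by
    refine Er.step E A _ u x p hE (mk u hu') hxA ?_ ?_
    · simp only [Finset.mem_erase, Finset.mem_sdiff, Finset.mem_univ, true_and]
      exact ⟨by rintro rfl; exact huX hp, hXA p hp⟩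
    · intro a ha b hb
      simp at hb
      exact nocross a ha b hb.2
  refine ⟨s1, hxp, ?_⟩
  intro q hq hqp
  have nc : ∀ a ∈ A, ∀ b, b ∉ A → b ≠ p → s(a, b) ∉ insert s(x, p) E := by
    intro a ha b hb hbp h
    rcases Finset.mem_insert.mp h with h | h
    · rw [Sym2.eq_iff] at h
      rcases h with h | h
      · exact hbp h.2
      · exact hb (h.2 ▸ hxA)
    · exact nocross a ha b hb h
  refine ⟨Er.step _ A _ p x q s1 (mk p (hXA p hp)) hxA ?_ ?_, nc x hxA q (hXA q hq) hqp⟩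
  · simp only [Finset.mem_erase, Finset.mem_sdiff, Finset.mem_univ, true_and]
    exact ⟨hqp, hXA q hq⟩
  · intro a ha b hb
    simp at hb
    exact nc a ha b hb.2 hb.1

theorem er_book {E : Finset (Sym2 V)} (hn : Fintype.card V = 2 * s + 1) (hE : Er s E) (Y : Finset V)
    (hEY : ∀ a b, s(a, b) ∈ E → (a ∈ Y ∧ b ∈ Y)) (hY : Y.card + 1 ≤ s) (p q : V) (hpq : p ≠ q)
    (hp : p ∉ Y) (hq : q ∉ Y) (T : Finset V) :
    p ∉ T → q ∉ T → Disjoint T Y → T.card + 1 ≤ s →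
    ∃ F, Er s F ∧ F.card = E.card + 1 + 2 * T.card ∧
      ∀ a b, s(a, b) ∈ F → (a ∈ insert p (insert q T) ∧ b ∈ insert p (insert q T)) ∨ (a ∈ Y ∧ b ∈ Y) := by
  induction T using Finset.induction_on with
  | empty =>
    intro _ _ _ h
    have := er_grow hn hE {p} Y (by simpa using hp) (fun a b h => Or.inr (hEY a b h))
      (by simpa using h) hY q p (by simpa using hpq.symm) hq (by simp)
    refine ⟨_, this.1, by rw [Finset.card_insert_of_notMem this.2.1]; simp, ?_⟩
    intro a b hab
    rcases Finset.mem_insert.mp hab with h | h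
    · left
      rw [Sym2.eq_iff] at h
      simp; tauto
    · exact Or.inr (hEY a b h)
  | insert x T hxT ih =>
    intro h1 h2 h3 h4
    rw [Finset.card_insert_of_notMem hxT] at h4 ⊢
    simp only [Finset.mem_insert, not_or] at h1 h2
    rw [Finset.disjoint_insert_left] at h3
    obtain ⟨F, f1, f2, f3⟩ := ih h1.2 h2.2 h3.2 (by omega)
    have hc : (insert p (insert q T)).card ≤ T.card + 2 :=
      (Finset.card_insert_le _ _).trans (by have := Finset.card_insert_le q T; omega)
    have g := er_grow hn f1 (insert p (insert q T)) Y (by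
      simp [Finset.disjoint_insert_left, hp, hq, h3.2]) f3 (by omega) hY x p
      (by simp only [Finset.mem_insert, not_or]; exact ⟨fun h => h1.1 h.symm, fun h => h2.1 h.symm, hxT⟩)
      h3.1 (by simp)
    have g2 := g.2.2 q (by simp) hpq.symm
    refine ⟨_, g2.1, ?_, ?_⟩
    · rw [Finset.card_insert_of_notMem g2.2, Finset.card_insert_of_notMem g.2.1]; omega
    · intro a b hab
      rw [Finset.mem_insert, Finset.mem_insert, Sym2.eq_iff, Sym2.eq_iff] at hab
      rcases hab with h | h | h
      · left; simp; tauto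
      · left; simp; tauto
      · rcases f3 a b h with h | h
        · left
          have : insert p (insert q T) ⊆ insert p (insert q (insert x T)) := by
            intro z; simp; tauto
          exact ⟨this h.1, this h.2⟩
        · exact Or.inr h

end EraHelp

theorem er_lower (s : ℕ) (hs : 2 < s) :
    ∃ E : Finset (Sym2 (Fin (2 * s + 1))), Er s E ∧ E.card = 4 * s - 4 := by
  have hn : Fintype.card (Fin (2 * s + 1)) = 2 * s + 1 := by simp
  obtain ⟨W, -, hW⟩ := Finset.exists_subset_card_eq (s := (Finset.univ : Finset (Fin (2 * s + 1))))
    (n := s + 1) (by simp; omega)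
  have hWc : (Finset.univ \ W).card = s := by rw [Finset.card_univ_sdiff, hn]; omega
  obtain ⟨Y, hYs, hYc⟩ := Finset.exists_subset_card_eq (s := Finset.univ \ W) (n := s - 1) (by omega)
  have book : ∀ X : Finset (Fin (2 * s + 1)), 2 ≤ X.card → ∃ p q T, p ≠ q ∧ p ∉ T ∧ q ∉ T ∧
      X = insert p (insert q T) ∧ T.card + 2 = X.card := by
    intro X hX
    obtain ⟨p, hp, q, hq, hpq⟩ := Finset.one_lt_card.mp (show 1 < X.card by omega)
    refine ⟨p, q, (X.erase p).erase q, hpq, by simp, by simp, ?_, ?_⟩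
    · ext z; simp only [Finset.mem_insert, Finset.mem_erase]
      by_cases h1 : z = p
      · subst h1; simp [hp]
      · by_cases h2 : z = q
        · subst h2; simp [hq]
        · simp [h1, h2]
    · rw [Finset.card_erase_of_mem (by simp [hq, hpq.symm]), Finset.card_erase_of_mem hp]; omega
  obtain ⟨p, q, T, b1, b2, b3, b4, b5⟩ := book Y (by omega)
  obtain ⟨F, f1, f2, f3⟩ := er_book hn (Er.nil (s := s)) ∅ (by simp) (by simp; omega) p q b1 (by simp)
    (by simp) T b2 b3 (by simp) (by omega)
  rw [← b4] at f3
  obtain ⟨p', q', T', b1', b2', b3', b4', b5'⟩ := book W (by omega)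
  have hWY : ∀ z ∈ W, z ∉ Y := fun z hz h => by have := hYs h; simp at this; exact this hz
  obtain ⟨F', f1', f2', f3'⟩ := er_book hn f1 Y (by
      intro a b h; have := f3 a b h; simpa using this) (by omega) p' q' b1' (hWY _ (by rw [b4']; simp))
      (hWY _ (by rw [b4']; simp)) T' b2' b3' (by
      rw [Finset.disjoint_left]; intro z hz; exact hWY z (by rw [b4']; simp [hz])) (by omega)
  rw [← b4'] at f3'
  have hp' : p' ∈ W := by rw [b4']; simp
  have hq' : q' ∈ W := by rw [b4']; simp
  obtain ⟨z, hz⟩ := Finset.card_pos.mp (show 0 < (Finset.univ \ W).card by omega)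
  have mk : ∀ u ∈ W, BPart s (W.erase u) (Finset.univ \ W) u := by
    intro u hu
    refine ⟨?_, by simp, by simp [hu], ?_, ?_, hWc⟩
    · intro t h1 h2; simp at h1 h2; exact h2 h1.2
    · intro t; simp; tauto
    · rw [Finset.card_erase_of_mem hu, hW]; omega
  have nc : ∀ a ∈ W, ∀ b ∈ Finset.univ \ W, s(a, b) ∉ F' := by
    intro a ha b hb h
    simp at hb
    rcases f3' a b h with h | h
    · exact hb h.2
    · exact hWY a ha h.1
  have e1 := Er.step F' _ _ q' p' z f1' (mk q' hq') (by simp [hp', b1']) hz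
    (fun a ha => nc a (Finset.mem_of_mem_erase ha))
  have nc2 : ∀ a ∈ W.erase p', ∀ b ∈ Finset.univ \ W, s(a, b) ∉ insert s(p', z) F' := by
    intro a ha b hb h
    simp at ha
    rcases Finset.mem_insert.mp h with h | h
    · rw [Sym2.eq_iff] at h
      rcases h with h | h
      · exact ha.1 h.1
      · simp at hb; exact hb (h.2 ▸ hp')
    · exact nc a ha.2 b hb h
  have e2 := Er.step _ _ _ p' q' z e1 (mk p' hp') (by simp [hq', b1'.symm]) hz nc2
  refine ⟨_, e2, ?_⟩
  rw [Finset.card_insert_of_notMem (nc2 q' (by simp [hq', b1'.symm]) z hz),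
    Finset.card_insert_of_notMem (nc p' hp' z hz)]
  simp at f2
  omega

theorem erasable_of_er {s : ℕ} {V : Type} [Fintype V] [DecidableEq V] {E : Finset (Sym2 V)}
    (hE : Er s E) : ∃ G : SimpleGraph V, Erasable s s G ∧ G.edgeSet = E := by
  induction hE with
  | nil => exact ⟨⊥, ⟨0, fun _ => ⊥, rfl, rfl, by simp⟩, by simp⟩
  | step E A B u x y hE hP hx hy hc ih =>
    obtain ⟨G, ⟨m, c, c0, cm, hcs⟩, hG⟩ := ih
    have hl := er_loop (Er.step E A B u x y hE hP hx hy hc)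
    have hedge : (SimpleGraph.fromEdgeSet (↑(insert s(x, y) E) : Set (Sym2 V))).edgeSet
        = ↑(insert s(x, y) E) := by
      rw [SimpleGraph.edgeSet_fromEdgeSet]
      ext e
      simp only [Set.mem_sdiff]
      constructor
      · exact fun h => h.1
      · exact fun h => ⟨h, fun h2 => hl e h h2⟩
    refine ⟨SimpleGraph.fromEdgeSet ↑(insert s(x, y) E), ⟨m + 1, fun i => Nat.casesOn i
      (SimpleGraph.fromEdgeSet ↑(insert s(x, y) E)) c, rfl, cm, ?_⟩, hedge⟩
    intro i hi
    cases i with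
    | succ i => exact hcs i (by omega)
    | zero =>
      change EraseStep s s (SimpleGraph.fromEdgeSet ↑(insert s(x, y) E)) (c 0)
      rw [c0]
      refine ⟨s(x, y), by rw [hedge]; simp, ?_, ↑A, ↑B, u, ?_, ?_, ?_, ?_, ?_, ?_, ?_, ?_⟩
      · rw [hedge, hG]
        ext e
        simp only [Finset.coe_insert, Set.mem_sdiff, Set.mem_insert_iff, Set.mem_singleton_iff,
          Finset.mem_coe]
        have : e = s(x, y) → e ∉ E := by rintro rfl; exact hc x hx y hy
        tauto
      · rw [Finset.disjoint_coe, Finset.disjoint_left]; exact fun z => hP.disj z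
      · simpa using hP.uA
      · simpa using hP.uB
      · ext z; have := hP.cover z; simp; tauto
      · rw [Set.ncard_coe_finset, hP.cA]
      · rw [Set.ncard_coe_finset, hP.cB]
      · exact ⟨x, by simpa using hx, y, by simpa using hy, rfl⟩
      · intro a ha b hb hab
        rw [← SimpleGraph.mem_edgeSet, hedge] at hab
        simp only [Finset.coe_insert, Set.mem_insert_iff, Finset.mem_coe] at hab ha hb
        rcases hab with h | h
        · exact h
        · exact absurd h (hc a ha b hb)

theorem er_of_chain {s : ℕ} {V : Type} [Fintype V] [DecidableEq V] (m : ℕ) :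
    ∀ (c : ℕ → SimpleGraph V), c m = ⊥ → (∀ i < m, EraseStep s s (c i) (c (i + 1))) →
    ∃ E : Finset (Sym2 V), Er s E ∧ (c 0).edgeSet = E := by
  classical
  induction m with
  | zero => intro c h _; exact ⟨∅, Er.nil, by simp [h]⟩
  | succ m ih =>
    intro c h hst
    obtain ⟨E, hE, hcE⟩ := ih (fun i => c (i + 1)) h (fun i hi => hst (i + 1) (by omega))
    obtain ⟨e, he, hee, V1, V2, v, d1, d2, d3, d4, d5, d6, ⟨x, hx, y, hy, rfl⟩, d8⟩ := hst 0 (by omega)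
    simp only [zero_add] at hcE hee
    have hE2 : (c 0).edgeSet = ↑(insert s(x, y) E) := by
      rw [Finset.coe_insert, ← hcE, hee]
      ext e
      simp only [Set.mem_insert_iff, Set.mem_sdiff, Set.mem_singleton_iff]
      by_cases h : e = s(x, y)
      · subst h; simp [he]
      · simp [h]
    refine ⟨_, Er.step E V1.toFinset V2.toFinset v x y hE ⟨?_, ?_, ?_, ?_, ?_, ?_⟩ ?_ ?_ ?_, hE2⟩
    · intro z h1 h2
      simp at h1 h2
      exact Set.disjoint_left.mp d1 h1 h2
    · simpa using d2
    · simpa using d3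
    · intro z
      have : z ∈ V1 ∪ V2 ∪ {v} := by rw [d4]; trivial
      simp at this ⊢
      tauto
    · rw [← Set.ncard_eq_toFinset_card', d5]
    · rw [← Set.ncard_eq_toFinset_card', d6]
    · simpa using hx
    · simpa using hy
    · intro a ha b hb hab
      simp at ha hb
      have : s(a, b) ∈ (c 1).edgeSet := by rw [hcE]; exact hab
      rw [hee] at this
      exact this.2 (d8 a ha b hb this.1)

/-- For `s > 2`, the maximum number of edges of an erasable graph on `2s+1` vertices
(with parameters `s, s`) equals `4s−4`; in particular every such erasable graph has
at most `4s−4` edges. -/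
theorem max_erasable_edges (s : ℕ) (hs : 2 < s) :
    (∃ G : SimpleGraph (Fin (2 * s + 1)),
        Erasable s s G ∧ G.edgeSet.ncard = 4 * s - 4) ∧
    (∀ G : SimpleGraph (Fin (2 * s + 1)), Erasable s s G →
        G.edgeSet.ncard ≤ 4 * s - 4) := by
  constructor
  · obtain ⟨E, hE, hc⟩ := er_lower s hs
    obtain ⟨G, hG, hGE⟩ := erasable_of_er hE
    exact ⟨G, hG, by rw [hGE, Set.ncard_coe_finset, hc]⟩
  · rintro G ⟨m, c, c0, cm, hst⟩
    obtain ⟨E, hE, hcE⟩ := er_of_chain m c cm hst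
    rw [← c0, hcE, Set.ncard_coe_finset]
    exact er_upper hs hE
end

section
/- For integers t > s > 2 with gcd(s,t) = 1, wsat(s+t+1, K_{s,t}) = C(s+t+1, 2) − (2s + 2t − 2). -/
open SimpleGraph

set_option linter.unusedSectionVars false

section WSatAux

variable {V : Type} [Fintype V] [DecidableEq V]

/-- Delete the edge `xy`. -/
def delE (H : SimpleGraph V) (x y : V) : SimpleGraph V := H.deleteEdges {s(x, y)}

lemma delE_adj (H : SimpleGraph V) (x y a b : V) :
    (delE H x y).Adj a b ↔ H.Adj a b ∧ ¬ (a = x ∧ b = y) ∧ ¬ (a = y ∧ b = x) := by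
  simp [delE, SimpleGraph.deleteEdges_adj]

/-- In the complement graph `H`, the edge `xy` may be removed, using pivot `v` and side `A`. -/
structure StepAt (s : ℕ) (H : SimpleGraph V) (x y v : V) (A : Finset V) : Prop where
  card : A.card = s
  vA : v ∉ A
  xA : x ∈ A
  yA : y ∉ A
  yv : y ≠ v
  adj : H.Adj x y
  cross : ∀ a ∈ A, ∀ b, b ∉ A → b ≠ v → H.Adj a b → a = x ∧ b = y

/-- All edges of `H` can be removed one by one. -/
inductive Diss (s : ℕ) : SimpleGraph V → Prop
  | bot : Diss s ⊥
  | step {H : SimpleGraph V} {x y v : V} {A : Finset V} :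
      StepAt s H x y v A → Diss s (delE H x y) → Diss s H

open Classical in
/-- Twice the number of edges inside `S`. -/
noncomputable def e2 (H : SimpleGraph V) (S : Finset V) : ℕ :=
  ((S ×ˢ S).filter (fun p => H.Adj p.1 p.2)).card

lemma e2_one (H : SimpleGraph V) (S : Finset V) (h : S.card = 1) : e2 H S = 0 := by
  obtain ⟨a, rfl⟩ := Finset.card_eq_one.1 h
  simp [e2]

lemma e2_mono {H H' : SimpleGraph V} {S : Finset V}
    (h : ∀ a ∈ S, ∀ b ∈ S, H.Adj a b → H'.Adj a b) : e2 H S ≤ e2 H' S := by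
  classical
  unfold e2
  apply Finset.card_le_card
  intro p hp
  simp only [Finset.mem_filter, Finset.mem_product] at hp ⊢
  exact ⟨hp.1, h _ hp.1.1 _ hp.1.2 hp.2⟩

lemma e2_del {H : SimpleGraph V} {x y : V} {S : Finset V} (h : ¬ (x ∈ S ∧ y ∈ S)) :
    e2 H S = e2 (delE H x y) S := by
  apply le_antisymm
  · apply e2_mono
    intro a ha b hb hab
    rw [delE_adj]
    refine ⟨hab, ?_, ?_⟩
    · rintro ⟨rfl, rfl⟩; exact h ⟨ha, hb⟩
    · rintro ⟨rfl, rfl⟩; exact h ⟨hb, ha⟩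
  · apply e2_mono
    intro a ha b hb hab
    exact ((delE_adj _ _ _ _ _).1 hab).1

/-- Splitting of `S` along a step. -/
lemma e2_split {s : ℕ} {H : SimpleGraph V} {x y v : V} {A : Finset V}
    (st : StepAt s H x y v A) (S : Finset V) :
    e2 H S ≤ e2 (delE H x y) (S ∩ insert v A) + e2 (delE H x y) (S \ A)
      + (if x ∈ S ∧ y ∈ S then 2 else 0) := by
  classical
  have key : ((S ×ˢ S).filter (fun p => H.Adj p.1 p.2)) ⊆
      (((S ∩ insert v A) ×ˢ (S ∩ insert v A)).filter (fun p => (delE H x y).Adj p.1 p.2)) ∪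
      (((S \ A) ×ˢ (S \ A)).filter (fun p => (delE H x y).Adj p.1 p.2)) ∪
      (if x ∈ S ∧ y ∈ S then {(x, y), (y, x)} else ∅) := by
    rintro ⟨a, b⟩ hp
    simp only [Finset.mem_filter, Finset.mem_product] at hp
    obtain ⟨⟨ha, hb⟩, hab⟩ := hp
    simp only [Finset.mem_union, Finset.mem_filter, Finset.mem_product, Finset.mem_inter,
      Finset.mem_insert, Finset.mem_sdiff, delE_adj]
    by_cases e1 : a = x ∧ b = y
    · obtain ⟨rfl, rfl⟩ := e1
      right; simp [ha, hb]
    by_cases e2 : a = y ∧ b = x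
    · obtain ⟨rfl, rfl⟩ := e2
      right; simp [ha, hb]
    left
    have c1 := st.cross a
    have c2 := st.cross b
    have hba := hab.symm
    by_cases hA : a ∈ A <;> by_cases hB : b ∈ A
    · left; tauto
    · have : b = v := by
        by_contra hne
        exact e1 (c1 hA b hB hne hab)
      left; tauto
    · have : a = v := by
        by_contra hne
        exact e2 (c2 hB a hA hne hba).symm
      left; tauto
    · right; tauto
  unfold e2
  refine (Finset.card_le_card key).trans ?_
  refine (Finset.card_union_le _ _).trans ?_
  refine Nat.add_le_add (Finset.card_union_le _ _) ?_
  split_ifs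
  · exact Finset.card_le_two
  · simp

lemma split_card (S A : Finset V) (v : V) (hv : v ∉ A) :
    (S ∩ insert v A).card + (S \ A).card = S.card + if v ∈ S then 1 else 0 := by
  have h1 : (S ∩ A).card + (S \ A).card = S.card := Finset.card_inter_add_card_sdiff S A
  split_ifs with h
  · rw [Finset.inter_insert_of_mem h, Finset.card_insert_of_notMem (by simp [hv])]
    omega
  · rw [Finset.inter_insert_of_notMem h]; omega

lemma Diss.sparse {s : ℕ} {H : SimpleGraph V} (hd : Diss s H) :
    ∀ S : Finset V, 2 ≤ S.card → e2 H S + 6 ≤ 4 * S.card := by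
  induction hd with
  | bot =>
    intro S hS
    have : e2 (⊥ : SimpleGraph V) S = 0 := by simp [e2]
    omega
  | @step H x y v A st _ ih =>
    intro S hS
    by_cases h : x ∈ S ∧ y ∈ S
    · have h1 := e2_split st S
      have h2 := split_card S A v st.vA
      rw [if_pos h] at h1
      have hx1 : x ∈ S ∩ insert v A := by simp [h.1, st.xA]
      have hy1 : y ∈ S \ A := by simp [h.2, st.yA]
      have c1 := Finset.card_pos.2 ⟨x, hx1⟩
      have c2 := Finset.card_pos.2 ⟨y, hy1⟩
      have i1 := ih (S ∩ insert v A)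
      have i2 := ih (S \ A)
      have j1 := e2_one (delE H x y) (S ∩ insert v A)
      have j2 := e2_one (delE H x y) (S \ A)
      split_ifs at h2 with hv
      · have : 1 < (S ∩ insert v A).card :=
          Finset.one_lt_card.2 ⟨x, hx1, v, by simp [hv], fun e => st.vA (e ▸ st.xA)⟩
        have : 1 < (S \ A).card :=
          Finset.one_lt_card.2 ⟨y, hy1, v, by simp [hv, st.vA], st.yv⟩
        have := i1 (by omega)
        have := i2 (by omega)
        omega
      · by_cases k1 : (S ∩ insert v A).card = 1 <;> by_cases k2 : (S \ A).card = 1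
        · have := j1 k1; have := j2 k2; omega
        · have := j1 k1; have := i2 (by omega); omega
        · have := i1 (by omega); have := j2 k2; omega
        · have := i1 (by omega); have := i2 (by omega); omega
    · rw [e2_del h]; exact ih S hS

/-- `T` induces a tight subgraph. -/
def Tight (H : SimpleGraph V) (T : Finset V) : Prop := 2 ≤ T.card ∧ 4 * T.card ≤ e2 H T + 6

lemma Tight.unsplit {s : ℕ} {H : SimpleGraph V} {x y v : V} {A : Finset V}
    (st : StepAt s H x y v A) (hd : Diss s (delE H x y)) {T : Finset V} (hT : Tight H T)
    (h : ¬ (x ∈ T ∧ y ∈ T)) :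
    Tight (delE H x y) T ∧ ∀ a ∈ T, ∀ b ∈ T, a ≠ v → b ≠ v → a ∈ A → b ∈ A := by
  refine ⟨⟨hT.1, by rw [← e2_del h]; exact hT.2⟩, ?_⟩
  intro a ha b hb hav hbv haA
  by_contra hbA
  have h1 := e2_split st T
  have h2 := split_card T A v st.vA
  rw [if_neg h] at h1
  have hx1 : a ∈ T ∩ insert v A := by simp [ha, haA]
  have hy1 : b ∈ T \ A := by simp [hb, hbA]
  have c1 := Finset.card_pos.2 ⟨a, hx1⟩
  have c2 := Finset.card_pos.2 ⟨b, hy1⟩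
  have i1 := hd.sparse (T ∩ insert v A)
  have i2 := hd.sparse (T \ A)
  have j1 := e2_one (delE H x y) (T ∩ insert v A)
  have j2 := e2_one (delE H x y) (T \ A)
  have t1 := hT.1
  have t2 := hT.2
  split_ifs at h2 with hv
  · have : 1 < (T ∩ insert v A).card :=
      Finset.one_lt_card.2 ⟨a, hx1, v, by simp [hv], hav⟩
    have : 1 < (T \ A).card :=
      Finset.one_lt_card.2 ⟨b, hy1, v, by simp [hv, st.vA], hbv⟩
    have := i1 (by omega)
    have := i2 (by omega)
    omega
  · by_cases k1 : (T ∩ insert v A).card = 1 <;> by_cases k2 : (T \ A).card = 1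
    · have := j1 k1; have := j2 k2; omega
    · have := j1 k1; have := i2 (by omega); omega
    · have := i1 (by omega); have := j2 k2; omega
    · have := i1 (by omega); have := i2 (by omega); omega

lemma Tight.split {s : ℕ} {H : SimpleGraph V} {x y v : V} {A : Finset V}
    (st : StepAt s H x y v A) (hd : Diss s (delE H x y)) {T : Finset V} (hT : Tight H T)
    (hx : x ∈ T) (hy : y ∈ T) :
    (v ∈ T ∧ Tight (delE H x y) (T ∩ insert v A) ∧ Tight (delE H x y) (T \ A)) ∨
      (v ∉ T ∧ T.card = 2) := by
  have h1 := e2_split st T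
  have h2 := split_card T A v st.vA
  rw [if_pos ⟨hx, hy⟩] at h1
  have hx1 : x ∈ T ∩ insert v A := by simp [hx, st.xA]
  have hy1 : y ∈ T \ A := by simp [hy, st.yA]
  have c1 := Finset.card_pos.2 ⟨x, hx1⟩
  have c2 := Finset.card_pos.2 ⟨y, hy1⟩
  have i1 := hd.sparse (T ∩ insert v A)
  have i2 := hd.sparse (T \ A)
  have j1 := e2_one (delE H x y) (T ∩ insert v A)
  have j2 := e2_one (delE H x y) (T \ A)
  have t1 := hT.1
  have t2 := hT.2
  split_ifs at h2 with hv
  · left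
    have : 1 < (T ∩ insert v A).card :=
      Finset.one_lt_card.2 ⟨x, hx1, v, by simp [hv], fun e => st.vA (e ▸ st.xA)⟩
    have : 1 < (T \ A).card :=
      Finset.one_lt_card.2 ⟨y, hy1, v, by simp [hv, st.vA], st.yv⟩
    have := i1 (by omega)
    have := i2 (by omega)
    exact ⟨hv, ⟨by omega, by omega⟩, ⟨by omega, by omega⟩⟩
  · right
    refine ⟨hv, ?_⟩
    by_cases k1 : (T ∩ insert v A).card = 1 <;> by_cases k2 : (T \ A).card = 1
    · omega
    · have := j1 k1; have := i2 (by omega); omega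
    · have := i1 (by omega); have := j2 k2; omega
    · have := i1 (by omega); have := i2 (by omega); omega


lemma not_tight_bot (T : Finset V) : ¬ Tight (⊥ : SimpleGraph V) T := by
  rintro ⟨h1, h2⟩
  have : e2 (⊥ : SimpleGraph V) T = 0 := by simp [e2]
  omega

/-- Star-shaped configuration: all tight blocks share the vertex `c`. -/
structure InvStar (s : ℕ) (H : SimpleGraph V) (c : V) (p : V → Finset V) : Prop where
  self : ∀ u, u ≠ c → u ∈ p u
  cen : ∀ u, u ≠ c → c ∉ p u
  card : ∀ u, u ≠ c → (p u).card ≤ s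
  tight : ∀ u, u ≠ c → Tight H (insert c (p u))
  const : ∀ u, u ≠ c → ∀ w ∈ p u, p w = p u
  edge : ∀ a b, H.Adj a b → a ≠ c → b ≠ c → b ∈ p a

lemma InvStar.step {s t : ℕ} (hs : 2 ≤ s) (hst : s < t) (hV : Fintype.card V = s + t + 1)
    {H : SimpleGraph V} {x y v : V} {A : Finset V}
    (st : StepAt s H x y v A) (hd : Diss s (delE H x y)) {c : V} {p : V → Finset V}
    (I : InvStar s H c p) : ∃ p', InvStar s (delE H x y) c p' := by
  have hxy : x ≠ y := st.adj.ne
  have hxv : x ≠ v := fun e => st.vA (e ▸ st.xA)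
  obtain ⟨u0, hu0, hx, hy⟩ : ∃ u0, u0 ≠ c ∧ x ∈ insert c (p u0) ∧ y ∈ insert c (p u0) := by
    by_cases hxc : x = c
    · have hyc : y ≠ c := fun e => hxy (hxc.trans e.symm)
      exact ⟨y, hyc, by simp [hxc], by simp [I.self y hyc]⟩
    · refine ⟨x, hxc, by simp [I.self x hxc], ?_⟩
      by_cases hyc : y = c
      · simp [hyc]
      · simp [I.edge x y st.adj hxc hyc]
  have hX := I.card u0 hu0
  have hcX := I.cen u0 hu0
  have hXc := I.const u0 hu0
  have same : ∀ u, u ≠ c → u ∉ p u0 → ∀ w ∈ p u, w ∉ p u0 := by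
    intro u huc hu w hw hw'
    have e1 := I.const u huc w hw
    have e2 := hXc w hw'
    exact hu (by rw [← e2, e1]; exact I.self u huc)
  have ns : ∀ u, u ≠ c → u ∉ p u0 → ¬ (x ∈ insert c (p u) ∧ y ∈ insert c (p u)) := by
    rintro u huc hu ⟨h1, h2⟩
    have := same u huc hu
    simp only [Finset.mem_insert] at hx hy h1 h2
    by_cases hxc : x = c
    · have hyc : y ≠ c := fun e => hxy (hxc.trans e.symm)
      exact this y (h2.resolve_left hyc) (hy.resolve_left hyc)
    · exact this x (h1.resolve_left hxc) (hx.resolve_left hxc)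
  have un := fun u huc hu => Tight.unsplit st hd (I.tight u huc) (ns u huc hu)
  have fol : c ≠ v → ∀ u, u ≠ c → u ∉ p u0 → u ≠ v → (c ∈ A ↔ u ∈ A) := by
    intro hcv u huc hu huv
    have h := (un u huc hu).2
    have hm : u ∈ insert c (p u) := by simp [I.self u huc]
    exact ⟨h c (by simp) u hm hcv huv, h u hm c (by simp) huv hcv⟩
  rcases Tight.split st hd (I.tight u0 hu0) hx hy with ⟨hv, t1, t2⟩ | ⟨hv, h2⟩
  · by_cases hvc : v = c
    · subst hvc
      have hx' : x ∈ p u0 := by simpa [hxv] using hx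
      have hy' : y ∈ p u0 := by simpa [st.yv] using hy
      have r1 : insert v (p u0) ∩ insert v A = insert v (p u0 ∩ A) := by
        ext w; simp only [Finset.mem_inter, Finset.mem_insert]; tauto
      have r2 : insert v (p u0) \ A = insert v (p u0 \ A) := by
        ext w; simp only [Finset.mem_sdiff, Finset.mem_insert]
        have := st.vA
        constructor
        · tauto
        · rintro (rfl | h)
          · exact ⟨Or.inl rfl, this⟩
          · tauto
      rw [r1] at t1
      rw [r2] at t2
      refine ⟨fun u => if u ∈ p u0 then (if u ∈ A then p u0 ∩ A else p u0 \ A) else p u, ?_⟩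
      constructor
      · intro u hu
        split_ifs with a b
        · simp [a, b]
        · simp [a, b]
        · exact I.self u hu
      · intro u hu
        split_ifs with a b
        · simp [hcX]
        · simp [hcX]
        · exact I.cen u hu
      · intro u hu
        split_ifs with a b
        · exact (Finset.card_le_card Finset.inter_subset_left).trans hX
        · exact (Finset.card_le_card Finset.sdiff_subset).trans hX
        · exact I.card u hu
      · intro u hu
        split_ifs with a b
        · exact t1
        · exact t2
        · exact (un u hu a).1
      · intro u hu w hw
        by_cases a : u ∈ p u0
        · by_cases b : u ∈ A
          · simp only [a, b, if_true, Finset.mem_inter] at hw ⊢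
            simp [hw.1, hw.2]
          · simp only [a, b, if_true, if_false, Finset.mem_sdiff] at hw ⊢
            simp [hw.1, hw.2]
        · simp only [a, if_false] at hw ⊢
          have := same u hu a w hw
          simp only [this, if_false]
          exact I.const u hu w hw
      · intro a b hab ha hb
        rw [delE_adj] at hab
        have hbp := I.edge a b hab.1 ha hb
        have c1 := st.cross a
        have c2 := st.cross b
        have hba := hab.1.symm
        split_ifs with h1 h2
        · have hb0 : b ∈ p u0 := by rw [← hXc a h1]; exact hbp
          have : b ∈ A := by
            by_contra h3
            exact hab.2.1 (c1 h2 b h3 hb hab.1)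
          simp [hb0, this]
        · have hb0 : b ∈ p u0 := by rw [← hXc a h1]; exact hbp
          have : b ∉ A := by
            intro h3
            exact hab.2.2 (c2 h3 a h2 ha hba).symm
          simp [hb0, this]
        · exact hbp
    · exfalso
      have hvX : v ∈ p u0 := by simpa [hvc] using hv
      by_cases hcA : c ∈ A
      · have : (p u0)ᶜ ⊆ A := by
          intro u hu
          rw [Finset.mem_compl] at hu
          by_cases huc : u = c
          · rw [huc]; exact hcA
          · exact (fol (Ne.symm hvc) u huc hu (fun e => hu (e ▸ hvX))).1 hcA
        have := Finset.card_le_card this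
        rw [Finset.card_compl, st.card, hV] at this
        omega
      · have : A ⊆ (p u0).erase v := by
          intro u hu
          have huc : u ≠ c := fun e => hcA (e ▸ hu)
          have huv : u ≠ v := fun e => st.vA (e ▸ hu)
          rw [Finset.mem_erase]
          refine ⟨huv, ?_⟩
          by_contra h
          exact hcA ((fol (Ne.symm hvc) u huc h huv).2 hu)
        have := Finset.card_le_card this
        rw [Finset.card_erase_of_mem hvX, st.card] at this
        omega
  · exfalso
    rw [Finset.card_insert_of_notMem hcX] at h2
    have hcv : c ≠ v := by rintro rfl; exact hv (by simp)
    by_cases hcA : c ∈ A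
    · have : (insert v (p u0))ᶜ ⊆ A := by
        intro u hu
        simp only [Finset.mem_compl, Finset.mem_insert, not_or] at hu
        by_cases huc : u = c
        · rw [huc]; exact hcA
        · exact (fol hcv u huc hu.2 hu.1).1 hcA
      have h3 := Finset.card_le_card this
      have h4 := Finset.card_insert_le v (p u0)
      rw [Finset.card_compl, st.card, hV] at h3
      omega
    · have : A ⊆ p u0 := by
        intro u hu
        have huc : u ≠ c := fun e => hcA (e ▸ hu)
        have huv : u ≠ v := fun e => st.vA (e ▸ hu)
        by_contra h
        exact hcA ((fol hcv u huc h huv).2 hu)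
      have := Finset.card_le_card this
      rw [st.card] at this
      omega

lemma Diss.not_star {s t : ℕ} (hs : 2 ≤ s) (hst : s < t) (hV : Fintype.card V = s + t + 1)
    {H : SimpleGraph V} (hd : Diss s H) : ∀ c p, ¬ InvStar s H c p := by
  induction hd with
  | bot =>
    intro c p I
    obtain ⟨u, hu⟩ : ∃ u, u ≠ c := by
      apply Fintype.exists_ne_of_one_lt_card
      omega
    exact not_tight_bot _ (I.tight u hu)
  | step st hd ih =>
    intro c p I
    obtain ⟨pnew, Inew⟩ := I.step hs hst hV st hd
    exact ih c pnew Inew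

/-- Disconnected configuration: a tight set `C` and a star of tight blocks at `c`. -/
structure InvDis (s : ℕ) (H : SimpleGraph V) (C : Finset V) (c : V) (p : V → Finset V) :
    Prop where
  cC : c ∉ C
  cardC : C.card = s + 1
  tightC : Tight H C
  self : ∀ u, u ≠ c → u ∉ C → u ∈ p u
  cen : ∀ u, u ≠ c → u ∉ C → c ∉ p u
  disj : ∀ u, u ≠ c → u ∉ C → ∀ w ∈ p u, w ∉ C
  card : ∀ u, u ≠ c → u ∉ C → (p u).card = s
  tight : ∀ u, u ≠ c → u ∉ C → Tight H (insert c (p u))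
  const : ∀ u, u ≠ c → u ∉ C → ∀ w ∈ p u, p w = p u
  edge : ∀ a b, H.Adj a b → (a ∈ C ∧ b ∈ C) ∨
    ∃ u, u ≠ c ∧ u ∉ C ∧ a ∈ insert c (p u) ∧ b ∈ insert c (p u)

lemma InvDis.step {s t : ℕ} (hs : 2 ≤ s) (hst : s < t) (hV : Fintype.card V = s + t + 1)
    {H : SimpleGraph V} {x y v : V} {A : Finset V}
    (st : StepAt s H x y v A) (hd : Diss s (delE H x y)) {C : Finset V} {c : V}
    {p : V → Finset V} (I : InvDis s H C c p) : False := by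
  have hxy : x ≠ y := st.adj.ne
  have hxv : x ≠ v := fun e => st.vA (e ▸ st.xA)
  have hAc := st.card
  have small : ∀ B : Finset V, A ⊆ B → v ∈ B → y ∈ B → B.card ≤ s + 1 → False := by
    intro B hAB hvB hyB hB
    have h1 : A ⊆ (B.erase v).erase y := by
      intro u hu
      simp only [Finset.mem_erase]
      exact ⟨fun e => st.yA (e ▸ hu), fun e => st.vA (e ▸ hu), hAB hu⟩
    have h2 := Finset.card_le_card h1
    rw [Finset.card_erase_of_mem (by simp [hyB, st.yv]), Finset.card_erase_of_mem hvB] at h2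
    omega
  have big : ∀ B : Finset V, ∀ z, z ∉ B → z ∈ A → s ≤ B.card → ¬ B ⊆ A := by
    intro B z hz hzA hB hBA
    have h1 : insert z B ⊆ A := Finset.insert_subset hzA hBA
    have h2 := Finset.card_le_card h1
    rw [Finset.card_insert_of_notMem hz] at h2
    omega
  have fol : ∀ u, u ≠ c → u ∉ C → ¬ (x ∈ insert c (p u) ∧ y ∈ insert c (p u)) → 
      ∀ a ∈ insert c (p u), ∀ b ∈ insert c (p u), a ≠ v → b ≠ v → a ∈ A → b ∈ A :=
    fun u hu hu' h => (Tight.unsplit st hd (I.tight u hu hu') h).2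
  rcases I.edge x y st.adj with ⟨hx, hy⟩ | ⟨u0, hu0, hu0C, hx, hy⟩
  · rcases Tight.split st hd I.tightC hx hy with ⟨hv, -, -⟩ | ⟨-, h2⟩
    · have hcv : c ≠ v := fun e => I.cC (e ▸ hv)
      have fol' : ∀ u, u ≠ c → u ∉ C → (c ∈ A ↔ u ∈ A) := by
        intro u huc hu
        have huv : u ≠ v := fun e => hu (e ▸ hv)
        have h := fol u huc hu (by
          rintro ⟨h1, -⟩
          simp only [Finset.mem_insert] at h1
          rcases h1 with h1 | h1
          · exact I.cC (h1 ▸ hx)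
          · exact I.disj u huc hu x h1 hx)
        have hm : u ∈ insert c (p u) := by simp [I.self u huc hu]
        exact ⟨h c (by simp) u hm hcv huv, h u hm c (by simp) huv hcv⟩
      by_cases hcA : c ∈ A
      · have : Cᶜ ⊆ A := by
          intro u hu
          rw [Finset.mem_compl] at hu
          by_cases huc : u = c
          · rw [huc]; exact hcA
          · exact (fol' u huc hu).1 hcA
        have := Finset.card_le_card this
        rw [Finset.card_compl, st.card, hV, I.cardC] at this
        omega
      · refine small C ?_ hv hy I.cardC.le
        intro u hu
        have huc : u ≠ c := fun e => hcA (e ▸ hu)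
        by_contra h
        exact hcA ((fol' u huc h).2 hu)
    · have := I.cardC; omega
  · have hX := I.card u0 hu0 hu0C
    have hcX := I.cen u0 hu0 hu0C
    have hXc := I.const u0 hu0 hu0C
    have hXd := I.disj u0 hu0 hu0C
    have hXi : (insert c (p u0)).card = s + 1 := by rw [Finset.card_insert_of_notMem hcX, hX]
    rcases Tight.split st hd (I.tight u0 hu0 hu0C) hx hy with ⟨hv, -, -⟩ | ⟨-, h2⟩
    · have same : ∀ u, u ≠ c → u ∉ C → u ∉ p u0 → ∀ w ∈ p u, w ∉ p u0 := by
        intro u huc huC hu w hw hw'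
        have e1 := I.const u huc huC w hw
        have e2 := hXc w hw'
        exact hu (by rw [← e2, e1]; exact I.self u huc huC)
      have hiC : ∀ w ∈ insert c (p u0), w ∉ C := by
        intro w hw
        simp only [Finset.mem_insert] at hw
        rcases hw with rfl | hw
        · exact I.cC
        · exact hXd w hw
      have ns : ∀ u, u ≠ c → u ∉ C → u ∉ p u0 →
          ¬ (x ∈ insert c (p u) ∧ y ∈ insert c (p u)) := by
        rintro u huc huC hu ⟨h1, h2⟩
        have := same u huc huC hu
        simp only [Finset.mem_insert] at hx hy h1 h2
        by_cases hxc : x = c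
        · have hyc : y ≠ c := fun e => hxy (hxc.trans e.symm)
          exact this y (h2.resolve_left hyc) (hy.resolve_left hyc)
        · exact this x (h1.resolve_left hxc) (hx.resolve_left hxc)
      refine small _ ?_ hv hy hXi.le
      intro u hu
      have huv : u ≠ v := fun e => st.vA (e ▸ hu)
      by_contra hun
      have hun' : u ≠ c ∧ u ∉ p u0 := by simpa using hun
      by_cases huC : u ∈ C
      · have hf := (Tight.unsplit st hd I.tightC (fun h => hiC x hx h.1)).2
        refine big C x (hiC x hx) st.xA (by rw [I.cardC]; omega) ?_
        intro w hw
        exact hf u huC w hw huv (fun e => hiC v hv (e ▸ hw)) hu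
      · have hf := fol u hun'.1 huC (ns u hun'.1 huC hun'.2)
        have hself := I.self u hun'.1 huC
        have hvu : v ∉ p u := by
          intro h
          have h1 := same u hun'.1 huC hun'.2 v h
          have h2 : v = c := by simpa [h1] using hv
          exact I.cen u hun'.1 huC (h2 ▸ h)
        have hall : p u ⊆ A := by
          intro w hw
          exact hf u (by simp [hself]) w (by simp [hw]) huv (fun e => hvu (e ▸ hw)) hu
        refine big (p u) x ?_ st.xA (I.card u hun'.1 huC).ge hall
        intro h
        have h1 := same u hun'.1 huC hun'.2 x h
        have h2 : x = c := by simpa [h1] using hx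
        exact I.cen u hun'.1 huC (h2 ▸ h)
    · omega

lemma Diss.not_dis {s t : ℕ} (hs : 2 ≤ s) (hst : s < t) (hV : Fintype.card V = s + t + 1)
    {H : SimpleGraph V} (hd : Diss s H) (C : Finset V) (c : V) (p : V → Finset V) :
    ¬ InvDis s H C c p := by
  intro I
  cases hd with
  | bot => exact not_tight_bot _ I.tightC
  | step st hd => exact I.step hs hst hV st hd

/-- Main configuration: a tight set `R` with tight blocks `p u` of size `s` attached at hinges
`h u` in `R`. -/
structure InvMain (s : ℕ) (H : SimpleGraph V) (R : Finset V) (p : V → Finset V) (h : V → V) :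
    Prop where
  tightR : Tight H R
  self : ∀ u, u ∉ R → u ∈ p u
  disj : ∀ u, u ∉ R → ∀ w ∈ p u, w ∉ R
  card : ∀ u, u ∉ R → (p u).card = s
  hinge : ∀ u, u ∉ R → h u ∈ R
  tight : ∀ u, u ∉ R → Tight H (insert (h u) (p u))
  const : ∀ u, u ∉ R → ∀ w ∈ p u, p w = p u ∧ h w = h u
  edge : ∀ a b, H.Adj a b → (a ∈ R ∧ b ∈ R) ∨
    ∃ u, u ∉ R ∧ a ∈ insert (h u) (p u) ∧ b ∈ insert (h u) (p u)

lemma InvMain.step {s t : ℕ} (hs : 2 ≤ s) (hst : s < t) (hV : Fintype.card V = s + t + 1)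
    {H : SimpleGraph V} {x y v : V} {A : Finset V}
    (st : StepAt s H x y v A) (hd : Diss s (delE H x y)) {R : Finset V}
    {p : V → Finset V} {h : V → V} (I : InvMain s H R p h) :
    (∃ R' p' h', InvMain s (delE H x y) R' p' h') ∨ (∃ c p', InvStar s (delE H x y) c p') ∨
      (∃ C c p', InvDis s (delE H x y) C c p') := by
  have hxy : x ≠ y := st.adj.ne
  have hxv : x ≠ v := fun e => st.vA (e ▸ st.xA)
  have hAc := st.card
  have small : ∀ B : Finset V, A ⊆ B → v ∈ B → y ∈ B → B.card ≤ s + 1 → False := by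
    intro B hAB hvB hyB hB
    have h1 : A ⊆ (B.erase v).erase y := by
      intro u hu
      simp only [Finset.mem_erase]
      exact ⟨fun e => st.yA (e ▸ hu), fun e => st.vA (e ▸ hu), hAB hu⟩
    have h2 := Finset.card_le_card h1
    rw [Finset.card_erase_of_mem (by simp [hyB, st.yv]), Finset.card_erase_of_mem hvB] at h2
    omega
  have big : ∀ B : Finset V, ∀ z, z ∉ B → z ∈ A → s ≤ B.card → ¬ B ⊆ A := by
    intro B z hz hzA hB hBA
    have h1 : insert z B ⊆ A := Finset.insert_subset hzA hBA
    have h2 := Finset.card_le_card h1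
    rw [Finset.card_insert_of_notMem hz] at h2
    omega
  have same : ∀ u u', u ∉ R → u' ∉ R → u ∉ p u' → ∀ w ∈ p u, w ∉ p u' := by
    intro u u' hu hu' hn w hw hw'
    have e1 := (I.const u hu w hw).1
    have e2 := (I.const u' hu' w hw').1
    exact hn (by rw [← e2, e1]; exact I.self u hu)
  have hp : ∀ u, u ∉ R → h u ∉ p u := fun u hu hm => I.disj u hu _ hm (I.hinge u hu)
  rcases I.edge x y st.adj with ⟨hx, hy⟩ | ⟨u0, hu0, hx, hy⟩
  · have ns : ∀ u, u ∉ R → ¬ (x ∈ insert (h u) (p u) ∧ y ∈ insert (h u) (p u)) := by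
      rintro u hu ⟨h1, h2⟩
      simp only [Finset.mem_insert] at h1 h2
      have h1' := h1.resolve_right (fun hm => I.disj u hu _ hm hx)
      have h2' := h2.resolve_right (fun hm => I.disj u hu _ hm hy)
      exact hxy (h1'.trans h2'.symm)
    have un := fun u hu => Tight.unsplit st hd (I.tight u hu) (ns u hu)
    rcases Tight.split st hd I.tightR hx hy with ⟨hv, t1, t2⟩ | ⟨hv, h2⟩
    · left
      have hnA : ∀ u, u ∉ R → u ∉ A := by
        intro u hu huA
        have huv : u ≠ v := fun e => hu (e ▸ hv)
        refine big (p u) x (fun hm => I.disj u hu _ hm hx) st.xA (I.card u hu).ge ?_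
        intro w hw
        exact (un u hu).2 u (by simp [I.self u hu]) w (by simp [hw]) huv
          (fun e => I.disj u hu w hw (e ▸ hv)) huA
      have hAR : A ⊆ R := by
        intro u hu
        by_contra hn
        exact hnA u hn hu
      have hhA : ∀ u, u ∉ R → h u ∉ A := by
        intro u hu hm
        have huv : u ≠ v := fun e => hu (e ▸ hv)
        exact hnA u hu ((un u hu).2 (h u) (by simp) u (by simp [I.self u hu])
          (fun e => st.vA (e ▸ hm)) huv hm)
      have r1 : R ∩ insert v A = insert v A := by
        apply Finset.inter_eq_right.2
        exact Finset.insert_subset hv hAR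
      rw [r1] at t1
      have nR : ∀ u, u ∉ R \ A → u ∉ A → u ∉ R := by
        intro u hu hA hR
        exact hu (by simp [hR, hA])
      refine ⟨R \ A, fun u => if u ∈ A then A else p u, fun u => if u ∈ A then v else h u, ?_⟩
      constructor
      · exact t2
      · intro u hu
        split_ifs with a
        · exact a
        · exact I.self u (nR u hu a)
      · intro u hu w hw
        split_ifs at hw with a
        · simp [hw]
        · have := I.disj u (nR u hu a) w hw
          simp [this]
      · intro u hu
        split_ifs with a
        · exact hAc
        · exact I.card u (nR u hu a)
      · intro u hu
        split_ifs with a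
        · simp [hv, st.vA]
        · have := hhA u (nR u hu a)
          simp [this, I.hinge u (nR u hu a)]
      · intro u hu
        split_ifs with a
        · exact t1
        · exact (un u (nR u hu a)).1
      · intro u hu w hw
        by_cases a : u ∈ A
        · simp only [a, if_true] at hw ⊢
          simp [hw]
        · simp only [a, if_false] at hw ⊢
          have hw' : w ∉ A := fun hm => I.disj u (nR u hu a) w hw (hAR hm)
          simp only [hw', if_false]
          exact I.const u (nR u hu a) w hw
      · intro a b hab
        rw [delE_adj] at hab
        have c1 := st.cross a
        have c2 := st.cross b
        rcases I.edge a b hab.1 with ⟨ha, hb⟩ | ⟨u, hu, ha, hb⟩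
        · by_cases haA : a ∈ A
          · right
            refine ⟨a, by simp [haA], ?_⟩
            simp only [haA, if_true, Finset.mem_insert, or_true, true_and]
            by_contra hn
            rw [not_or] at hn
            exact hab.2.1 (c1 haA b hn.2 hn.1 hab.1)
          · by_cases hbA : b ∈ A
            · right
              refine ⟨b, by simp [hbA], ?_⟩
              simp only [hbA, if_true, Finset.mem_insert, or_true, and_true]
              by_contra hn
              rw [not_or] at hn
              exact hab.2.2 (c2 hbA a hn.2 hn.1 hab.1.symm).symm
            · left; simp [ha, hb, haA, hbA]
        · right
          refine ⟨u, by simp [hu], ?_⟩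
          simp only [hnA u hu, if_false]
          exact ⟨ha, hb⟩
    · right; right
      have hR : R = {x, y} := by
        symm
        apply Finset.eq_of_subset_of_card_le
        · intro w hw
          simp only [Finset.mem_insert, Finset.mem_singleton] at hw
          rcases hw with rfl | rfl <;> assumption
        · rw [h2, Finset.card_pair hxy]
      have hhR : ∀ u, u ∉ R → h u = x ∨ h u = y := by
        intro u hu
        have := I.hinge u hu
        rw [hR] at this
        simpa using this
      have hhv : ∀ u, u ∉ R → h u ≠ v := fun u hu e => hv (e ▸ I.hinge u hu)
      have fol : ∀ u, u ∉ R → u ≠ v → (h u ∈ A ↔ u ∈ A) := by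
        intro u hu huv
        have hm : u ∈ insert (h u) (p u) := by simp [I.self u hu]
        exact ⟨(un u hu).2 _ (by simp) _ hm (hhv u hu) huv,
          (un u hu).2 _ hm _ (by simp) huv (hhv u hu)⟩
      have hvv := I.self v hv
      have oth : ∀ u, u ∉ R → u ∉ p v → h u = y := by
        intro u hu hn
        refine (hhR u hu).resolve_left ?_
        intro hux
        refine big (p u) x (fun hm => I.disj u hu _ hm hx) st.xA (I.card u hu).ge ?_
        intro w hw
        have hwR := I.disj u hu w hw
        have hwv : w ≠ v := by
          rintro rfl
          exact same u w hu hv hn w hw hvv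
        apply (fol w hwR hwv).1
        rw [(I.const u hu w hw).2, hux]
        exact st.xA
      have hvx : h v = x := by
        refine (hhR v hv).resolve_right ?_
        intro hvy
        have hA1 : A ⊆ {x} := by
          intro u hu
          rw [Finset.mem_singleton]
          by_contra hne
          have huv : u ≠ v := fun e => st.vA (e ▸ hu)
          have huy : u ≠ y := fun e => st.yA (e ▸ hu)
          have huR : u ∉ R := by rw [hR]; simp [hne, huy]
          have hhy : h u = y := by
            by_cases hm : u ∈ p v
            · rw [(I.const v hv u hm).2, hvy]
            · exact oth u huR hm
          have := (fol u huR huv).2 hu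
          rw [hhy] at this
          exact st.yA this
        have := Finset.card_le_card hA1
        rw [hAc, Finset.card_singleton] at this
        omega
      have hxZ : x ∉ p v := fun hm => I.disj v hv _ hm hx
      have hyZ : y ∉ p v := fun hm => I.disj v hv _ hm hy
      have nR : ∀ u, u ≠ y → u ∉ insert x (p v) → u ∉ R ∧ u ∉ p v := by
        intro u huy hu
        simp only [Finset.mem_insert, not_or] at hu
        refine ⟨?_, hu.2⟩
        rw [hR]; simp [hu.1, huy]
      have hyC : y ∉ insert x (p v) := by simp [hyZ, hxy.symm]
      refine ⟨insert x (p v), y, p, ?_⟩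
      constructor
      · exact hyC
      · rw [Finset.card_insert_of_notMem hxZ, I.card v hv]
      · have := (un v hv).1
        rwa [hvx] at this
      · intro u hu hn
        exact I.self u (nR u hu hn).1
      · intro u hu hn hm
        exact I.disj u (nR u hu hn).1 _ hm hy
      · intro u hu hn w hw
        simp only [Finset.mem_insert, not_or]
        refine ⟨?_, same u v (nR u hu hn).1 hv (nR u hu hn).2 w hw⟩
        rintro rfl
        exact I.disj u (nR u hu hn).1 _ hw hx
      · intro u hu hn
        exact I.card u (nR u hu hn).1
      · intro u hu hn
        have := (un u (nR u hu hn).1).1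
        rwa [oth u (nR u hu hn).1 (nR u hu hn).2] at this
      · intro u hu hn w hw
        exact (I.const u (nR u hu hn).1 w hw).1
      · intro a b hab
        rw [delE_adj] at hab
        rcases I.edge a b hab.1 with ⟨ha, hb⟩ | ⟨u, hu, ha, hb⟩
        · exfalso
          have hne := hab.1.ne
          rw [hR] at ha hb
          simp only [Finset.mem_insert, Finset.mem_singleton] at ha hb
          rcases ha with rfl | rfl <;> rcases hb with rfl | rfl <;> simp_all
        · by_cases hm : u ∈ p v
          · left
            rw [(I.const v hv u hm).1, (I.const v hv u hm).2, hvx] at ha hb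
            exact ⟨ha, hb⟩
          · right
            rw [oth u hu hm] at ha hb
            refine ⟨u, fun e => hu (e ▸ hy), ?_, ha, hb⟩
            simp only [Finset.mem_insert, not_or]
            exact ⟨fun e => hu (e ▸ hx), hm⟩
  · have hX := I.card u0 hu0
    have hXc := I.const u0 hu0
    have hXd := I.disj u0 hu0
    have hhX := hp u0 hu0
    have hh0 := I.hinge u0 hu0
    have hXi : (insert (h u0) (p u0)).card = s + 1 := by
      rw [Finset.card_insert_of_notMem hhX, hX]
    obtain ⟨z, hzX, hz⟩ : ∃ z ∈ p u0, z = x ∨ z = y := by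
      simp only [Finset.mem_insert] at hx hy
      by_cases hxc : x = h u0
      · have hyc : y ≠ h u0 := fun e => hxy (hxc.trans e.symm)
        exact ⟨y, hy.resolve_left hyc, Or.inr rfl⟩
      · exact ⟨x, hx.resolve_left hxc, Or.inl rfl⟩
    have nsT : ∀ T : Finset V, z ∉ T → ¬ (x ∈ T ∧ y ∈ T) := by
      rintro T hT ⟨h1, h2⟩
      rcases hz with rfl | rfl
      · exact hT h1
      · exact hT h2
    have unR := Tight.unsplit st hd I.tightR (nsT R (hXd z hzX))
    have un : ∀ u, u ∉ R → u ∉ p u0 → _ := fun u hu hn =>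
      Tight.unsplit st hd (I.tight u hu) (nsT _ (by
        simp only [Finset.mem_insert, not_or]
        refine ⟨fun e => hXd z hzX (e ▸ I.hinge u hu), fun hm => ?_⟩
        exact same u u0 hu hu0 hn z hm hzX))
    rcases Tight.split st hd (I.tight u0 hu0) hx hy with ⟨hv, t1, t2⟩ | ⟨-, h2⟩
    swap
    · omega
    by_cases hvh : v = h u0
    · right; left
      have hvR : v ∈ R := hvh ▸ hh0
      have hx' : x ∈ p u0 := by simpa [← hvh, hxv] using hx
      have hy' : y ∈ p u0 := by simpa [← hvh, st.yv] using hy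
      have hvX : v ∉ p u0 := hvh ▸ hhX
      have hnA : ∀ u, u ∉ R → u ∉ p u0 → u ∉ A := by
        intro u hu hn huA
        have huv : u ≠ v := fun e => hu (e ▸ hvR)
        refine big (p u) x (fun hm => same u u0 hu hu0 hn x hm hx') st.xA (I.card u hu).ge ?_
        intro w hw
        exact (un u hu hn).2 u (by simp [I.self u hu]) w (by simp [hw]) huv
          (fun e => I.disj u hu w hw (e ▸ hvR)) huA
      have hRA : R.erase v ⊆ A := by
        by_contra hcon
        refine small _ ?_ hv hy hXi.le
        intro u hu
        have huv : u ≠ v := fun e => st.vA (e ▸ hu)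
        rw [Finset.mem_insert]; right
        by_cases huR : u ∈ R
        · exfalso
          apply hcon
          intro w hw
          rw [Finset.mem_erase] at hw
          exact unR.2 u huR w hw.2 huv hw.1 hu
        · by_contra hn
          exact hnA u huR hn hu
      have hhv : ∀ u, u ∉ R → u ∉ p u0 → h u = v := by
        intro u hu hn
        by_contra hne
        have huv : u ≠ v := fun e => hu (e ▸ hvR)
        have h1 : h u ∈ A := hRA (by simp [hne, I.hinge u hu])
        exact hnA u hu hn ((un u hu hn).2 (h u) (by simp) u (by simp [I.self u hu]) hne huv h1)
      rw [← hvh] at t1 t2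
      have r1 : insert v (p u0) ∩ insert v A = insert v (p u0 ∩ A) := by
        ext w; simp only [Finset.mem_inter, Finset.mem_insert]; tauto
      have r2 : insert v (p u0) \ A = insert v (p u0 \ A) := by
        ext w; simp only [Finset.mem_sdiff, Finset.mem_insert]
        have := st.vA
        constructor
        · tauto
        · rintro (rfl | h)
          · exact ⟨Or.inl rfl, this⟩
          · tauto
      rw [r1] at t1
      rw [r2] at t2
      refine ⟨v, fun u => if u ∈ R then R.erase v else if u ∈ p u0 then
        (if u ∈ A then p u0 ∩ A else p u0 \ A) else p u, ?_⟩
      constructor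
      · intro u hu
        split_ifs with a b c
        · simp [a, hu]
        · simp [b, c]
        · simp [b, c]
        · exact I.self u a
      · intro u hu
        split_ifs with a b c
        · simp
        · simp [hvX]
        · simp [hvX]
        · exact fun hm => I.disj u a _ hm hvR
      · intro u hu
        split_ifs with a b c
        · exact (Finset.card_le_card hRA).trans hAc.le
        · exact (Finset.card_le_card Finset.inter_subset_left).trans hX.le
        · exact (Finset.card_le_card Finset.sdiff_subset).trans hX.le
        · exact (I.card u a).le
      · intro u hu
        split_ifs with a b c
        · rw [Finset.insert_erase hvR]; exact unR.1
        · exact t1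
        · exact t2
        · have := (un u a b).1
          rwa [hhv u a b] at this
      · intro u hu w hw
        by_cases a : u ∈ R
        · simp only [a, if_true, Finset.mem_erase] at hw ⊢
          simp [hw.2]
        by_cases b : u ∈ p u0
        · by_cases c : u ∈ A
          · simp only [a, b, c, if_true, if_false, Finset.mem_inter] at hw ⊢
            simp [hw.1, hw.2, hXd w hw.1]
          · simp only [a, b, c, if_true, if_false, Finset.mem_sdiff] at hw ⊢
            simp [hw.1, hw.2, hXd w hw.1]
        · simp only [a, b, if_false] at hw ⊢
          have h1 := I.disj u a w hw
          have h2 := same u u0 a hu0 b w hw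
          simp only [h1, h2, if_false]
          exact (I.const u a w hw).1
      · intro a b hab ha hb
        rw [delE_adj] at hab
        have c1 := st.cross a
        have c2 := st.cross b
        have hba := hab.1.symm
        rcases I.edge a b hab.1 with ⟨haR, hbR⟩ | ⟨u, hu, hau, hbu⟩
        · simp [haR, hbR, hb]
        · by_cases hm : u ∈ p u0
          · rw [(hXc u hm).1, (hXc u hm).2, ← hvh] at hau hbu
            have ha' : a ∈ p u0 := by simpa [ha] using hau
            have hb' : b ∈ p u0 := by simpa [hb] using hbu
            simp only [hXd a ha', ha', if_true, if_false]
            split_ifs with h2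
            · have : b ∈ A := by
                by_contra h3
                exact hab.2.1 (c1 h2 b h3 hb hab.1)
              simp [hb', this]
            · have : b ∉ A := by
                intro h3
                exact hab.2.2 (c2 h3 a h2 ha hba).symm
              simp [hb', this]
          · rw [hhv u hu hm] at hau hbu
            have ha' : a ∈ p u := by simpa [ha] using hau
            have hb' : b ∈ p u := by simpa [hb] using hbu
            have h1 := I.disj u hu a ha'
            have h2 := same u u0 hu hu0 hm a ha'
            simp only [h1, h2, if_false]
            rw [(I.const u hu a ha').1]
            exact hb'
    · exfalso
      have hvX : v ∈ p u0 := by simpa [hvh] using hv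
      have hvR : v ∉ R := hXd v hvX
      have nv : ∀ w ∈ R, w ≠ v := fun w hw e => hvR (e ▸ hw)
      have fol : ∀ u, u ∉ p u0 → (h u0 ∈ A ↔ u ∈ A) := by
        intro u hn
        by_cases hu : u ∈ R
        · exact ⟨unR.2 _ hh0 _ hu (nv _ hh0) (nv _ hu), unR.2 _ hu _ hh0 (nv _ hu) (nv _ hh0)⟩
        · have hh := I.hinge u hu
          have huv : u ≠ v := fun e => hn (e ▸ hvX)
          have hm : u ∈ insert (h u) (p u) := by simp [I.self u hu]
          have f := (un u hu hn).2
          constructor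
          · intro hA
            exact f (h u) (by simp) u hm (nv _ hh) huv (unR.2 _ hh0 _ hh (nv _ hh0) (nv _ hh) hA)
          · intro hA
            exact unR.2 _ hh _ hh0 (nv _ hh) (nv _ hh0) (f u hm (h u) (by simp) huv (nv _ hh) hA)
      by_cases hA : h u0 ∈ A
      · have : (p u0)ᶜ ⊆ A := by
          intro u hu
          rw [Finset.mem_compl] at hu
          exact (fol u hu).1 hA
        have := Finset.card_le_card this
        rw [Finset.card_compl, st.card, hV, hX] at this
        omega
      · refine small _ ?_ hv hy hXi.le
        intro u hu
        rw [Finset.mem_insert]; right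
        by_contra hn
        exact hA ((fol u hn).2 hu)

lemma Diss.not_main {s t : ℕ} (hs : 2 ≤ s) (hst : s < t) (hV : Fintype.card V = s + t + 1)
    {H : SimpleGraph V} (hd : Diss s H) : ∀ R p h, ¬ InvMain s H R p h := by
  induction hd with
  | bot =>
    intro R p h I
    exact not_tight_bot _ I.tightR
  | step st hd ih =>
    intro R p h I
    rcases I.step hs hst hV st hd with ⟨R', p', h', I'⟩ | ⟨c, p', I'⟩ | ⟨C, c, p', I'⟩
    · exact ih _ _ _ I'
    · exact hd.not_star hs hst hV _ _ I'
    · exact hd.not_dis hs hst hV _ _ _ I'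

lemma Diss.card_le {s t : ℕ} (hs : 2 ≤ s) (hst : s < t) (hV : Fintype.card V = s + t + 1)
    {H : SimpleGraph V} (hd : Diss s H) : H.edgeSet.ncard ≤ 2 * s + 2 * t - 2 := by
  classical
  have h1 : e2 H Finset.univ = 2 * H.edgeSet.ncard := by
    rw [← SimpleGraph.coe_edgeFinset, Set.ncard_coe_finset, SimpleGraph.two_mul_card_edgeFinset]
    unfold e2
    congr 1
  by_contra hcon
  refine hd.not_main hs hst hV Finset.univ (fun _ => ∅) id ?_
  have ht : Tight H Finset.univ := by
    refine ⟨by rw [Finset.card_univ]; omega, ?_⟩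
    rw [Finset.card_univ, h1, hV]
    omega
  constructor <;> simp [ht]

lemma step_of_add {s t : ℕ} (hV : Fintype.card V = s + t + 1) {G G' : SimpleGraph V}
    (h : AddStep (completeBipartiteGraph (Fin s) (Fin t)) G G') :
    ∃ x y v A, StepAt s Gᶜ x y v A ∧ delE Gᶜ x y = G'ᶜ := by
  obtain ⟨e, heG, hG', f, hf, a0, b0, hab0, he⟩ := h
  obtain ⟨i, j, he⟩ : ∃ i j, s(f (Sum.inl i), f (Sum.inr j)) = e := by
    rcases a0 with i | i <;> rcases b0 with j | j
    · simp at hab0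
    · exact ⟨i, j, he⟩
    · exact ⟨j, i, by rw [Sym2.eq_swap]; exact he⟩
    · simp at hab0
  subst he
  have hadj : ∀ a b, G'.Adj a b ↔
      (s(a, b) = s(f (Sum.inl i), f (Sum.inr j)) ∨ G.Adj a b) := by
    intro a b
    rw [← SimpleGraph.mem_edgeSet, hG', Set.mem_insert_iff, SimpleGraph.mem_edgeSet]
  let A : Finset V := Finset.univ.image (fun i => f (Sum.inl i))
  have hA : A.card = s := by
    simp only [A]
    rw [Finset.card_image_of_injective _ (fun a b hab => by simpa using hab)]
    simp
  have hU : (Finset.univ.map f).card = s + t := by simp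
  obtain ⟨v, hv⟩ : ∃ v, v ∉ Finset.univ.map f := by
    by_contra hcon
    push Not at hcon
    have := Finset.card_le_card (fun w _ => hcon w : (Finset.univ : Finset V) ⊆ _)
    rw [hU, Finset.card_univ, hV] at this
    omega
  have hins : insert v (Finset.univ.map f) = Finset.univ := by
    rw [← Finset.card_eq_iff_eq_univ, Finset.card_insert_of_notMem hv, hU, hV]
  have hB : ∀ b, b ∉ A → b ≠ v → ∃ j, b = f (Sum.inr j) := by
    intro b hbA hbv
    have : b ∈ insert v (Finset.univ.map f) := by rw [hins]; simp
    simp only [Finset.mem_insert, hbv, Finset.mem_map, Finset.mem_univ, true_and, false_or] at this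
    obtain ⟨(k | k), rfl⟩ := this
    · exact absurd (by simp [A]) hbA
    · exact ⟨k, rfl⟩
  have hne : f (Sum.inl i) ≠ f (Sum.inr j) := by simp
  refine ⟨f (Sum.inl i), f (Sum.inr j), v, A, ?_, ?_⟩
  · constructor
    · exact hA
    · intro hm
      simp only [A, Finset.mem_image, Finset.mem_univ, true_and] at hm
      obtain ⟨k, rfl⟩ := hm
      exact hv (by simp)
    · simp [A]
    · simp [A]
    · rintro rfl; exact hv (by simp)
    · rw [SimpleGraph.compl_adj]
      exact ⟨hne, heG⟩
    · intro a ha b hb hbv hab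
      obtain ⟨l, rfl⟩ := hB b hb hbv
      simp only [A, Finset.mem_image, Finset.mem_univ, true_and] at ha
      obtain ⟨k, rfl⟩ := ha
      have h1 := hf (Sum.inl k) (Sum.inr l) (by simp)
      have h2 := ((hadj _ _).1 h1).resolve_right ((SimpleGraph.compl_adj _ _ _).1 hab).2
      simpa using h2
  · ext a b
    rw [delE_adj, SimpleGraph.compl_adj, SimpleGraph.compl_adj, hadj, Sym2.eq_iff]
    tauto

lemma add_of_step {s t : ℕ} (hV : Fintype.card V = s + t + 1) {H : SimpleGraph V}
    {x y v : V} {A : Finset V} (st : StepAt s H x y v A) :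
    AddStep (completeBipartiteGraph (Fin s) (Fin t)) Hᶜ (delE H x y)ᶜ := by
  have hxy := st.adj.ne
  let B : Finset V := (insert v A)ᶜ
  have hB : B.card = t := by
    simp only [B]
    rw [Finset.card_compl, Finset.card_insert_of_notMem st.vA, st.card, hV]; omega
  have hBm : ∀ b, b ∈ B ↔ b ≠ v ∧ b ∉ A := by intro b; simp [B]
  let g1 := (A.equivFinOfCardEq st.card).symm
  let g2 := (B.equivFinOfCardEq hB).symm
  have hadj : ∀ a b, a ∈ A → b ∈ B → (delE H x y)ᶜ.Adj a b := by
    intro a b ha hb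
    rw [hBm] at hb
    rw [SimpleGraph.compl_adj, delE_adj]
    refine ⟨fun e => hb.2 (e ▸ ha), ?_⟩
    rintro ⟨h1, h2, -⟩
    exact h2 (st.cross a ha b hb.2 hb.1 h1)
  have hyB : y ∈ B := (hBm y).2 ⟨st.yv, st.yA⟩
  have hinj : Function.Injective (Sum.elim (fun i => (g1 i : V)) (fun j => (g2 j : V))) := by
    have d : ∀ i j, (g1 i : V) ≠ (g2 j : V) := fun i j e =>
      ((hBm _).1 (g2 j).2).2 (e ▸ (g1 i).2)
    rintro (i | i) (j | j) h
    · simpa using h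
    · exact absurd h (d i j)
    · exact absurd h.symm (d j i)
    · simpa using h
  refine ⟨s(x, y), ?_, ?_, ⟨Sum.elim (fun i => (g1 i : V)) (fun j => (g2 j : V)), hinj⟩, ?_,
    Sum.inl (g1.symm ⟨x, st.xA⟩), Sum.inr (g2.symm ⟨y, hyB⟩), by simp, ?_⟩
  · simp [st.adj]
  · ext e
    induction e with
    | _ a b =>
      rw [Set.mem_insert_iff, SimpleGraph.mem_edgeSet, SimpleGraph.mem_edgeSet,
        SimpleGraph.compl_adj, SimpleGraph.compl_adj, delE_adj, Sym2.eq_iff]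
      have : (a = x ∧ b = y) → a ≠ b := by rintro ⟨rfl, rfl⟩; exact hxy
      have : (a = y ∧ b = x) → a ≠ b := by rintro ⟨rfl, rfl⟩; exact hxy.symm
      tauto
  · rintro (i | i) (j | j) h
    · simp at h
    · exact hadj _ _ (g1 i).2 (g2 j).2
    · exact (hadj _ _ (g1 j).2 (g2 i).2).symm
    · simp at h
  · change s((g1 (g1.symm ⟨x, st.xA⟩) : V), (g2 (g2.symm ⟨y, hyB⟩) : V)) = s(x, y)
    simp

lemma diss_of_chain {s t : ℕ} (hV : Fintype.card V = s + t + 1) (m : ℕ) :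
    ∀ c : ℕ → SimpleGraph V, c m = ⊤ →
      (∀ i < m, AddStep (completeBipartiteGraph (Fin s) (Fin t)) (c i) (c (i + 1))) →
      Diss s (c 0)ᶜ := by
  induction m with
  | zero =>
    intro c h _
    rw [h, compl_top]; exact Diss.bot
  | succ m ih =>
    intro c h hc
    have := ih (fun i => c (i + 1)) h (fun i hi => hc (i + 1) (by omega))
    obtain ⟨x, y, v, A, st, hd⟩ := step_of_add hV (hc 0 (by omega))
    refine Diss.step st ?_
    rw [hd]; exact this

/-- The saturation process ends in the complete graph. -/
def HasChain (s t : ℕ) (G : SimpleGraph V) : Prop :=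
  ∃ (m : ℕ) (c : ℕ → SimpleGraph V), c 0 = G ∧ c m = ⊤ ∧
    ∀ i < m, AddStep (completeBipartiteGraph (Fin s) (Fin t)) (c i) (c (i + 1))

lemma HasChain.cons {s t : ℕ} {G G' : SimpleGraph V}
    (h : AddStep (completeBipartiteGraph (Fin s) (Fin t)) G G') (hc : HasChain s t G') :
    HasChain s t G := by
  obtain ⟨m, c, h0, hm, hc⟩ := hc
  refine ⟨m + 1, fun i => Nat.casesOn i G c, rfl, hm, ?_⟩
  intro i hi
  cases i with
  | zero => simpa [h0] using h
  | succ i => exact hc i (by omega)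

lemma Diss.chain {s t : ℕ} (hV : Fintype.card V = s + t + 1) {H : SimpleGraph V}
    (hd : Diss s H) : HasChain s t Hᶜ := by
  induction hd with
  | bot => exact ⟨0, fun _ => ⊤, by simp, rfl, by simp⟩
  | step st _ ih => exact ih.cons (add_of_step hV st)

lemma compl_ncard (G : SimpleGraph V) :
    G.edgeSet.ncard + Gᶜ.edgeSet.ncard = (Fintype.card V).choose 2 := by
  classical
  have hd : Disjoint G.edgeSet Gᶜ.edgeSet :=
    SimpleGraph.disjoint_edgeSet.2 disjoint_compl_right
  rw [← Set.ncard_union_eq hd (Set.toFinite _) (Set.toFinite _), ← SimpleGraph.edgeSet_sup,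
    sup_compl_eq_top, ← SimpleGraph.card_edgeFinset_top_eq_card_choose_two,
    ← Set.ncard_coe_finset, SimpleGraph.coe_edgeFinset]

lemma HasChain.lower {s t : ℕ} (hs : 2 ≤ s) (hst : s < t) (hV : Fintype.card V = s + t + 1)
    {G : SimpleGraph V} (h : HasChain s t G) :
    (Fintype.card V).choose 2 ≤ G.edgeSet.ncard + (2 * s + 2 * t - 2) := by
  obtain ⟨m, c, h0, hm, hc⟩ := h
  have hd := diss_of_chain hV m c hm hc
  rw [h0] at hd
  have := hd.card_le hs hst hV
  have := compl_ncard G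
  omega

/-- If every nonempty subgraph admits a step then `H` dissolves. -/
lemma diss_of_sub {s : ℕ} {H : SimpleGraph V}
    (h : ∀ H' ≤ H, H' ≠ ⊥ → ∃ x y v A, StepAt s H' x y v A) : Diss s H := by
  generalize hn : H.edgeSet.ncard = n
  induction n using Nat.strong_induction_on generalizing H with
  | _ n ih =>
    by_cases hb : H = ⊥
    · rw [hb]; exact Diss.bot
    obtain ⟨x, y, v, A, st⟩ := h H le_rfl hb
    have hle : delE H x y ≤ H := SimpleGraph.deleteEdges_le _
    refine Diss.step st (ih _ ?_ (fun H' hH' => h H' (hH'.trans hle)) rfl)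
    rw [← hn]
    apply Set.ncard_lt_ncard _ (Set.toFinite _)
    rw [Set.ssubset_iff_of_subset (SimpleGraph.edgeSet_mono hle)]
    exact ⟨s(x, y), st.adj, by simp [delE]⟩

end WSatAux

section WSatConstr

lemma fin_card {n : ℕ} (A0 : Finset ℕ) (h : ∀ i ∈ A0, i < n) :
    (Finset.univ.filter (fun i : Fin n => (i : ℕ) ∈ A0)).card = A0.card := by
  refine Finset.card_bij (fun i _ => (i : ℕ)) ?_ ?_ ?_
  · intro i hi; simpa using hi
  · intro i _ j _ hij; exact Fin.ext hij
  · intro b hb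
    exact ⟨⟨b, h b hb⟩, by simpa using hb, rfl⟩

/-- Adjacency in terms of natural number labels. -/
def AdjN {n : ℕ} (H : SimpleGraph (Fin n)) (a b : ℕ) : Prop :=
  ∃ (ha : a < n) (hb : b < n), H.Adj ⟨a, ha⟩ ⟨b, hb⟩

lemma mkStep {n s : ℕ} {H : SimpleGraph (Fin n)} (x y v : ℕ) (A0 : Finset ℕ)
    (hc : A0.card = s) (hA : ∀ i ∈ A0, i < n) (hv : v < n) (hvA : v ∉ A0) (hx : x ∈ A0)
    (hy : y ∉ A0) (hyv : y ≠ v) (hQ : AdjN H x y)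
    (hcr : ∀ a ∈ A0, ∀ b, b ∉ A0 → b ≠ v → AdjN H a b → a = x ∧ b = y) :
    ∃ x y v A, StepAt s H x y v A := by
  obtain ⟨hxn, hyn, hadj⟩ := hQ
  refine ⟨⟨x, hxn⟩, ⟨y, hyn⟩, ⟨v, hv⟩, Finset.univ.filter (fun i : Fin n => (i : ℕ) ∈ A0), ?_⟩
  constructor
  · rw [fin_card A0 hA, hc]
  · simpa using hvA
  · simpa using hx
  · simpa using hy
  · simpa using hyv
  · exact hadj
  · intro a ha b hb hbv hab
    have := hcr a (by simpa using ha) b (by simpa using hb)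
      (fun e => hbv (Fin.ext e)) ⟨a.2, b.2, hab⟩
    exact ⟨Fin.ext this.1, Fin.ext this.2⟩

/-- Edges (with increasing endpoints) of the extremal complement graph. -/
def ER (s t a b : ℕ) : Prop :=
  (b = a + 1 ∧ b < s + t) ∨ (b = s + t ∧ a ≤ t ∧ a < b) ∨ (a = t ∧ t + 1 < b ∧ b < s + t)

/-- The extremal complement graph. -/
def HE (s t : ℕ) : SimpleGraph (Fin (s + t + 1)) where
  Adj a b := ER s t a b ∨ ER s t b a
  symm := ⟨fun _ _ h => h.symm⟩
  loopless := ⟨fun a h => by unfold ER at h; omega⟩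

set_option maxHeartbeats 4000000 in
lemma HE_step (s t : ℕ) (hs : 2 < s) (hst : s < t) (hgcd : Nat.gcd s t = 1)
    (H : SimpleGraph (Fin (s + t + 1))) (hH : H ≤ HE s t) (hne : H ≠ ⊥) :
    ∃ x y v A, StepAt s H x y v A := by
  have sym : ∀ a b, AdjN H a b → AdjN H b a := by
    rintro a b ⟨ha, hb, h⟩; exact ⟨hb, ha, h.symm⟩
  have base : ∀ a b, AdjN H a b → ER s t a b ∨ ER s t b a := by
    rintro a b ⟨ha, hb, h⟩; exact hH h
  simp only [ER] at base
  by_cases h0 : AdjN H t (t - 1)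
  · refine mkStep t (t - 1) (s + t) (Finset.Ico t (s + t)) ?_ ?_ ?_ ?_ ?_ ?_ ?_ h0 ?_
    · simp
    · intro i hi; simp only [Finset.mem_Ico] at hi; omega
    · omega
    · simp
    · simp only [Finset.mem_Ico]; omega
    · simp only [Finset.mem_Ico]; omega
    · omega
    · intro a ha b hb hbv hab
      simp only [Finset.mem_Ico] at ha hb
      rcases base a b hab with (hh | hh | hh) | (hh | hh | hh) <;> omega
  have n0 : ∀ a b, AdjN H a b → ¬ (a = t ∧ b + 1 = t) ∧ ¬ (b = t ∧ a + 1 = t) := by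
    intro a b hab
    constructor
    · rintro ⟨h, h'⟩
      have e : b = t - 1 := by omega
      rw [h, e] at hab; exact h0 hab
    · rintro ⟨h, h'⟩
      have e : a = t - 1 := by omega
      have hba := sym _ _ hab
      rw [h, e] at hba; exact h0 hba
  by_cases h1 : ∃ b, 1 ≤ b ∧ b < t ∧ AdjN H (b - 1) b
  · have hex : ∃ i, 1 ≤ (i * s) % t ∧ AdjN H ((i * s) % t - 1) ((i * s) % t) := by
      obtain ⟨b, hb1, hb2, hb3⟩ := h1
      obtain ⟨i, hi⟩ : ∃ i, (i * s) % t = b := by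
        obtain ⟨m, hm⟩ := Nat.exists_mul_mod_eq_one_of_coprime hgcd (by omega)
        refine ⟨m * b, ?_⟩
        have : m * b * s = (s * m) * b := by ring
        rw [this, Nat.mul_mod, hm.2, one_mul, Nat.mod_mod, Nat.mod_eq_of_lt hb2]
      exact ⟨i, by rw [hi]; exact ⟨hb1, hb3⟩⟩
    classical
    have hsp := Nat.find_spec hex
    have hmin := fun m => @Nat.find_min _ _ hex m
    generalize Nat.find hex = i at hsp hmin
    obtain ⟨k, rfl⟩ : ∃ k, i = k + 1 := by
      refine ⟨i - 1, ?_⟩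
      have : i ≠ 0 := by rintro rfl; simp at hsp
      omega
    have hk := hmin k (by omega)
    have hjt : (k * s) % t < t := Nat.mod_lt _ (by omega)
    have hmod : ((k + 1) * s) % t = ((k * s) % t + s) % t := by
      rw [add_mul, one_mul, Nat.mod_add_mod]
    rw [hmod] at hsp
    generalize (k * s) % t = j at hk hjt hsp
    have nj : ∀ a b, AdjN H a b → ¬ (a + 1 = j ∧ b = j) ∧ ¬ (b + 1 = j ∧ a = j) := by
      intro a b hab
      constructor
      · rintro ⟨h2, rfl⟩
        exact hk ⟨by omega, by rw [← h2]; simpa using (h2 ▸ hab)⟩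
      · rintro ⟨h2, rfl⟩
        exact hk ⟨by omega, by rw [← h2]; simpa using (h2 ▸ sym _ _ hab)⟩
    by_cases hj : j + s < t
    · rw [Nat.mod_eq_of_lt hj] at hsp
      refine mkStep (j + s - 1) (j + s) (s + t) (Finset.Ico j (j + s)) ?_ ?_ ?_ ?_ ?_ ?_ ?_
        hsp.2 ?_
      · simp
      · intro i hi; simp only [Finset.mem_Ico] at hi; omega
      · omega
      · simp only [Finset.mem_Ico]; omega
      · simp only [Finset.mem_Ico]; omega
      · simp only [Finset.mem_Ico]; omega
      · omega
      · intro a ha b hb hbv hab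
        have := nj a b hab
        have := n0 a b hab
        simp only [Finset.mem_Ico] at ha hb
        rcases base a b hab with (hh | hh | hh) | (hh | hh | hh) <;> omega
    · have hm : (j + s) % t = j + s - t := by
        rw [Nat.mod_eq_sub_mod (by omega), Nat.mod_eq_of_lt (by omega)]
      rw [hm] at hsp
      have hsp1 := hsp.1
      refine mkStep (j + s - t - 1) (j + s - t) (s + t)
        (Finset.Ico 0 (j + s - t) ∪ Finset.Ico j t) ?_ ?_ ?_ ?_ ?_ ?_ ?_
        hsp.2 ?_
      · rw [Finset.card_union_of_disjoint]
        · simp only [Nat.card_Ico]; omega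
        · rw [Finset.disjoint_left]
          intro i; simp only [Finset.mem_Ico]; omega
      · intro i hi; simp only [Finset.mem_union, Finset.mem_Ico] at hi; omega
      · omega
      · simp only [Finset.mem_union, Finset.mem_Ico]; omega
      · simp only [Finset.mem_union, Finset.mem_Ico]; omega
      · simp only [Finset.mem_union, Finset.mem_Ico]; omega
      · omega
      · intro a ha b hb hbv hab
        have := nj a b hab
        have := n0 a b hab
        simp only [Finset.mem_union, Finset.mem_Ico] at ha hb
        rcases base a b hab with (hh | hh | hh) | (hh | hh | hh) <;> omega
  have n1 : ∀ a b, AdjN H a b → ¬ (b = a + 1 ∧ b < t) ∧ ¬ (a = b + 1 ∧ a < t) := by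
    intro a b hab
    constructor
    · rintro ⟨rfl, h⟩
      exact h1 ⟨a + 1, by omega, h, by simpa using hab⟩
    · rintro ⟨rfl, h⟩
      exact h1 ⟨b + 1, by omega, h, by simpa using sym _ _ hab⟩
  by_cases h2 : ∃ l, l < t ∧ AdjN H l (s + t)
  · obtain ⟨l, hl, hQ⟩ := h2
    refine mkStep l (s + t) t (insert l (Finset.Ico (t + 1) (s + t))) ?_ ?_ ?_ ?_ ?_ ?_ ?_ hQ ?_
    · rw [Finset.card_insert_of_notMem]
      · simp only [Nat.card_Ico]; omega
      · simp only [Finset.mem_Ico]; omega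
    · intro i hi; simp only [Finset.mem_insert, Finset.mem_Ico] at hi; omega
    · omega
    · simp only [Finset.mem_insert, Finset.mem_Ico]; omega
    · simp
    · simp only [Finset.mem_insert, Finset.mem_Ico]; omega
    · omega
    · intro a ha b hb hbv hab
      have := n0 a b hab
      have := n1 a b hab
      simp only [Finset.mem_insert, Finset.mem_Ico] at ha hb
      rcases base a b hab with (hh | hh | hh) | (hh | hh | hh) <;> omega
  have n2 : ∀ a b, AdjN H a b → ¬ (a < t ∧ b = s + t) ∧ ¬ (b < t ∧ a = s + t) := by
    intro a b hab
    constructor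
    · rintro ⟨h, rfl⟩
      exact h2 ⟨a, h, hab⟩
    · rintro ⟨h, rfl⟩
      exact h2 ⟨b, h, sym _ _ hab⟩
  by_cases h3 : ∃ q, t < q ∧ q + 1 < s + t ∧ AdjN H q (q + 1)
  · obtain ⟨q, hq1, hq2, hQ⟩ := h3
    refine mkStep q (q + 1) t (Finset.Ico 0 (s + t - q) ∪ Finset.Ico (t + 1) (q + 1))
      ?_ ?_ ?_ ?_ ?_ ?_ ?_ hQ ?_
    · rw [Finset.card_union_of_disjoint]
      · simp only [Nat.card_Ico]; omega
      · rw [Finset.disjoint_left]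
        intro i; simp only [Finset.mem_Ico]; omega
    · intro i hi; simp only [Finset.mem_union, Finset.mem_Ico] at hi; omega
    · omega
    · simp only [Finset.mem_union, Finset.mem_Ico]; omega
    · simp only [Finset.mem_union, Finset.mem_Ico]; omega
    · simp only [Finset.mem_union, Finset.mem_Ico]; omega
    · omega
    · intro a ha b hb hbv hab
      have := n0 a b hab
      have := n1 a b hab
      have := n2 a b hab
      simp only [Finset.mem_union, Finset.mem_Ico] at ha hb
      rcases base a b hab with (hh | hh | hh) | (hh | hh | hh) <;> omega
  have n3 : ∀ a b, AdjN H a b →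
      ¬ (t < a ∧ b = a + 1 ∧ b < s + t) ∧ ¬ (t < b ∧ a = b + 1 ∧ a < s + t) := by
    intro a b hab
    constructor
    · rintro ⟨h, rfl, h'⟩
      exact h3 ⟨a, h, h', hab⟩
    · rintro ⟨h, rfl, h'⟩
      exact h3 ⟨b, h, h', sym _ _ hab⟩
  by_cases h4 : ∃ q, t < q ∧ q < s + t ∧ AdjN H q t
  · obtain ⟨q, hq1, hq2, hQ⟩ := h4
    refine mkStep q t (s + t) (insert q (Finset.Ico 0 (s - 1))) ?_ ?_ ?_ ?_ ?_ ?_ ?_ hQ ?_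
    · rw [Finset.card_insert_of_notMem]
      · simp only [Nat.card_Ico]; omega
      · simp only [Finset.mem_Ico]; omega
    · intro i hi; simp only [Finset.mem_insert, Finset.mem_Ico] at hi; omega
    · omega
    · simp only [Finset.mem_insert, Finset.mem_Ico]; omega
    · simp
    · simp only [Finset.mem_insert, Finset.mem_Ico]; omega
    · omega
    · intro a ha b hb hbv hab
      have := n0 a b hab
      have := n1 a b hab
      have := n2 a b hab
      have := n3 a b hab
      simp only [Finset.mem_insert, Finset.mem_Ico] at ha hb
      rcases base a b hab with (hh | hh | hh) | (hh | hh | hh) <;> omega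
  have n4 : ∀ a b, AdjN H a b →
      ¬ (t < a ∧ b = t ∧ a < s + t) ∧ ¬ (t < b ∧ a = t ∧ b < s + t) := by
    intro a b hab
    constructor
    · rintro ⟨h, rfl, h'⟩
      exact h4 ⟨a, h, h', hab⟩
    · rintro ⟨h, rfl, h'⟩
      exact h4 ⟨b, h, h', sym _ _ hab⟩
  by_cases h5 : AdjN H (s + t) t
  · refine mkStep (s + t) t (t + 1) (insert (s + t) (Finset.Ico 0 (s - 1)))
      ?_ ?_ ?_ ?_ ?_ ?_ ?_ h5 ?_
    · rw [Finset.card_insert_of_notMem]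
      · simp only [Nat.card_Ico]; omega
      · simp only [Finset.mem_Ico]; omega
    · intro i hi; simp only [Finset.mem_insert, Finset.mem_Ico] at hi; omega
    · omega
    · simp only [Finset.mem_insert, Finset.mem_Ico]; omega
    · simp
    · simp only [Finset.mem_insert, Finset.mem_Ico]; omega
    · omega
    · intro a ha b hb hbv hab
      have := n0 a b hab
      have := n1 a b hab
      have := n2 a b hab
      have := n3 a b hab
      simp only [Finset.mem_insert, Finset.mem_Ico] at ha hb
      rcases base a b hab with (hh | hh | hh) | (hh | hh | hh) <;> omega
  exfalso
  apply hne
  ext a b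
  simp only [SimpleGraph.bot_adj, iff_false]
  intro hadj
  have hab : AdjN H a b := ⟨a.2, b.2, hadj⟩
  have n5 : ¬ ((a : ℕ) = s + t ∧ (b : ℕ) = t) ∧ ¬ ((b : ℕ) = s + t ∧ (a : ℕ) = t) := by
    constructor
    · rintro ⟨ha, hb⟩
      rw [ha, hb] at hab
      exact h5 hab
    · rintro ⟨ha, hb⟩
      rw [ha, hb] at hab
      exact h5 (sym _ _ hab)
  have := n0 a b hab
  have := n1 a b hab
  have := n2 a b hab
  have := n3 a b hab
  have := n4 a b hab
  rcases base a b hab with (hh | hh | hh) | (hh | hh | hh) <;> omega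

lemma HE_card (s t : ℕ) (hs : 2 < s) : 2 * s + 2 * t - 2 ≤ (HE s t).edgeSet.ncard := by
  classical
  rw [← SimpleGraph.coe_edgeFinset, Set.ncard_coe_finset]
  let lo : ℕ → ℕ := fun k => if k < s + t - 1 then k else if k < s + t - 1 + (t + 1) then
    k - (s + t - 1) else t
  let hi : ℕ → ℕ := fun k => if k < s + t - 1 then k + 1 else if k < s + t - 1 + (t + 1) then
    s + t else k - (s + t - 1 + (t + 1)) + t + 2
  have hER : ∀ k, k < 2 * s + 2 * t - 2 → ER s t (lo k) (hi k) ∧ lo k < hi k ∧ hi k ≤ s + t := by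
    intro k hk
    simp only [lo, hi, ER]
    split_ifs <;> omega
  have hinj : ∀ k l, k < 2 * s + 2 * t - 2 → l < 2 * s + 2 * t - 2 → lo k = lo l →
      hi k = hi l → k = l := by
    intro k l hk hl
    simp only [lo, hi]
    split_ifs <;> omega
  have hcard : (Finset.range (2 * s + 2 * t - 2)).card = 2 * s + 2 * t - 2 := by simp
  rw [← hcard]
  refine Finset.card_le_card_of_injOn
    (fun k => s(Fin.ofNat (s + t + 1) (lo k), Fin.ofNat (s + t + 1) (hi k))) ?_ ?_
  · intro k hk
    have hk' : k < 2 * s + 2 * t - 2 := by simpa using hk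
    obtain ⟨h1, h2, h3⟩ := hER k hk'
    have e1 : lo k % (s + t + 1) = lo k := Nat.mod_eq_of_lt (by omega)
    have e2 : hi k % (s + t + 1) = hi k := Nat.mod_eq_of_lt (by omega)
    rw [Finset.mem_coe, SimpleGraph.mem_edgeFinset, SimpleGraph.mem_edgeSet]
    refine Or.inl ?_
    rw [Fin.val_ofNat, Fin.val_ofNat, e1, e2]
    exact h1
  · intro k hk l hl hkl
    have hk' : k < 2 * s + 2 * t - 2 := by simpa using hk
    have hl' : l < 2 * s + 2 * t - 2 := by simpa using hl
    obtain ⟨-, h2, h3⟩ := hER k hk'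
    obtain ⟨-, h5, h6⟩ := hER l hl'
    have e1 : lo k % (s + t + 1) = lo k := Nat.mod_eq_of_lt (by omega)
    have e2 : hi k % (s + t + 1) = hi k := Nat.mod_eq_of_lt (by omega)
    have e3 : lo l % (s + t + 1) = lo l := Nat.mod_eq_of_lt (by omega)
    have e4 : hi l % (s + t + 1) = hi l := Nat.mod_eq_of_lt (by omega)
    simp only [Sym2.eq_iff, Fin.ext_iff, Fin.val_ofNat, e1, e2, e3, e4] at hkl
    rcases hkl with ⟨a, b⟩ | ⟨a, b⟩
    · exact hinj k l hk' hl' a b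
    · omega

/-- A graph with a complete process and the minimum number of edges is `F`-free. -/
lemma free_of_min {s t : ℕ} (hs : 2 < s) (hst : s < t) (G : SimpleGraph (Fin (s + t + 1)))
    (hG : HasChain s t G)
    (hc : G.edgeSet.ncard + (2 * s + 2 * t - 2) ≤ (s + t + 1).choose 2) :
    ¬ ContainsCopy (completeBipartiteGraph (Fin s) (Fin t)) G := by
  rintro ⟨f, hf⟩
  have hab : (completeBipartiteGraph (Fin s) (Fin t)).Adj (Sum.inl ⟨0, by omega⟩)
      (Sum.inr ⟨0, by omega⟩) := by simp
  generalize (Sum.inl ⟨0, by omega⟩ : Fin s ⊕ Fin t) = a at hab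
  generalize (Sum.inr ⟨0, by omega⟩ : Fin s ⊕ Fin t) = b at hab
  have hadj := hf a b hab
  have hset : G.edgeSet = insert s(f a, f b) (delE G (f a) (f b)).edgeSet := by
    ext e
    by_cases he : e = s(f a, f b)
    · subst he; simpa using hadj
    · simp [delE, he]
  have hnot : s(f a, f b) ∉ (delE G (f a) (f b)).edgeSet := by simp [delE]
  have hch : HasChain s t (delE G (f a) (f b)) :=
    hG.cons ⟨s(f a, f b), hnot, hset, f, hf, a, b, hab, rfl⟩
  have h1 := hch.lower (by omega) hst (by simp)
  have h2 : G.edgeSet.ncard = (delE G (f a) (f b)).edgeSet.ncard + 1 := by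
    rw [hset, Set.ncard_insert_of_notMem hnot (Set.toFinite _)]
  rw [Fintype.card_fin] at h1
  omega

end WSatConstr

/-- For `t > s > 2` with `gcd(s,t) = 1`,
`wsat(s+t+1, K_{s,t}) = C(s+t+1,2) − (2s+2t−2)`. -/
theorem wsat_Kst_coprime (s t : ℕ) (hs : 2 < s) (hst : s < t) (hgcd : Nat.gcd s t = 1) :
    (wsat (s + t + 1) (completeBipartiteGraph (Fin s) (Fin t)) : ℤ) =
      ((s + t + 1).choose 2 : ℤ) - (2 * s + 2 * t - 2) := by
  have hV : Fintype.card (Fin (s + t + 1)) = s + t + 1 := by simp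
  have hd : Diss s (HE s t) := diss_of_sub (HE_step s t hs hst hgcd)
  have hch : HasChain s t (HE s t)ᶜ := hd.chain hV
  have c1 := HE_card s t hs
  have c2 := hd.card_le (by omega) hst hV
  have c3 := compl_ncard (HE s t)
  rw [hV] at c3
  have hfree := free_of_min hs hst _ hch (by omega)
  have key : wsat (s + t + 1) (completeBipartiteGraph (Fin s) (Fin t)) =
      (HE s t)ᶜ.edgeSet.ncard := by
    unfold wsat
    apply le_antisymm
    · exact Nat.sInf_le ⟨_, ⟨hfree, hch⟩, rfl⟩
    · refine le_csInf ⟨(HE s t)ᶜ.edgeSet.ncard, (HE s t)ᶜ, ⟨hfree, hch⟩, rfl⟩ ?_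
      rintro m ⟨G, ⟨-, hG⟩, rfl⟩
      have h1 := HasChain.lower (by omega) hst hV (G := G) hG
      rw [hV] at h1
      omega
  rw [key]
  omega
end
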